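/- Let P = A ∪ B be an ℓ-divided set of points in the plane in general position with no ℓ-divided 5-hole in P, with 5 ≤ |A| ≤ 6, |B| = 4, and with A in convex position. Then for every point a of A, if the non-convex a-wedge contains no point of B, then every a-wedge contains at most two points of B. -/

import Mathlib

noncomputable section

/-- Points of the plane. -/
abbrev Pt : Type := ℝ × ℝ

/-- The cross product (signed area) of two planar vectors. -/
def cross2 (u v : Pt) : ℝ := u.1 * v.2 - u.2 * v.1

/-- The dot product of two planar vectors. -/
def dotp (v p : Pt) : ℝ := v.1 * p.1 + v.2 * p.2

/-- A set of points in the plane is in general position if no three of its points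
are collinear. -/
def GenPos (P : Set Pt) : Prop :=
  ∀ p ∈ P, ∀ q ∈ P, ∀ r ∈ P, p ≠ q → p ≠ r → q ≠ r →
    ¬ Collinear ℝ ({p, q, r} : Set Pt)

/-- A set of points is in convex position if no point of the set lies in the convex
hull of the other points. -/
def ConvexPos (S : Set Pt) : Prop :=
  ∀ p ∈ S, p ∉ convexHull ℝ (S \ {p})

/-- `H` is a `k`-hole in `P`: a subset of `P` of size `k` in convex position whose
convex hull contains no point of `P \ H`. -/
def IsKHole (k : ℕ) (P H : Finset Pt) : Prop :=
  H ⊆ P ∧ H.card = k ∧ ConvexPos (↑H : Set Pt) ∧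
    ∀ p ∈ P, p ∉ H → p ∉ convexHull ℝ (↑H : Set Pt)

/-- The number of `k`-holes in `P`. -/
def numKHoles (k : ℕ) (P : Finset Pt) : ℕ :=
  Set.ncard {H : Finset Pt | IsKHole k P H}

/-- For an `ℓ`-divided set `P = A ∪ B`, an `ℓ`-divided 5-hole is a 5-hole in `A ∪ B`
containing points of both `A` and `B`. -/
def DividedFiveHole (A B H : Finset Pt) : Prop :=
  IsKHole 5 (A ∪ B) H ∧ (↑H ∩ ↑A : Set Pt).Nonempty ∧ (↑H ∩ ↑B : Set Pt).Nonempty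

/-- `x` is an extremal point of `P`: it lies on the boundary of the convex hull of `P`. -/
def OnHullBoundary (P : Finset Pt) (x : Pt) : Prop :=
  x ∈ frontier (convexHull ℝ (↑P : Set Pt))

/-- An `ℓ`-divided set `C = A ∪ B` is `ℓ`-critical if neither part is in convex position
and, for every extremal point `x` of `C`, one of the sets `(C \ {x}) ∩ A` and
`(C \ {x}) ∩ B` is in convex position. -/
def LCritical (A B : Finset Pt) : Prop :=
  ¬ ConvexPos (↑A : Set Pt) ∧ ¬ ConvexPos (↑B : Set Pt) ∧
    ∀ x ∈ A ∪ B, OnHullBoundary (A ∪ B) x →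
      (ConvexPos (↑(A.erase x) : Set Pt) ∨ ConvexPos (↑(B.erase x) : Set Pt))

/-- The closed wedge with apex `a` swept clockwise from the ray `a→p` to the ray `a→q`.
If the clockwise angle from `a→p` to `a→q` is at most `π` the wedge is convex, otherwise
it is the corresponding reflex region. -/
def Wedge (a p q : Pt) : Set Pt :=
  if cross2 (p - a) (q - a) ≤ 0 then
    {x | cross2 (p - a) (x - a) ≤ 0 ∧ 0 ≤ cross2 (q - a) (x - a)}
  else
    {x | cross2 (p - a) (x - a) ≤ 0 ∨ 0 ≤ cross2 (q - a) (x - a)}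

/-- `W` is an `a`-wedge of `A`: one of the closed regions into which the rays from `a`
through the other points of `A` partition the plane, i.e. a wedge spanned by two
points of `A \ {a}` that are angularly consecutive around `a` (no other point of `A`
lies in the wedge). -/
def IsAWedge (A : Finset Pt) (a : Pt) (W : Set Pt) : Prop :=
  ∃ p ∈ A.erase a, ∃ q ∈ A.erase a, p ≠ q ∧ W = Wedge a p q ∧
    (↑A : Set Pt) ∩ Wedge a p q ⊆ {a, p, q}

/-- The combinatorial data of the `a*`-wedges of an `ℓ`-divided set `P = A ∪ B`, where
`ℓ` is the vertical line `x = x0` and `A` lies to its left: `aStar` is the rightmost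
interior point `a*` of `A`; `lbl` is the clockwise cyclic labeling `a_0, a_1, …` of
`A \ {a*}` (period `|A| - 1`), so that the `k`-th wedge `W_k` is swept clockwise from
the ray through `lbl (k-1)` to the ray through `lbl k` and contains no other point
of `A`; the wedges `W_1, …, W_t` are exactly those meeting `ℓ`, in top-to-bottom
order along `ℓ`. -/
structure StarSetup (x0 : ℝ) (A : Finset Pt) where
  aStar : Pt
  lbl : ℕ → Pt
  t : ℕ
  aStar_mem : aStar ∈ A
  aStar_interior : aStar ∈ interior (convexHull ℝ (↑A : Set Pt))
  aStar_rightmost : ∀ p ∈ A, p ∈ interior (convexHull ℝ (↑A : Set Pt)) → p.1 ≤ aStar.1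
  lbl_mem : ∀ k, lbl k ∈ A.erase aStar
  lbl_periodic : ∀ k, lbl (k + (A.card - 1)) = lbl k
  lbl_bij : ∀ p ∈ A.erase aStar, ∃! k, k ∈ Finset.Icc 1 (A.card - 1) ∧ lbl k = p
  consec : ∀ k ∈ Finset.Icc 1 (A.card - 1),
    (↑A : Set Pt) ∩ Wedge aStar (lbl (k - 1)) (lbl k) ⊆ {aStar, lbl (k - 1), lbl k}
  t_pos : 1 ≤ t
  t_le : t ≤ A.card - 1
  inter_iff : ∀ k ∈ Finset.Icc 1 (A.card - 1),
    ((Wedge aStar (lbl (k - 1)) (lbl k)) ∩ {p : Pt | p.1 = x0}).Nonempty ↔ k ≤ t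
  ordered : ∀ k ∈ Finset.Icc 1 t, ∀ k' ∈ Finset.Icc 1 t, k < k' →
    ∀ p ∈ (Wedge aStar (lbl (k - 1)) (lbl k)) ∩ {q : Pt | q.1 = x0},
    ∀ p' ∈ (Wedge aStar (lbl (k' - 1)) (lbl k')) ∩ {q : Pt | q.1 = x0},
      p'.2 ≤ p.2

/-- The `k`-th `a*`-wedge `W_k`. -/
def StarSetup.W {x0 : ℝ} {A : Finset Pt} (S : StarSetup x0 A) (k : ℕ) : Set Pt :=
  Wedge S.aStar (S.lbl (k - 1)) (S.lbl k)

/-- `w_k`, the number of points of `B` in the `k`-th `a*`-wedge. -/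
def StarSetup.w {x0 : ℝ} {A : Finset Pt} (S : StarSetup x0 A) (B : Finset Pt) (k : ℕ) : ℕ :=
  Set.ncard ((↑B : Set Pt) ∩ S.W k)

/-! ### A small certified unit-propagation checker

Literals are natural numbers: `l < litOff` is the positive literal of the variable `l`, and
`l + litOff` its negation.  A clause is the bit mask of its literals. -/

/-- Offset between a variable and its negated literal. -/
abbrev litOff : ℕ := 15000

/-- Truth value of a literal. -/
def litTrue (ν : ℕ → Bool) (l : ℕ) : Bool :=
  if l < litOff then ν l else if l < litOff + litOff then !ν (l - litOff) else false

/-- The complementary literal. -/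
def litNeg (l : ℕ) : ℕ := bif Nat.blt l litOff then l + litOff else l - litOff

/-- Evaluate the first argument before going on (only matters for kernel reduction). -/
def forceNat {α : Type} (x : ℕ) (f : ℕ → α) : α :=
  match x with
  | 0 => f 0
  | k + 1 => f (k + 1)

theorem forceNat_eq {α : Type} (x : ℕ) (f : ℕ → α) : forceNat x f = f x := by
  cases x <;> rfl

/-- The complementary literal, for a literal given as a mask with one bit. -/
def maskNeg (R : ℕ) : ℕ :=
  forceNat (Nat.shiftRight R litOff) fun S =>
    bif Nat.beq S 0 then Nat.shiftLeft R litOff else S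

/-- A clause (bit mask) is satisfied. -/
def ClauseSat (ν : ℕ → Bool) (C : ℕ) : Prop := ∃ l, C.testBit l = true ∧ litTrue ν l = true

/-- All literals of the mask are false. -/
def AllFalse (ν : ℕ → Bool) (F : ℕ) : Prop := ∀ l, F.testBit l = true → litTrue ν l = false

/-- Bit mask of a list of literals. -/
def maskOf : List ℕ → ℕ
  | [] => 0
  | l :: ls => Nat.lor (Nat.shiftLeft 1 l) (maskOf ls)

/-- The trivial clause. -/
def trivialLits : List ℕ := [0, litOff]

/-- The trivial clause, as a mask. -/
def trivialMask : ℕ := maskOf trivialLits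

/-- Look up an entry of a list, with a default value. -/
noncomputable def lookupD {α : Type} (d : α) (db : List α) : ℕ → α :=
  List.rec (fun _ => d) (fun c _ ih k => Nat.rec c (fun k' _ => ih k') k) db

/-- The clause referred to by a hint: hints below `1000` refer to the table `axs`, which is split
into blocks of 16, the other ones to the list `db` of derived clauses. -/
noncomputable def hintClause (axs : List (List ℕ)) (db : List ℕ) (h : ℕ) : ℕ :=
  bif Nat.blt h 1000 then lookupD trivialMask (lookupD [] axs (h / 16)) (h % 16)
  else lookupD trivialMask db (h - 1000)

/-- Unit propagation along the list of hints, from the mask `F` of false literals;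
`true` means that a conflict was reached. -/
noncomputable def propagate (axs : List (List ℕ)) (db : List ℕ) : List ℕ → ℕ → Bool
  | [], _ => false
  | h :: hs, F =>
    forceNat (hintClause axs db h) fun C =>
      forceNat (Nat.xor C (Nat.land C F)) fun R =>
        bif Nat.beq R 0 then true
        else bif Nat.beq (Nat.land R (Nat.sub R 1)) 0 then
          forceNat (Nat.lor F (maskNeg R)) fun F' => propagate axs db hs F'
        else false

/-- Run a refutation.  Each step consists of the positive and the negative variables of a new
clause, and of the hints which show that it follows. -/
noncomputable def refute (axs : List (List ℕ)) : List (List ℕ × List ℕ × List ℕ) → List ℕ → ℕ → Bool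
  | [], _, _ => false
  | (p, q, hs) :: rest, db, F =>
    forceNat (Nat.lor (maskOf p) (Nat.shiftLeft (maskOf q) litOff)) fun C =>
      forceNat (Nat.lor F C) fun F' =>
        match propagate axs db hs F' with
        | false => false
        | true =>
          match p, q with
          | [], [] => true
          | [l], [] => forceNat (Nat.lor F (Nat.shiftLeft 1 (litNeg l))) fun F'' => refute axs rest db F''
          | [], [l] => forceNat (Nat.lor F (Nat.shiftLeft 1 l)) fun F'' => refute axs rest db F''
          | _, _ => refute axs rest (C :: db) F

/-- Literals of the hole clause for the pentagon with indices `a, b, c, d, e`. -/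
def triplesOf (a b c d e : ℕ) : List (ℕ × ℕ × ℕ) :=
  [(a, b, c), (a, b, d), (a, b, e), (a, c, d), (a, c, e), (a, d, e), (b, c, d), (b, c, e),
    (b, d, e), (c, d, e)]

/-- Variable of a triple. -/
def triVar (i j k : ℕ) : ℕ := 100 * i + 10 * j + k

/-- Literals stating that a point with index below `n` is inside the triangle `t`. -/
def insideLits (t : ℕ × ℕ × ℕ) : ℕ → List ℕ
  | 0 => []
  | x + 1 =>
    bif Nat.blt t.1 x && Nat.blt x t.2.1 then
      (1000 + (1000 * t.1 + 100 * x + 10 * t.2.1 + t.2.2)) :: insideLits t x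
    else bif Nat.blt t.2.1 x && Nat.blt x t.2.2 then
      (8000 + (1000 * t.1 + 100 * t.2.1 + 10 * x + t.2.2)) :: insideLits t x
    else insideLits t x

/-- The clause (as a list of literals) with a given code. -/
def clauseLits (n : ℕ) (col : List Bool) (code : ℕ) : List ℕ :=
  let t := code / 10000
  let l := code % 10
  let k := code / 10 % 10
  let j := code / 100 % 10
  let i := code / 1000 % 10
  let A := triVar i j k
  let B := triVar i j l
  let C := triVar i k l
  let D := triVar j k l
  let cl := fun s => col.getD s false
  bif Nat.blt i j && Nat.blt j k && Nat.blt k l && Nat.blt l n && Nat.blt t 16 then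
    bif Nat.blt t 8 then
      bif Nat.blt 0 i then
        match t with
        | 0 => [A + litOff, B, C + litOff]
        | 1 => [A, B + litOff, C]
        | 2 => [A + litOff, B, D + litOff]
        | 3 => [A, B + litOff, D]
        | 4 => [A + litOff, C, D + litOff]
        | 5 => [A, C + litOff, D]
        | 6 => [B + litOff, C, D + litOff]
        | _ => [B, C + litOff, D]
      else trivialLits
    else bif Nat.blt t 10 then
      bif cl i && !cl j && cl k && cl l then
        bif Nat.beq t 8 then [A, B + litOff] else [A + litOff, B]
      else trivialLits
    else bif Nat.blt t 12 then
      bif cl i && cl j && !cl k && cl l then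
        bif Nat.beq t 10 then [C, D + litOff] else [C + litOff, D]
      else trivialLits
    else
      match t with
      | 12 => [1000 + (1000 * i + 100 * j + 10 * k + l) + litOff, A + litOff, B + litOff]
      | 13 => [1000 + (1000 * i + 100 * j + 10 * k + l) + litOff, A, B]
      | 14 => [8000 + (1000 * i + 100 * j + 10 * k + l) + litOff, C + litOff, D + litOff]
      | _ => [8000 + (1000 * i + 100 * j + 10 * k + l) + litOff, C, D]
  else
    let h := (code - 160000) / 10000
    bif Nat.blt h i && Nat.blt i j && Nat.blt j k && Nat.blt k l && Nat.blt l n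
        && (cl h || cl i || cl j || cl k || cl l)
        && !(cl h && cl i && cl j && cl k && cl l) then
      (triplesOf h i j k l).flatMap fun t => insideLits t n
    else trivialLits

/-- Load a block of clauses with the given codes. -/
def loadBlock (n : ℕ) (col : List Bool) : List ℕ → (List ℕ → Bool) → Bool
  | [], f => f []
  | c :: cs, f =>
    forceNat (maskOf (clauseLits n col c)) fun C => loadBlock n col cs fun db => f (C :: db)

/-- Load the clauses with the given codes. -/
def loadTable (n : ℕ) (col : List Bool) : List (List ℕ) → (List (List ℕ) → Bool) → Bool
  | [], f => f []
  | c :: cs, f => loadBlock n col c fun C => loadTable n col cs fun db => f (C :: db)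

/-- The literals known to be false from the start. -/
def initFalse (n : ℕ) (col : List Bool) : List ℕ :=
  (List.range n).flatMap fun i => (List.range n).flatMap fun j => (List.range n).flatMap fun k =>
    bif Nat.blt i j && Nat.blt j k
        && (Nat.beq i 0 || (col.getD i false && col.getD j false && col.getD k false)) then
      [triVar i j k + litOff]
    else []

/-- The complete check. -/
noncomputable def checkCert (n : ℕ) (col : List Bool) (axs : List (List ℕ))
    (steps : List (List ℕ × List ℕ × List ℕ)) : Bool :=
  Nat.ble n 10 && forceNat (maskOf (initFalse n col)) fun F =>
    loadTable n col axs fun tab => refute tab steps [] F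

/-! ### Soundness of the checker -/

theorem litTrue_pos (ν : ℕ → Bool) {l : ℕ} (h : l < litOff) : litTrue ν l = ν l := by
  simp [litTrue, h]

theorem litTrue_neg (ν : ℕ → Bool) {l : ℕ} (h : l < litOff) :
    litTrue ν (l + litOff) = !ν l := by
  have h1 : ¬ l + litOff < litOff := by omega
  have h2 : l + litOff < litOff + litOff := by omega
  unfold litTrue
  rw [if_neg h1, if_pos h2, Nat.add_sub_cancel]

theorem maskOf_testBit (ls : List ℕ) (l : ℕ) : (maskOf ls).testBit l = true ↔ l ∈ ls := by
  induction ls with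
  | nil => simp [maskOf]
  | cons a as ih =>
    have : maskOf (a :: as) = (1 <<< a) ||| maskOf as := rfl
    rw [this, Nat.testBit_or, Bool.or_eq_true, ih, Nat.one_shiftLeft, Nat.testBit_two_pow]
    simp [eq_comm]

theorem clauseSat_maskOf (ν : ℕ → Bool) (ls : List ℕ) :
    ClauseSat ν (maskOf ls) ↔ ∃ l ∈ ls, litTrue ν l = true := by
  simp only [ClauseSat, maskOf_testBit]

theorem allFalse_maskOf (ν : ℕ → Bool) (ls : List ℕ) :
    AllFalse ν (maskOf ls) ↔ ∀ l ∈ ls, litTrue ν l = false := by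
  simp only [AllFalse, maskOf_testBit]

theorem trivialLits_sat (ν : ℕ → Bool) : ∃ l ∈ trivialLits, litTrue ν l = true := by
  cases h : ν 0
  · refine ⟨litOff, by simp [trivialLits], ?_⟩
    have := litTrue_neg ν (l := 0) (by norm_num)
    rw [Nat.zero_add] at this
    rw [this, h]; rfl
  · refine ⟨0, by simp [trivialLits], ?_⟩
    rw [litTrue_pos ν (by norm_num), h]

theorem trivialMask_sat (ν : ℕ → Bool) : ClauseSat ν trivialMask :=
  (clauseSat_maskOf ν _).2 (trivialLits_sat ν)

theorem lookupD_mem {α : Type} (d : α) (db : List α) :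
    ∀ k, lookupD d db k = d ∨ lookupD d db k ∈ db := by
  induction db with
  | nil => intro k; left; rfl
  | cons c cs ih =>
    intro k
    cases k with
    | zero => right; exact List.mem_cons_self
    | succ k =>
      rcases ih k with h | h
      · left; exact h
      · right; exact List.mem_cons_of_mem _ h

theorem hintClause_sat (ν : ℕ → Bool) (axs : List (List ℕ)) (db : List ℕ)
    (ha : ∀ b ∈ axs, ∀ C ∈ b, ClauseSat ν C) (hd : ∀ C ∈ db, ClauseSat ν C) (h : ℕ) :
    ClauseSat ν (hintClause axs db h) := by
  unfold hintClause
  cases Nat.blt h 1000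
  · rcases lookupD_mem trivialMask db (h - 1000) with h1 | h1
    · simp only [cond_false]; rw [h1]; exact trivialMask_sat ν
    · exact hd _ h1
  · simp only [cond_true]
    rcases lookupD_mem trivialMask (lookupD [] axs (h / 16)) (h % 16) with h1 | h1
    · rw [h1]; exact trivialMask_sat ν
    · rcases lookupD_mem [] axs (h / 16) with h2 | h2
      · rw [h2] at h1; simp at h1
      · exact ha _ h2 _ h1

theorem allFalse_or {ν : ℕ → Bool} {F G : ℕ} (hF : AllFalse ν F) (hG : AllFalse ν G) :
    AllFalse ν (Nat.lor F G) := by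
  intro l hl
  have hl' : (F ||| G).testBit l = true := hl
  rw [Nat.testBit_or, Bool.or_eq_true] at hl'
  exact hl'.elim (hF l) (hG l)

theorem allFalse_two_pow {ν : ℕ → Bool} {l : ℕ} (h : litTrue ν l = false) :
    AllFalse ν (2 ^ l) := by
  intro m hm
  rw [Nat.testBit_two_pow] at hm
  simp at hm; rw [← hm]; exact h

theorem maskNeg_sound {ν : ℕ → Bool} {l : ℕ} (h : litTrue ν l = true) :
    AllFalse ν (maskNeg (2 ^ l)) := by
  unfold maskNeg
  rw [forceNat_eq]
  have h1 : Nat.shiftRight (2 ^ l) litOff = 2 ^ l / 2 ^ litOff := Nat.shiftRight_eq_div_pow _ _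
  have h2 : Nat.shiftLeft (2 ^ l) litOff = 2 ^ l * 2 ^ litOff := Nat.shiftLeft_eq _ _
  rw [h1, h2]
  by_cases hl : l < litOff
  · have h3 : 2 ^ l / 2 ^ litOff = 0 :=
      Nat.div_eq_of_lt (Nat.pow_lt_pow_right (by norm_num) hl)
    rw [h3, ← pow_add]
    have h4 : Nat.beq 0 0 = true := rfl
    rw [h4, cond_true]
    apply allFalse_two_pow
    rw [litTrue_neg ν hl, ← litTrue_pos ν hl, h]; rfl
  · push Not at hl
    rw [Nat.pow_div hl (by norm_num)]
    have h4 : Nat.beq (2 ^ (l - litOff)) 0 = false := by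
      have h5 : 2 ^ (l - litOff) ≠ 0 := by positivity
      cases h6 : Nat.beq (2 ^ (l - litOff)) 0
      · rfl
      · exact absurd (Nat.eq_of_beq_eq_true h6) h5
    rw [h4, cond_false]
    apply allFalse_two_pow
    obtain ⟨k, rfl⟩ := Nat.exists_eq_add_of_le hl
    rw [Nat.add_comm] at h
    rw [Nat.add_sub_cancel_left]
    by_cases hk : k < litOff
    · rw [litTrue_neg ν hk] at h
      rw [litTrue_pos ν hk]; simpa using h
    · have h8 : ¬ k + litOff < litOff := by omega
      have h9 : ¬ k + litOff < litOff + litOff := by omega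
      unfold litTrue at h
      rw [if_neg h8, if_neg h9] at h
      cases h

theorem propagate_sound (ν : ℕ → Bool) (axs : List (List ℕ)) (db : List ℕ)
    (ha : ∀ b ∈ axs, ∀ C ∈ b, ClauseSat ν C) (hd : ∀ C ∈ db, ClauseSat ν C) :
    ∀ (hs : List ℕ) (F : ℕ), propagate axs db hs F = true → ¬ AllFalse ν F := by
  intro hs
  induction hs with
  | nil => intro F h; simp [propagate] at h
  | cons h hs ih =>
    intro F hp hF
    unfold propagate at hp
    simp only [forceNat_eq] at hp
    obtain ⟨l, hl, hlt⟩ := hintClause_sat ν axs db ha hd h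
    set C := hintClause axs db h
    have hR : (Nat.xor C (Nat.land C F)).testBit l = true := by
      change (C ^^^ (C &&& F)).testBit l = true
      rw [Nat.testBit_xor, Nat.testBit_and, hl]
      cases hFl : F.testBit l
      · rfl
      · rw [hF l hFl] at hlt; cases hlt
    set R := Nat.xor C (Nat.land C F)
    have hR0 : R ≠ 0 := by
      intro h0; rw [h0] at hR; simp at hR
    have hb0 : Nat.beq R 0 = false := by
      cases h6 : Nat.beq R 0
      · rfl
      · exact absurd (Nat.eq_of_beq_eq_true h6) hR0
    rw [hb0, cond_false] at hp
    cases hb : Nat.beq (Nat.land R (Nat.sub R 1)) 0 with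
    | false => rw [hb] at hp; simp at hp
    | true =>
      rw [hb, cond_true] at hp
      have h7 : R &&& (R - 1) = 0 := Nat.eq_of_beq_eq_true hb
      obtain ⟨m, hm⟩ := (Nat.and_sub_one_eq_zero_iff_isPowerOfTwo hR0).1 h7
      rw [hm, Nat.testBit_two_pow] at hR
      simp at hR
      subst hR
      rw [hm] at hp
      exact ih _ hp (allFalse_or hF (maskNeg_sound hlt))

theorem allFalse_clause {ν : ℕ → Bool} {C : ℕ} (h : ¬ ClauseSat ν C) : AllFalse ν C := by
  intro l hl
  cases h1 : litTrue ν l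
  · rfl
  · exact absurd ⟨l, hl, h1⟩ h

theorem litNeg_false {ν : ℕ → Bool} {l : ℕ} (h : litTrue ν l = true) :
    litTrue ν (litNeg l) = false := by
  by_cases hl : l < litOff
  · have h1 : litNeg l = l + litOff := by
      have h4 : Nat.blt l litOff = true := by rw [Nat.blt_eq]; exact hl
      unfold litNeg; rw [h4, cond_true]
    rw [h1, litTrue_neg ν hl, ← litTrue_pos ν hl, h]; rfl
  · have h1 : litNeg l = l - litOff := by
      have h4 : Nat.blt l litOff = false := by
        cases h6 : Nat.blt l litOff
        · rfl
        · rw [Nat.blt_eq] at h6; exact absurd h6 hl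
      unfold litNeg; rw [h4, cond_false]
    rw [h1]
    obtain ⟨k, rfl⟩ := Nat.exists_eq_add_of_le (not_lt.1 hl)
    rw [Nat.add_sub_cancel_left]
    rw [Nat.add_comm] at h
    by_cases hk : k < litOff
    · rw [litTrue_neg ν hk] at h
      rw [litTrue_pos ν hk]; simpa using h
    · have h8 : ¬ k + litOff < litOff := by omega
      have h9 : ¬ k + litOff < litOff + litOff := by omega
      unfold litTrue at h
      rw [if_neg h8, if_neg h9] at h
      cases h

theorem refute_sound (ν : ℕ → Bool) (axs : List (List ℕ))
    (ha : ∀ b ∈ axs, ∀ C ∈ b, ClauseSat ν C) :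
    ∀ (steps : List (List ℕ × List ℕ × List ℕ)) (db : List ℕ) (F : ℕ),
      (∀ C ∈ db, ClauseSat ν C) → AllFalse ν F → refute axs steps db F = true → False := by
  intro steps
  induction steps with
  | nil => intro db F _ _ h; simp [refute] at h
  | cons s rest ih =>
    intro db F hd hF h
    obtain ⟨p, q, hs⟩ := s
    unfold refute at h
    simp only [forceNat_eq] at h
    set C := Nat.lor (maskOf p) (Nat.shiftLeft (maskOf q) litOff) with hC
    cases hp : propagate axs db hs (Nat.lor F C) with
    | false => rw [hp] at h; cases h
    | true =>
      rw [hp] at h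
      have hCs : ClauseSat ν C := by
        by_contra hn
        exact propagate_sound ν axs db ha hd hs _ hp (allFalse_or hF (allFalse_clause hn))
      have hCbit : ∀ l, C.testBit l = true → l ∈ p ∨ (litOff ≤ l ∧ l - litOff ∈ q) := by
        intro l hl
        have hl' : (maskOf p ||| maskOf q <<< litOff).testBit l = true := hl
        rw [Nat.testBit_or, Bool.or_eq_true, maskOf_testBit, Nat.testBit_shiftLeft] at hl'
        rcases hl' with h1 | h1
        · exact Or.inl h1
        · right
          rw [Bool.and_eq_true, maskOf_testBit] at h1
          exact ⟨by simpa using h1.1, h1.2⟩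
      obtain ⟨l, hl, hlt⟩ := hCs
      have hmem := hCbit l hl
      have hcons : ∀ D ∈ C :: db, ClauseSat ν D := by
        intro D hD
        rcases List.mem_cons.1 hD with h1 | h1
        · rw [h1]; exact ⟨l, hl, hlt⟩
        · exact hd D h1
      split at h
      · cases h
      · split at h
        · simp at hmem
        · rename_i l' _ _
          simp at hmem
          subst hmem
          refine ih _ _ hd (allFalse_or hF ?_) h
          have h1 : Nat.shiftLeft 1 (litNeg l) = 2 ^ litNeg l := Nat.one_shiftLeft _
          rw [h1]
          exact allFalse_two_pow (litNeg_false hlt)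
        · rename_i l'
          simp at hmem
          obtain ⟨h1, h2⟩ := hmem
          refine ih _ _ hd (allFalse_or hF ?_) h
          have h3 : Nat.shiftLeft 1 l' = 2 ^ l' := Nat.one_shiftLeft _
          rw [h3]
          apply allFalse_two_pow
          have h5 := litNeg_false hlt
          have h6 : litNeg l = l' := by
            have h4 : Nat.blt l litOff = false := by
              cases h6 : Nat.blt l litOff
              · rfl
              · rw [Nat.blt_eq] at h6; omega
            unfold litNeg; rw [h4, cond_false]; exact h2
          rw [← h6]; exact h5
        · exact ih _ _ hcons hF h

/-- The combinatorial configurations refuted by the certificates: `o i j k` is the orientation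
of the points with indices `i < j < k`, sorted by angle around the point with index `0`, and `col`
tells which points belong to `A`. -/
structure Cfg (n : ℕ) (col : ℕ → Bool) (o : ℕ → ℕ → ℕ → Bool) : Prop where
  z : ∀ j k, 0 < j → j < k → k < n → o 0 j k = true
  cA : ∀ i j k, i < j → j < k → k < n → col i = true → col j = true → col k = true →
    o i j k = true
  sig : ∀ i j k l, 0 < i → i < j → j < k → k < l → l < n →
    (¬ (o i j k = true ∧ o i j l = false ∧ o i k l = true)) ∧
    (¬ (o i j k = false ∧ o i j l = true ∧ o i k l = false)) ∧
    (¬ (o i j k = true ∧ o i j l = false ∧ o j k l = true)) ∧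
    (¬ (o i j k = false ∧ o i j l = true ∧ o j k l = false)) ∧
    (¬ (o i j k = true ∧ o i k l = false ∧ o j k l = true)) ∧
    (¬ (o i j k = false ∧ o i k l = true ∧ o j k l = false)) ∧
    (¬ (o i j l = true ∧ o i k l = false ∧ o j k l = true)) ∧
    (¬ (o i j l = false ∧ o i k l = true ∧ o j k l = false))
  sepJ : ∀ i j k l, i < j → j < k → k < l → l < n → col i = true → col j = false →
    col k = true → col l = true → o i j k = o i j l
  sepK : ∀ i j k l, i < j → j < k → k < l → l < n → col i = true → col j = true →
    col k = false → col l = true → o i k l = o j k l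
  nohole : ∀ a b c d e, a < b → b < c → c < d → d < e → e < n →
    (col a = true ∨ col b = true ∨ col c = true ∨ col d = true ∨ col e = true) →
    ¬ (col a = true ∧ col b = true ∧ col c = true ∧ col d = true ∧ col e = true) →
    ∃ t ∈ triplesOf a b c d e, ∃ x < n,
      (t.1 < x ∧ x < t.2.1 ∧ o t.1 x t.2.1 ≠ o t.1 x t.2.2) ∨
      (t.2.1 < x ∧ x < t.2.2 ∧ o t.1 x t.2.2 ≠ o t.2.1 x t.2.2)

/-- The assignment of the variables given by a configuration. -/
def assignOf (o : ℕ → ℕ → ℕ → Bool) (v : ℕ) : Bool :=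
  if v < 1000 then o (v / 100) (v / 10 % 10) (v % 10)
  else if v < 8000 then
    (o ((v - 1000) / 1000) ((v - 1000) / 100 % 10) ((v - 1000) / 10 % 10)) !=
      (o ((v - 1000) / 1000) ((v - 1000) / 100 % 10) ((v - 1000) % 10))
  else
    (o ((v - 8000) / 1000) ((v - 8000) / 10 % 10) ((v - 8000) % 10)) !=
      (o ((v - 8000) / 100 % 10) ((v - 8000) / 10 % 10) ((v - 8000) % 10))

theorem assignOf_tri (o : ℕ → ℕ → ℕ → Bool) {i j k : ℕ} (hi : i < 10) (hj : j < 10) (hk : k < 10) :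
    assignOf o (triVar i j k) = o i j k := by
  unfold assignOf triVar
  rw [if_pos (by omega)]
  congr 1 <;> omega

theorem assignOf_inJ (o : ℕ → ℕ → ℕ → Bool) {i j k l : ℕ} (hi : i < 7) (hj : j < 10) (hk : k < 10)
    (hl : l < 10) :
    assignOf o (1000 + (1000 * i + 100 * j + 10 * k + l)) = (o i j k != o i j l) := by
  unfold assignOf
  rw [if_neg (by omega), if_pos (by omega)]
  rw [Nat.add_sub_cancel_left]
  have h1 : (1000 * i + 100 * j + 10 * k + l) / 1000 = i := by omega
  have h2 : (1000 * i + 100 * j + 10 * k + l) / 100 % 10 = j := by omega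
  have h3 : (1000 * i + 100 * j + 10 * k + l) / 10 % 10 = k := by omega
  have h4 : (1000 * i + 100 * j + 10 * k + l) % 10 = l := by omega
  rw [h1, h2, h3, h4]

theorem assignOf_inK (o : ℕ → ℕ → ℕ → Bool) {i j k l : ℕ} (hi : i < 7) (hj : j < 10) (hk : k < 10)
    (hl : l < 10) :
    assignOf o (8000 + (1000 * i + 100 * j + 10 * k + l)) = (o i k l != o j k l) := by
  unfold assignOf
  rw [if_neg (by omega), if_neg (by omega)]
  rw [Nat.add_sub_cancel_left]
  have h1 : (1000 * i + 100 * j + 10 * k + l) / 1000 = i := by omega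
  have h2 : (1000 * i + 100 * j + 10 * k + l) / 100 % 10 = j := by omega
  have h3 : (1000 * i + 100 * j + 10 * k + l) / 10 % 10 = k := by omega
  have h4 : (1000 * i + 100 * j + 10 * k + l) % 10 = l := by omega
  rw [h1, h2, h3, h4]

theorem lit_tri_pos (o : ℕ → ℕ → ℕ → Bool) {i j k : ℕ} (hi : i < 10) (hj : j < 10) (hk : k < 10) :
    litTrue (assignOf o) (triVar i j k) = o i j k := by
  rw [litTrue_pos _ (by unfold triVar litOff; omega), assignOf_tri o hi hj hk]

theorem lit_tri_neg (o : ℕ → ℕ → ℕ → Bool) {i j k : ℕ} (hi : i < 10) (hj : j < 10) (hk : k < 10) :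
    litTrue (assignOf o) (triVar i j k + litOff) = !o i j k := by
  rw [litTrue_neg _ (by unfold triVar litOff; omega), assignOf_tri o hi hj hk]

theorem lit_inJ_pos (o : ℕ → ℕ → ℕ → Bool) {i j k l : ℕ} (hi : i < 7) (hj : j < 10) (hk : k < 10)
    (hl : l < 10) :
    litTrue (assignOf o) (1000 + (1000 * i + 100 * j + 10 * k + l)) = (o i j k != o i j l) := by
  rw [litTrue_pos _ (by unfold litOff; omega), assignOf_inJ o hi hj hk hl]

theorem lit_inJ_neg (o : ℕ → ℕ → ℕ → Bool) {i j k l : ℕ} (hi : i < 7) (hj : j < 10) (hk : k < 10)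
    (hl : l < 10) :
    litTrue (assignOf o) (1000 + (1000 * i + 100 * j + 10 * k + l) + litOff)
      = !(o i j k != o i j l) := by
  rw [litTrue_neg _ (by unfold litOff; omega), assignOf_inJ o hi hj hk hl]

theorem lit_inK_pos (o : ℕ → ℕ → ℕ → Bool) {i j k l : ℕ} (hi : i < 7) (hj : j < 10) (hk : k < 10)
    (hl : l < 10) :
    litTrue (assignOf o) (8000 + (1000 * i + 100 * j + 10 * k + l)) = (o i k l != o j k l) := by
  rw [litTrue_pos _ (by unfold litOff; omega), assignOf_inK o hi hj hk hl]

theorem lit_inK_neg (o : ℕ → ℕ → ℕ → Bool) {i j k l : ℕ} (hi : i < 7) (hj : j < 10) (hk : k < 10)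
    (hl : l < 10) :
    litTrue (assignOf o) (8000 + (1000 * i + 100 * j + 10 * k + l) + litOff)
      = !(o i k l != o j k l) := by
  rw [litTrue_neg _ (by unfold litOff; omega), assignOf_inK o hi hj hk hl]

theorem mem_insideLits_J (t : ℕ × ℕ × ℕ) (n x : ℕ) (hx : x < n) (h1 : t.1 < x) (h2 : x < t.2.1) :
    (1000 + (1000 * t.1 + 100 * x + 10 * t.2.1 + t.2.2)) ∈ insideLits t n := by
  induction n with
  | zero => omega
  | succ m ih =>
    unfold insideLits
    by_cases hm : x = m
    · subst hm
      have h3 : (Nat.blt t.1 x && Nat.blt x t.2.1) = true := by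
        rw [Bool.and_eq_true, Nat.blt_eq, Nat.blt_eq]; exact ⟨h1, h2⟩
      rw [h3, cond_true]
      exact List.mem_cons_self
    · have := ih (by omega)
      cases (Nat.blt t.1 m && Nat.blt m t.2.1)
      · cases (Nat.blt t.2.1 m && Nat.blt m t.2.2)
        · exact this
        · exact List.mem_cons_of_mem _ this
      · exact List.mem_cons_of_mem _ this

theorem mem_insideLits_K (t : ℕ × ℕ × ℕ) (n x : ℕ) (hx : x < n) (h1 : t.2.1 < x) (h2 : x < t.2.2) :
    (8000 + (1000 * t.1 + 100 * t.2.1 + 10 * x + t.2.2)) ∈ insideLits t n := by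
  induction n with
  | zero => omega
  | succ m ih =>
    unfold insideLits
    by_cases hm : x = m
    · subst hm
      have h3 : (Nat.blt t.1 x && Nat.blt x t.2.1) = false := by
        cases h : (Nat.blt t.1 x && Nat.blt x t.2.1)
        · rfl
        · rw [Bool.and_eq_true, Nat.blt_eq, Nat.blt_eq] at h; omega
      have h4 : (Nat.blt t.2.1 x && Nat.blt x t.2.2) = true := by
        rw [Bool.and_eq_true, Nat.blt_eq, Nat.blt_eq]; exact ⟨h1, h2⟩
      rw [h3, cond_false, h4, cond_true]
      exact List.mem_cons_self
    · have := ih (by omega)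
      cases (Nat.blt t.1 m && Nat.blt m t.2.1)
      · cases (Nat.blt t.2.1 m && Nat.blt m t.2.2)
        · exact this
        · exact List.mem_cons_of_mem _ this
      · exact List.mem_cons_of_mem _ this

theorem triplesOf_bound {a b c d e : ℕ} (hab : a < b) (hbc : b < c) (hcd : c < d) (hde : d < e)
    (t : ℕ × ℕ × ℕ) (ht : t ∈ triplesOf a b c d e) : t.1 < t.2.1 ∧ t.2.1 < t.2.2 ∧ t.2.2 ≤ e := by
  simp only [triplesOf, List.mem_cons, List.not_mem_nil, or_false] at ht
  rcases ht with h | h | h | h | h | h | h | h | h | h <;> subst h <;>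
    refine ⟨?_, ?_, ?_⟩ <;> dsimp only <;> omega

theorem holeLits_sat {n : ℕ} {col : ℕ → Bool} {o : ℕ → ℕ → ℕ → Bool} (hn : n ≤ 10)
    (hc : Cfg n col o) {a b c d e : ℕ} (hab : a < b) (hbc : b < c) (hcd : c < d) (hde : d < e)
    (hen : e < n) (h1 : col a = true ∨ col b = true ∨ col c = true ∨ col d = true ∨ col e = true)
    (h2 : ¬ (col a = true ∧ col b = true ∧ col c = true ∧ col d = true ∧ col e = true)) :
    ∃ l ∈ (triplesOf a b c d e).flatMap fun t => insideLits t n,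
      litTrue (assignOf o) l = true := by
  obtain ⟨t, ht, x, hx, h⟩ := hc.nohole a b c d e hab hbc hcd hde hen h1 h2
  obtain ⟨hb1, hb2, hb3⟩ := triplesOf_bound hab hbc hcd hde t ht
  rcases h with ⟨h3, h4, h5⟩ | ⟨h3, h4, h5⟩
  · refine ⟨_, List.mem_flatMap.2 ⟨t, ht, mem_insideLits_J t n x hx h3 h4⟩, ?_⟩
    rw [lit_inJ_pos o (by omega) (by omega) (by omega) (by omega)]
    simpa using h5
  · refine ⟨_, List.mem_flatMap.2 ⟨t, ht, mem_insideLits_K t n x hx h3 h4⟩, ?_⟩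
    rw [lit_inK_pos o (by omega) (by omega) (by omega) (by omega)]
    simpa using h5

set_option linter.unusedSimpArgs false in
theorem clauseLits_sat {n : ℕ} {col : List Bool} {o : ℕ → ℕ → ℕ → Bool} (hn : n ≤ 10)
    (hc : Cfg n (fun i => col.getD i false) o) (code : ℕ) :
    ∃ l ∈ clauseLits n col code, litTrue (assignOf o) l = true := by
  unfold clauseLits
  have hl10 : code % 10 < 10 := by omega
  have hk10 : code / 10 % 10 < 10 := by omega
  have hj10 : code / 100 % 10 < 10 := by omega
  have hi10 : code / 1000 % 10 < 10 := by omega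
  generalize code % 10 = l at *
  generalize code / 10 % 10 = k at *
  generalize code / 100 % 10 = j at *
  generalize code / 1000 % 10 = i at *
  generalize code / 10000 = t at *
  generalize (code - 160000) / 10000 = h at *
  dsimp only
  cases hb : (Nat.blt i j && Nat.blt j k && Nat.blt k l && Nat.blt l n && Nat.blt t 16)
  · rw [cond_false]
    cases hb2 : (Nat.blt h i && Nat.blt i j && Nat.blt j k && Nat.blt k l && Nat.blt l n
        && (col.getD h false || col.getD i false || col.getD j false || col.getD k false
          || col.getD l false)
        && !(col.getD h false && col.getD i false && col.getD j false && col.getD k false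
          && col.getD l false))
    · rw [cond_false]; exact trivialLits_sat _
    · rw [cond_true]
      simp only [Bool.and_eq_true, Nat.blt_eq, Bool.or_eq_true, Bool.not_eq_true', ] at hb2
      obtain ⟨⟨⟨⟨⟨⟨h1, h2⟩, h3⟩, h4⟩, h5⟩, h6⟩, h7⟩ := hb2
      refine holeLits_sat hn hc h1 h2 h3 h4 h5 ?_ ?_
      · rcases h6 with (((h6 | h6) | h6) | h6) | h6
        · exact Or.inl h6
        · exact Or.inr (Or.inl h6)
        · exact Or.inr (Or.inr (Or.inl h6))
        · exact Or.inr (Or.inr (Or.inr (Or.inl h6)))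
        · exact Or.inr (Or.inr (Or.inr (Or.inr h6)))
      · rintro ⟨g1, g2, g3, g4, g5⟩
        rw [g1, g2, g3, g4, g5] at h7
        cases h7
  · rw [cond_true]
    simp only [Bool.and_eq_true, Nat.blt_eq] at hb
    obtain ⟨⟨⟨⟨hij, hjk⟩, hkl⟩, hln⟩, ht⟩ := hb
    have eA := lit_tri_pos o hi10 hj10 hk10
    have eA' := lit_tri_neg o hi10 hj10 hk10
    have eB := lit_tri_pos o hi10 hj10 hl10
    have eB' := lit_tri_neg o hi10 hj10 hl10
    have eC := lit_tri_pos o hi10 hk10 hl10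
    have eC' := lit_tri_neg o hi10 hk10 hl10
    have eD := lit_tri_pos o hj10 hk10 hl10
    have eD' := lit_tri_neg o hj10 hk10 hl10
    have hi7 : i < 7 := by omega
    have eJ := lit_inJ_neg o hi7 hj10 hk10 hl10
    have eK := lit_inK_neg o hi7 hj10 hk10 hl10
    cases hb8 : Nat.blt t 8
    · rw [cond_false]
      cases hb10 : Nat.blt t 10
      · rw [cond_false]
        cases hb12 : Nat.blt t 12
        · rw [cond_false]
          have ht12 : ¬ t < 12 := by
            intro h; rw [← Nat.blt_eq, hb12] at h; cases h
          have : t = 12 ∨ t = 13 ∨ t = 14 ∨ t = 15 := by omega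
          rcases this with h | h | h | h <;> subst h <;>
            simp only [List.mem_cons, List.not_mem_nil, or_false, exists_eq_or_imp,
              exists_eq_left, eA, eA', eB, eB', eC, eC', eD, eD', eJ, eK]
          · cases o i j k <;> cases o i j l <;> simp
          · cases o i j k <;> cases o i j l <;> simp
          · cases o i k l <;> cases o j k l <;> simp
          · cases o i k l <;> cases o j k l <;> simp
        · rw [cond_true]
          cases hcol : (col.getD i false && col.getD j false && !col.getD k false &&
            col.getD l false)
          · exact trivialLits_sat _
          · rw [cond_true]
            simp only [Bool.and_eq_true, Bool.not_eq_true'] at hcol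
            obtain ⟨⟨⟨h1, h2⟩, h3⟩, h4⟩ := hcol
            have := hc.sepK i j k l hij hjk hkl hln h1 h2 h3 h4
            cases Nat.beq t 10 <;> simp only [cond_true, cond_false, List.mem_cons,
              List.not_mem_nil, or_false, exists_eq_or_imp,
              exists_eq_left, eA, eA', eB, eB', eC, eC', eD, eD', this] <;>
              cases o j k l <;> simp
      · rw [cond_true]
        cases hcol : (col.getD i false && !col.getD j false && col.getD k false &&
            col.getD l false)
        · exact trivialLits_sat _
        · rw [cond_true]
          simp only [Bool.and_eq_true, Bool.not_eq_true'] at hcol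
          obtain ⟨⟨⟨h1, h2⟩, h3⟩, h4⟩ := hcol
          have := hc.sepJ i j k l hij hjk hkl hln h1 h2 h3 h4
          cases Nat.beq t 8 <;> simp only [cond_true, cond_false, List.mem_cons,
              List.not_mem_nil, or_false, exists_eq_or_imp,
              exists_eq_left, eA, eA', eB, eB', eC, eC', eD, eD', this] <;>
              cases o i j l <;> simp
    · rw [cond_true]
      rw [Nat.blt_eq] at hb8
      cases hb0 : Nat.blt 0 i
      · exact trivialLits_sat _
      · rw [Nat.blt_eq] at hb0
        rw [cond_true]
        obtain ⟨s0, s1, s2, s3, s4, s5, s6, s7⟩ := hc.sig i j k l hb0 hij hjk hkl hln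
        have : t = 0 ∨ t = 1 ∨ t = 2 ∨ t = 3 ∨ t = 4 ∨ t = 5 ∨ t = 6 ∨ t = 7 := by omega
        rcases this with h | h | h | h | h | h | h | h <;> subst h <;>
            simp only [List.mem_cons, List.not_mem_nil, or_false, exists_eq_or_imp,
              exists_eq_left, eA, eA', eB, eB', eC, eC', eD, eD']
        all_goals
          revert s0 s1 s2 s3 s4 s5 s6 s7
          cases o i j k <;> cases o i j l <;> cases o i k l <;> cases o j k l <;> simp

theorem loadBlock_sound (ν : ℕ → Bool) (n : ℕ) (col : List Bool)
    (hs : ∀ c, ∃ l ∈ clauseLits n col c, litTrue ν l = true) :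
    ∀ (cs : List ℕ) (f : List ℕ → Bool), loadBlock n col cs f = true →
      ∃ db, (∀ C ∈ db, ClauseSat ν C) ∧ f db = true := by
  intro cs
  induction cs with
  | nil => intro f h; exact ⟨[], by simp, h⟩
  | cons c cs ih =>
    intro f h
    unfold loadBlock at h
    rw [forceNat_eq] at h
    obtain ⟨db, h1, h2⟩ := ih _ h
    refine ⟨_, ?_, h2⟩
    intro C hC
    rcases List.mem_cons.1 hC with h3 | h3
    · rw [h3]; exact (clauseSat_maskOf ν _).2 (hs c)
    · exact h1 C h3

theorem loadTable_sound (ν : ℕ → Bool) (n : ℕ) (col : List Bool)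
    (hs : ∀ c, ∃ l ∈ clauseLits n col c, litTrue ν l = true) :
    ∀ (cs : List (List ℕ)) (f : List (List ℕ) → Bool), loadTable n col cs f = true →
      ∃ tab, (∀ b ∈ tab, ∀ C ∈ b, ClauseSat ν C) ∧ f tab = true := by
  intro cs
  induction cs with
  | nil => intro f h; exact ⟨[], by simp, h⟩
  | cons c cs ih =>
    intro f h
    unfold loadTable at h
    obtain ⟨b, h1, h2⟩ := loadBlock_sound ν n col hs _ _ h
    obtain ⟨tab, h3, h4⟩ := ih _ h2
    refine ⟨_, ?_, h4⟩
    intro b' hb'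
    rcases List.mem_cons.1 hb' with h5 | h5
    · rw [h5]; exact h1
    · exact h3 b' h5

theorem initFalse_sound {n : ℕ} {col : List Bool} {o : ℕ → ℕ → ℕ → Bool} (hn : n ≤ 10)
    (hc : Cfg n (fun i => col.getD i false) o) :
    ∀ l ∈ initFalse n col, litTrue (assignOf o) l = false := by
  intro l hl
  unfold initFalse at hl
  simp only [List.mem_flatMap, List.mem_range] at hl
  obtain ⟨i, hi, j, hj, k, hk, hl⟩ := hl
  cases hb : (Nat.blt i j && Nat.blt j k
        && (Nat.beq i 0 || (col.getD i false && col.getD j false && col.getD k false)))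
  · rw [hb, cond_false] at hl; cases hl
  · rw [hb, cond_true, List.mem_singleton] at hl
    simp only [Bool.and_eq_true, Nat.blt_eq, Bool.or_eq_true, Nat.beq_eq] at hb
    obtain ⟨⟨h1, h2⟩, h3⟩ := hb
    rw [hl, lit_tri_neg o (by omega) (by omega) (by omega)]
    have : o i j k = true := by
      rcases h3 with h3 | ⟨⟨h3, h4⟩, h5⟩
      · subst h3; exact hc.z j k h1 h2 hk
      · exact hc.cA i j k h1 h2 hk h3 h4 h5
    rw [this]; rfl

theorem checkCert_sound {n : ℕ} {col : List Bool} {axs : List (List ℕ)}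
    {steps : List (List ℕ × List ℕ × List ℕ)} (h : checkCert n col axs steps = true)
    (o : ℕ → ℕ → ℕ → Bool) : ¬ Cfg n (fun i => col.getD i false) o := by
  intro hc
  unfold checkCert at h
  rw [Bool.and_eq_true, forceNat_eq] at h
  obtain ⟨hn, h⟩ := h
  have hn' : n ≤ 10 := Nat.le_of_ble_eq_true hn
  obtain ⟨tab, h1, h2⟩ := loadTable_sound (assignOf o) n col (clauseLits_sat hn' hc) _ _ h
  exact refute_sound (assignOf o) tab h1 steps [] _ (by simp)
    ((allFalse_maskOf _ _).2 (initFalse_sound hn' hc)) h2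
/-- Clauses used for the colour sequence `AAAABBBBA`. -/
def certTable0 : List (List ℕ) := [

  [140356, 140346, 140578, 140367, 132346, 132345, 53678, 55678, 132356, 143578, 140678, 143568, 32678, 33578, 33458, 75678],
  [142356, 123458, 143456, 123456, 125678, 143678, 132367, 152456, 140456, 123457, 52345, 53457, 143567, 152457, 144567, 123478],
  [132347, 123567, 134567, 142345, 123467, 154567, 32568, 65678, 140478, 32457, 144568, 132567, 3467, 52357, 3456, 123578],
  [151234, 142346, 144578, 64578, 74567, 51458, 140256, 152345, 122468, 145678, 152467, 152567, 143467, 122568, 132457, 132456],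
  [142678, 124567, 140246, 153456, 43456, 163678, 143457, 155678, 52356, 3457, 141345, 154578, 52346, 141356, 135678, 151237],
  [52367, 32356, 183456, 142567, 51568, 54678, 153457, 132467, 152367, 133456, 122467, 142456, 53456, 52457, 131347, 154678],
  [52478, 72467, 132357, 151236, 33567, 124678, 154568, 152356, 124568, 134678, 205678, 122456, 131247, 142347, 151235, 34567],
  [32367, 32357, 51247, 151247, 12357, 151467, 141346, 152347, 2567, 141568, 163456, 33457, 151267, 142467, 131346, 5678],
  [152357, 153567, 140156, 1346, 184567, 141245, 122457, 183457, 153467, 131345, 152346, 31247, 124578, 32346, 45678, 141578],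
  [35678, 133457, 52467, 122567, 24567, 142357, 151457, 141678, 51678, 151257, 140146, 74678, 144678, 72567, 64568, 32467],
  [140235, 131567, 151246, 54568, 11346, 131267, 73467, 2467, 142457, 74578, 151456, 52347, 31468, 131367, 134578, 151256],
  [131467, 141256, 163468, 74568, 140135, 131246, 51246, 1356, 134568, 34578, 1456, 33468, 142568, 141246, 63457, 31246],
  [142578, 4567, 131257, 12345, 141467, 12356, 172467, 131245, 33456, 131357, 32345, 11347, 1457, 140125, 64567, 172457],
  [54578, 151567, 142367, 53467, 24678, 120357, 121245, 122458, 120238, 120468, 162358, 131356, 120138, 120137, 21345, 31578],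
  [120478, 2456, 164578, 120278, 31257, 141368, 120245, 140178, 120346, 110248, 183467, 44678, 12347, 140168, 24578, 121235],
  [110378, 142348, 120578, 142378, 140158, 142358, 51467, 120678, 141247, 161358, 64678, 34678, 131457, 183567, 3567, 120146],
  [141358, 120356, 120237, 120367, 120467, 120168, 163467, 21246, 141267, 161234, 21235, 140348, 140123, 120157, 120345, 142368],
  [51367, 33467, 101368, 121458, 120123, 140126, 11245, 164567, 102368, 32468, 140378, 121234, 43467, 120258, 32456, 110158],
  [41235, 140258, 120267, 120568, 121457, 52456, 110148, 141234, 120136, 140136, 53567, 121238, 133567, 140345, 12367, 140245],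
  [141257, 120156, 120235, 120135, 111258, 120248, 141235, 163457, 31467, 140138, 121358, 31478, 120368, 163578, 31457, 110368],
  [120178, 73567, 140236, 140278, 44578, 120126, 140567, 140368, 110178, 120234, 121456, 120158, 121258, 71345, 121268, 24568],
  [172346, 110358, 140457, 120358, 1236, 61245, 161235, 120378, 21245, 43457, 21256, 110278, 120567, 164568, 21234, 120456],
  [120246, 163458, 194567, 172356, 140238, 121236, 161368, 120347, 122368, 32578, 41234, 140357, 140234, 120236, 52468, 163568],
  [110348, 2457, 165678, 120145, 120128, 164678, 141378, 123678, 140358, 32567, 120256, 140468, 120125, 52567, 120348, 140148],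
  [1245, 120268, 162368, 12346, 54567, 23567, 120257, 34568, 140248, 121468, 120147, 172345, 120458, 51257, 120148, 33478],
  [140347, 33568, 121568, 32458, 13456, 1237, 71267, 140467, 120247, 163567, 151245, 31367, 120167, 123568, 121246, 122358],
  [1234, 123468, 143458, 141348, 140145, 140134, 140568, 143478, 121368, 53568, 140458, 143468, 140124, 141456, 140128, 120457],
  [140268, 121256, 120124, 133467, 141457, 120134]]

/-- Refutation for the colour sequence `AAAABBBBA`. -/
def certSteps0 : List (List ℕ × List ℕ × List ℕ) := [
  ([],[1245],[230]), ([],[2235,125],[239]), ([],[1146],[255]), ([125],[235],[266]),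
  ([],[8123],[268]), ([],[1123],[276]), ([],[8126,126],[277]), ([],[1278],[227]),
  ([],[1238],[216]), ([],[1237],[258]), ([],[2234,124],[283]), ([],[1258],[285]),
  ([135],[235],[288]), ([],[1267],[290]), ([],[2238],[299]), ([],[8345,345],[301]),
  ([],[8245,245],[303]), ([],[1235],[306]), ([],[1248],[309]),
  ([1145,4457,1247,1347,8457,1147,8367,1134,11567,1234,1357,11467,1257,11457,1345,8567,8357,1137,8345,8467,1157,12567,8347,1457,1135],[],[311]),
  ([],[8138],[313]), ([],[135,2358],[314]), ([],[1368],[316]),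
  ([8348,4457,6678,8367,1358,1578,1378,1357,8567,4678,1157,4458,8368,1458,8568,11568,1158,4578,8357,8358,4478,1178,1137,8345,8578,8347,8378,1138,1478,11578,1457,1257,1678,1135,11567],[],[317]),
  ([],[1126],[325]), ([],[567,8567],[326]), ([],[1234],[329]), ([],[1578],[242]),
  ([158],[],[287]), ([],[1568],[291]), ([358],[],[337]), ([],[8158],[244]), ([],[9358],[256]),
  ([258],[],[308]), ([],[10358],[245]), ([],[8258],[289]), ([],[457,8457],[338]),
  ([],[1358],[339]), ([126],[136],[340]),
  ([8235,8345,1135,9245,8125,2235,8135,9235,8245,1125,9345,10345,8145],[],[342]),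
  ([],[1378],[343]), ([],[1678],[247]), ([368],[],[319]), ([168],[],[274]), ([268],[],[280]),
  ([],[8368],[327]), ([],[8168],[237]), ([],[9368],[229]), ([],[10368],[271]), ([],[1567],[348]),
  ([12578,12568,1256,1168,1145,8468,1148,1456,8456,1458,1345,1156,1158,8458,8568,12678,1348,1346,13678,8478,8678,1246,1356,8578,5568,1268,1468],[],[349]),
  ([124],[234],[350]), ([],[1456],[351]), ([],[1246],[352]),
  ([8458,1158,4458,8348,8358,1134,11458,12568,1138,1348,1135,11578,11468,8378,1345,8578,8478,1458,8345,8468,1148,12578,1145,11478,11568,8568],[],[353]),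
  ([],[8238],[356]), ([],[2236,126],[357]),
  ([2568,11678,9348,8178,8348,1268,4468,9678,4568,9346,8126,1236,9378,8148,8136,2268,8128,8678,8146,8378,8156,9356,1138,8346,8356,2236,1136,2368,2468,8358,1168,1468],[],[358]),
  ([],[1347],[359]), ([],[236,3368],[360]), ([578,257],[],[361]), ([134],[234],[362]),
  ([],[357,8357],[363]), ([],[1136],[296]), ([],[1137],[221]), ([],[1357],[213]),
  ([],[1236],[365]), ([],[1157],[269]), ([],[1156],[305]), ([],[1135],[307]),
  ([468,246],[],[366]),
  ([1458,8378,8678,8568,11678,4456,8346,1268,8345,1256,1168,11578,1356,4468,1138,8578,13678,11568,1158,4568,8348,8358,8356,1468,4458],[],[367]),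
  ([1168,6678,1257,8567,1178,13678,8578,8678,1467,1256,1367,1458,1268,1158,1167,8568,1478,1457,1356,1468],[],[370]),
  ([],[1145],[371]), ([],[1128],[372]),
  ([1467,5678,1348,8458,1367,1148,1247,5567,8468,1147,8478,8456,1468,1478,1178,1268,5578,12678,8457,1167,1346,5568,1168,8678,8467],[],[373]),
  ([],[4678,367],[375]), ([],[1356],[257]), ([],[1367],[259]), ([],[1138],[220]),
  ([],[1168],[261]), ([],[1178],[320]), ([],[1158],[331]), ([],[8358],[376]), ([],[1478],[224]),
  ([248],[],[233]), ([148],[],[294]), ([348],[],[368]), ([],[10348],[241]), ([],[8348],[267]),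
  ([],[1256],[378]), ([],[468,8468],[379]), ([],[1125],[380]), ([],[1348],[382]),
  ([],[8148],[383]), ([],[1268],[385]),
  ([8268,8256,8678,8246,1468,8248,4568,8236,3568,10346,10678,10356,8378,11678,8356,3368,10378,4468,8346,3468,8278],[],[386]),
  ([],[1257],[390]), ([],[8248],[392]), ([],[2468,146],[393]), ([],[1147],[394]),
  ([],[1458],[396]), ([],[1148],[398]), ([478,347],[],[399]), ([],[8347,347],[400]),
  ([356,568],[],[401]), ([],[2568,156],[402]), ([245,458],[],[403]), ([127],[137],[405]),
  ([],[467,8467],[407]), ([],[1247],[408]),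
  ([1467,4457,8345,8567,8356,8357,11567,4567,1167,4456,1457,8367,4467,8347,8346],[],[409]),
  ([],[1167],[412]), ([],[4568,356],[413]), ([],[235,3358],[415]), ([124],[134],[416]),
  ([378],[],[240]), ([178],[],[328]), ([278],[],[347]), ([],[10378],[243]), ([],[8378],[282]),
  ([],[8178],[231]), ([],[9378],[374]), ([],[8278],[323]), ([],[4468,346],[417]),
  ([],[11458,458],[418]), ([],[9348],[419]), ([],[1346],[232]), ([],[1345],[270]),
  ([],[8145,145],[420]), ([],[134,8134],[421]), ([],[8568,568],[422]), ([],[11478,478],[423]),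
  ([],[136,2368],[424]), ([356,568],[],[425]), ([],[458,8458],[426]), ([],[468,11468],[427]),
  ([],[1468],[217]), ([],[1467],[260]), ([],[8124,124],[428]), ([],[8128],[430]),
  ([],[1457],[431]), ([],[8268],[432]), ([],[1124],[434]), ([],[1134],[437]),
  ([357],[4567,367],[300,254]),
  ([12568,11468,8468,11478,8478,12578,8568,11568,11578,8578],[345,458],[1003,1010,17,1048,1037]),
  ([5578,12567,5678,12568,11468,8468,11478,8478,12578,8567,11567,8568,11568,11578,8578,6678],[458,467,367],[1017,60,1004,1000,226,1043,193,27,123,34,200,92,86,1001,145,435,89,67,354]),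
  ([234,236,237,3467,10346,10347,10456,10356,10357,10457,3567,4467,11456,4567,11457,5567,10467,11467,10367],[],[22,32,4,234]),
  ([],[234],[1041,1035,364,1053,1004,1011,295,265]),
  ([458,8568,9568,11568,9578,11578,8578],[135,125],[205,332,1056,14,1051,17,53,74,1012,275,180,1048,249]),
  ([235,458,8568,9568,11568,9578,11578,8578],[124],[5,14,1022,35,53,74,133,1054,344,1057,214,1000,110,222,48,137,395]),
  ([247,124,456,457,10467,9467,678],[245,145],[1017,48,34,152,12,264,369,167,236,87,114,139,120,43,29,387,182,191,32,22,203,204,176,115,108,165,23,4,186,162,164,181,79,94,173,150,153,170,175,161,99,126,198]),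
  ([357,257,10457,3357,3347,4457,10347,3457,3345,10345,457,10467,12567,11467,11567,10567,10367],[],[86,128,135]),
  ([4457,8347,4478,8345,4458,8567,11567,8568,11568,11578,8578,4678,8367,6678],[357],[47,1038,1051]),
  ([235,257],[3357],[116,98]),
  ([10345,8568,11568,10568,11578,8578,10578],[235,345],[1057,17,160,195,1022,215,1056,218]),
  ([235,10467,457,678],[245,3457,345,578],[7,148,15,1017,121,11,143,9,2,152,12,134,96,97,40,155,1016,50,196,1035,1012,42,1009,53,1005,1004]),
  ([235,678,10467,457],[3457,345,578],[1000,41,62]),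
  ([247,3345,235,12567,3347,257,10457,10467,457,678],[345,578],[1000,12,120,197,8,4,116,22,1003,7,148,23,43,34,83,15,1019,121,11,143,9,2,152,96,167,97,87,40,155,1018,50,196,132,1037,1014,42,63,1011,53,1007,1006]),
  ([3345,3457,3356,3346,3367,3357,12567,3347,10456,3567,10457,10467,5567,10567],[246,245,247],[90,107,132]),
  ([3345,10345,12567,3347,257,10457,10467,457,678,6678],[345,578],[192,2,9,15,188,11,1021,1004,1002,12,120,197,8,4,116,22,1005,1062,17,7,148,23,43,34,1057,6,28,83,210,1040,3,1001,41,1000,171,109,146,31,1035,25,60,1006,1007]),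
  ([10345,12567,3347,257,10457,10467,457,678,6678],[345,578],[15,1022,11,188,9,2,192,1005,1000,5]),
  ([10345,12567,3347,257,10457,10467,457,678,6678],[578],[6,7,28,12,83,210,1000,26,202,27,123,41,5,1007,86,128,166,145,119,62,135,60]),
  ([678,3347,457,10467,345],[578],[26,93,29,55,14,51,15,7,85,20,30,1000]),
  ([6678,13678,457,8578],[467,678],[10,212,193,52,163,1061,1025,1046]),
  ([6678],[567,678,578],[10,57,2,127,1062,1026,1047]),
  ([6678,12567,3347,3357,10457,3457,4457,10357,11457,247,347,457,10467,10345,3345],[678,578],[57,119,2,1001,166,136,97,88,1000,59,129,135]),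
  ([567,12567,3347,3357,3457,10347,4457,257,357,457,10467,10345,3345],[],[29,321,52,157,129,88,136,59,1014]),
  ([12567,3347,3357,3457,4457,257,247,347,357,457,10467,10345,3345],[678,578],[29,119,128,86,1001,1000,127,20]),
  ([],[567,678,578],[127,1003,20]),
  ([3347,3345,3357,3457,4457,257,247,347,357,457,10467,10345],[678,578],[1001,1000,37,52]),
  ([457,10467,345,235],[578],[26,55,5,27,123,41,93,113,145,62,1016,32,1007,1000]),
  ([5567,5568,8456,12678,8457,5578,8478,8458],[467,678],[10,1042,212,1051,101,1053]),
  ([5568,8456,12678,8678,13678,12578,8478,8458,8578],[568,468],[1052,1034,42,1066]),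
  ([4568,11456,8356,11468,8468,5568,8456,12678,8678,11678,11478,8478,8458,11458],[346],[1,1039,178]),
  ([12678,8678,13678,11678,12578,11478,8478,345,8578,235],[468,456],[14,104,24,26,55,1032,1039,5,1054,1031,1001,38,1049,91,0,16,18,1043,1000,89,76,141,138,63,4,8,82]),
  ([345,235],[678,457,578],[1072,14,140,51,50,1036,40,1033,2,21,57,10,156,1006,111,24,104,65,1003,37,1000,158,105,78,102,106]),
  ([345,235],[457,578],[14,51,50,1037,40,9,2,140,1000,6,15,7,155,85,28,11,1038,42,20,1074,1056,1033,101,30,1029]),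
  ([678],[10467,478],[12,85,125]), ([345,235],[578],[14,26,51,1001,93,1007,1000,1009,52,157,58]),
  ([4456,4468,8346,4568,8356,8678,13678,11678,8345,4458,11578,8578],[568],[11,1041,1063]),
  ([568,4468,8346],[468,356,458,478,678],[1049,0,1038,1045,156,1041,40,10,21,1060,1037,163,24,104,18,178]),
  ([568],[458,345],[1084,1056,391,0,46,24,18,1,19,122]),
  ([12578,11478,8478,11578,8578],[458,345],[1085,17,1047,1040,1000,11,1044,158,42,1062,1039,1074]),
  ([8678,13678,11678,11578,8578],[356,568,345],[1086,17,0,46,1052,1,1049,19,1003]),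
  ([4456,3356,3346,10456,10356,11456,10345,3345],[246,346,245],[107,49,82]),
  ([246,267,257,237,236,256,124,456,467,457],[145],[58,29,32,22,4,43,23,1052,48,34,159,87,182,191,114,139,186,246,164,162,181,203,204,176,115,108,165,170,161,175,117,124,99,126,79,94,173,150,153,198]),
  ([457,458,235],[568,678,578],[1017,52,1007,1059,35,53,10,57,21,143,9,2,5,11,121,1048,335,1036,1002,298,100,67,72,103,81,112,45,381,23,4,8,1000,76,1001,19]),
  ([456,12568,5678,6678,12567,457,458,12678,12578,13678],[],[174,34,184,106]),
  ([457,235],[478,678,578],[2,9,1009,40,1049,50,1005,156,1019,57,1091,52,37,1001,78,179,1063,105,187,102,0,1,19,1000,24,18,122]),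
  ([235],[478,678,578],[1010,9,2,40,1050,50,1006,1000,238]),
  ([4456,8346,8345],[456,356],[0,24,18,122]),
  ([4568,8356,10356,3568,8256,4468,8346,10346,8246,3468,10678,8678,11678],[236],[322,1080,1070]),
  ([125,127,2247,9257,9457,2357,2345,9235,2347,9237,9567,9267,9467,124,10457,3357,3347,10467,10567,2457,9245,12567,3457,9247,3345],[],[1059,48,199,194,207]),
  ([2356,9236,9235,3356,10356,9356,9256,4456,10346,3456,10345,9345,9245,2456,9346,9246],[125,126],[1084,1101,433,355]),
  ([4568,8356,9356,2568,8156,4468,8346,9346,8146,2468,9678,8678,11678],[136],[297,1090,1054,1100,1085,334,1084]),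
  ([257,3357,237,267,124,125,134,9235,135,2457,9245,3457,9247,467,457,567,3345],[],[32,58,59,199,48,137,37,29,228,397,194,1067,108,406,150,153,79,94,201,117,124,209,207]),
  ([367,4567,10357,3567,3367,3357,267,3356,10356,4456,10346,3456,10345,4467,4457,3467,3457,10347,567],[],[59,129,88,253]),
  ([267,124,125,134,135,236,4456,4468,8346,10346,3456,10345,2457,9245,4467,4457,8347,4478,3467,3457,10347,9247,467,457,567,8678,11678,235],[356,256],[110,8,1066,0,16,5,302,98,22,1001,147,45,47,1083,149,33,1000,3,1078,69]),
  ([236,4468,8346,4467,8347,4478,567,8678,11678,235],[267,356],[1067,0,157,80,45,3,1079,47,1084,33,69]),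
  ([3367,3357,267,3356,4456,4468,8346,10346,3456,10345,4467,4457,8347,4478,3467,3457,10347,567,8678,11678,235],[257,356,256],[1068,0,16,147,45,47,1085,149,33,1002,3,1080,69]),
  ([9235,2356,9236,3356,10356,9356,9256,4456,10346,3456,10345,9345,9245,2456,9346,9246],[125,256],[346,1006]),
  ([235],[678,578],[1022,21,10,151,64,1032,1011,315,324,96,1078,51,235,312,318,248,1014,41,109,159,134,90,31,1077,25,273,36,1079,154,189,118,330,133,74,292,84,38,1076,35,56,66,107,49,1,1067,19,130,1075,177,77,54,61,16,0,1070,1009,8,1006,183,99,219,110,131,1002,1000,384,1003]),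
  ([6678,8568,11568,11578,8578],[356,567,367,345],[1100,28,1083,3,1105,17,46,389,44,47,1088,31,1078,25,1101]),
  ([10345,3347,457,257,678],[467,578],[29,7,15,20,12,30,125,1041]),
  ([245,3457,3367,3347,3567,3357,10457,457,3356,3346,10456,456,678,3345],[578],[34,7,12,83,1077,41,286,51,97,63,87,1026,30,132]),
  ([3347,257,3356,3346,10456,10356,678,3345],[245,346,345,578],[6,44,7,15,20,3,1086,2,9,11,28,1081,31,17,1108,1103,1067,25,1052,190,19,1002,68,67,12,35,1020,1001,146]),
  ([235],[346,578],[2,9,1027,1004,6,7,15,11,1068,20,1003,81,8,4,68,72,23,103,1104,28,1087,3,1109,17,5,44,31,1082,25,1053,45,113,190,29,1052,43,32,22,1000,41,1001,62]),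
  ([357,235],[578],[1005,12,6,1000,211,125,7,30,2,9,1028,15,11,1069,20,1004,81,8,4,68,72,23,5,45,113,345,29,1053,43,32,22,1050,1045,1002,35]),
  ([235],[578],[2,9,1029,17,1111,1006,6,15,7,3,1089,28,11,1070,20,1106,1000,73,31,1084,25,1055]),
  ([567,6678,678,578],[345],[1112,71,13,144,100,1027,46,169,179,1,19,75,95,102,1018,388,111,184,37,105,34,174,106]),
  ([11567,8567,8367],[356,345,357],[73,25,1086,1113,1096,0,46,33,1,19,36,1080]),
  ([457,356,6678,678,235],[346,345],[19,68,67,81,8,4,72,23,103,1086,1002,1001,71,12,1099,5,208,185,93,75,95,35,1026,281,146,101,42,30,1023]),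
  ([11567],[457,567,345,367,357],[1110,73,25,1088,1115,3,1098,1109,206,70,1083,30,60,1113]),
  ([11567,6678,678,235],[345],[1004,1003,1111,6,3,71,13,1002,1088,68,1000,208,185,1001,75,95,187,211,101,42,30,1025]),
  ([6678,678,235],[345],[6,1005,1004,1000,28]),
  ([],[567,6678,345,367,357],[3,1113,28,20,1004,1074]),
  ([678,235],[345],[6,1007,13,1001,1000,144,78]),
  ([346,567,345,235],[],[1008,13,100,27,111,18,1105,377,91,16,26,55,5,89,76,141,138,63,4,8,82]),
  ([8347,4467,8346,11456,5567,8456,4567,8356,11457,8457,8357],[467,367],[3,1089,60,262]),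
  ([567,678,235],[],[1010,13,1002,27,70,1116,14,140,71,6,1105,144,100,111,78,0,33,24,104,65,18,1001,1,44,36,1095,1000,251,85,37,105,102,75,95,106]),
  ([345],[346,467,367,357],[27,70,1117,1106,1,404,200,44,36,0,33,24,65,18,1096,1001]),
  ([12567,8467,8567],[456,457],[1118,24,65,279]),
  ([678,235],[],[1013,13,5,6,1005,26,27,55,1002,1120,206,1093,30,1001,89,76,141,138,63,4,8,1000,92,293,103,23,82,67]),
  ([346,235],[],[1014,1000,39,1098,142,46,1005]), ([345,235],[467],[1000,1015,13,284,1003]),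
  ([235],[367],[1001,1091,1,1016,13,1002,39,1100,33,1094,0,10,21,1111,47,3,1106,44,31,1101,36,69]),
  ([235],[468,458],[1002,1092,1,1017,1003,39,1101,250,1045]),
  ([124,247,3457,345,235],[],[26,1018,1004,39,84,21,10,151,14,1000,172,1105,154,1102,77,1003,1,1093,130,1101,1096,0,118,1032,183,333,410,1002,1001,64,1112,56,66,38,16,54,61,49,1035,80,58,142,59,112,98,32,411,201,131,94,79,272,209,124,117,137,110,37,1115,13,27,168,223,436,304,5,278,114,139,252,115,108,1034]),
  ([9234,3346,2346,9236,10346,9346,9246,10456,9456,11456,568],[124,246],[1103,38,16,84,77,177,1133,263,414,1119,336]),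
  ([345,235],[247,347],[1005,36,1003,1006,21,10,64,14,1002,1114,56,66,1020,39,1104,38,16,1,1095,54,61,1098,0,49,1037,80,88,1004,58,112,136,92,91,18,13,27,65,1117,168,70,33,147,149,109,90,1081]),
  ([247,345,235],[],[1021,1007,39,1105,92,18,84,429,38,91,14,1003,1115,172,189,1006,118,49,21,10,64,56,66,16,1,1096,54,61,1099,0,1038,151,1108,154,77,130,1104,1035,99,131,126,4,48,1001,26,62,1002]),
  ([345,235],[],[1000,171,1001]),
  ([235],[],[1023,13,1120,1009,21,10,64,39,142,38,1107,54,61,16,0,1101,1008,1,1098,1006,1000,73,1050,19,31,1108,25,36,169,1105,96,35,225,109,134,90,56,66,107,49,1040,8,112,80,98,22,1032]),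
  ([],[8235],[160]), ([125],[],[1139]), ([135],[],[1136]), ([245],[],[195]), ([345],[],[202]),
  ([],[2235],[1140]), ([],[8125],[205]), ([145],[],[341]), ([],[8135],[180]), ([],[9235],[310]),
  ([],[8245],[1134]), ([],[10345],[35]), ([],[8345],[1135]), ([],[8145],[1096]),
  ([],[9245],[133]), ([],[9345],[74]), ([],[],[1127])]

theorem certCheck0 : checkCert 9 [true, true, true, true, false, false, false, false, true]
    certTable0 certSteps0 = true := by
  decide +kernel

/-- Clauses used for the colour sequence `AAABABBBA`. -/
def certTable1 : List (List ℕ) := [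

  [133457, 124567, 133467, 122345, 153567, 124678, 140678, 124578, 142457, 55678, 52457, 133567, 144567, 133456, 122356, 132457],
  [155678, 144678, 142467, 52456, 140568, 122347, 53456, 133478, 34567, 131235, 52467, 151245, 135678, 133458, 153456, 151345],
  [32567, 140578, 152347, 133468, 152567, 122357, 21456, 31568, 194567, 122578, 133578, 122678, 140267, 154567, 133678, 143567],
  [63468, 32578, 142456, 12567, 133568, 132456, 144578, 24567, 143467, 44567, 32467, 125678, 153568, 195678, 52678, 4567],
  [45678, 153457, 151267, 152357, 51257, 140136, 131457, 33467, 153578, 151247, 151357, 131257, 153467, 32378, 151347, 140256],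
  [141256, 151567, 131237, 52357, 142356, 141235, 152345, 71235, 22456, 140126, 53568, 52367, 33568, 31257, 141456, 11457],
  [172357, 14567, 151235, 53457, 151257, 122567, 153678, 132467, 151367, 13457, 122367, 12457, 134567, 143456, 75678, 152346],
  [131456, 152367, 143457, 152356, 53467, 164678, 121368, 140146, 42357, 122568, 73456, 131256, 140246, 152456, 71246, 1567],
  [141236, 140156, 32456, 142357, 32568, 53578, 140236, 140235, 54568, 33567, 2357, 71356, 35678, 131356, 12356, 53567],
  [33678, 2567, 121357, 141237, 131236, 51356, 142367, 132356, 31235, 151246, 183456, 152467, 123567, 2367, 140245, 145678],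
  [142678, 184567, 21256, 172356, 151346, 51267, 120234, 122478, 120457, 140125, 1345, 121234, 12357, 140247, 162478, 32358],
  [23468, 122378, 140134, 140478, 161246, 140238, 120378, 111468, 122368, 120158, 110478, 120347, 183467, 120157, 111268, 151236],
  [65678, 120456, 120124, 121568, 140138, 120568, 71346, 120257, 110458, 54567, 140468, 110258, 183457, 123568, 122358, 111238],
  [52567, 21246, 120168, 120346, 140234, 120458, 61456, 162468, 120246, 141678, 140123, 41246, 165678, 140135, 140145, 151237],
  [110234, 120126, 120127, 52368, 61234, 161245, 120567, 131357, 63478, 151356, 140128, 32368, 2345, 121348, 31236, 73678],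
  [121256, 53678, 1346, 140237, 122468, 141478, 110158, 143578, 110138, 140567, 141234, 142567, 63678, 140178, 51567, 71236],
  [132357, 33578, 110168, 143678, 122346, 34678, 161234, 120345, 140456, 72356, 124568, 64567, 140458, 122458, 172456, 140258],
  [122348, 143568, 140248, 120248, 12456, 23458, 120356, 41245, 141356, 120256, 120134, 142578, 162458, 120478, 51678, 120258],
  [120358, 121345, 120268, 1245, 31378, 2346, 120278, 164567, 121356, 72456, 13567, 123578, 140158, 151256, 120578, 141458],
  [140148, 120146, 51236, 140124, 142478, 120125, 34578, 120128, 63458, 120368, 120123, 123678, 120367, 120178, 43678, 120156],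
  [161468, 120245, 141246, 110278, 73567, 120678, 140168, 121468, 121248, 140257, 140467, 110178, 120147, 120148, 2356, 71456],
  [144568, 120468, 142458, 141245, 120467, 140278, 142468, 121268, 31357, 120247, 42345, 141468, 164578, 164568, 32678, 120267],
  [43478, 121246, 21245, 120167, 121245, 2347, 62356, 140268, 120357, 33457, 120348, 142568, 42346, 22347, 120145, 22567],
  [140457, 121346, 42347]]

/-- Refutation for the colour sequence `AAABABBBA`. -/
def certSteps1 : List (List ℕ × List ℕ × List ℕ) := [
  ([],[1158],[185]), ([],[1157],[189]), ([],[1124],[194]), ([126],[246],[209]), ([],[1346],[211]),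
  ([],[234,8234],[212]), ([],[123,8123],[218]), ([146],[246],[219]),
  ([1468,1268,1378,1156,1567,1167,1458,8678,1578,1368,1478,1278,1258,1568,1357,1467,1678,1178,8568,13678,1358,1267,8567,6678,8578,1256,1257,1356,1457,1168,1367,1456],[],[220]),
  ([234],[],[224]), ([],[8234],[1003]), ([],[1127],[226]), ([134],[],[228]), ([],[8134],[178]),
  ([8145,1345,9234,8124,1245,8135,8235,2245,9235,1125,2345,9245,8245,1145,3345,8125],[],[229]),
  ([],[1567],[230]), ([235],[245],[236]), ([],[138,2348],[237]), ([136],[146],[242]),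
  ([138],[],[248]), ([],[8138],[196]), ([238],[],[207]), ([],[2348],[1001]), ([],[8238],[181]),
  ([],[567,8567],[249]), ([],[9234],[250]), ([168],[],[258]), ([468],[],[183]), ([268],[],[190]),
  ([],[8468],[202]), ([],[1568],[197]), ([458],[],[200]), ([258],[],[203]), ([158],[],[246]),
  ([],[236,3346],[260]), ([678,467],[],[261]), ([8124,2234,1123,8123,1134,1234],[],[262]),
  ([],[1345],[263]), ([],[456,8456],[264]), ([],[5568,456],[266]), ([],[8458],[268]),
  ([2246,2245,9236,3345,2346,9245,9456,3456,9256,2256,10456,9246,3346,2356,9235,2456,2345,3356],[],[270]),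
  ([],[8258],[271]), ([],[3348],[272]), ([348],[345],[277]), ([145],[245],[279]),
  ([],[1234],[166]), ([],[1248],[275]), ([],[1134],[282]),
  ([3358,10578,3345,1128,8478,1148,12568,10568,10468,1245,1358,1125,8245,8268,8235,10478,8578,8568,12578,1458,1258,1145,8248,3458,10458,1348,8278],[],[284]),
  ([],[1478],[285]), ([],[1258],[287]), ([],[1358],[288]), ([],[2345,135],[289]),
  ([],[1268],[290]), ([125],[145],[291]), ([378,137],[],[292]), ([236],[246],[293]),
  ([],[1278],[294]),
  ([1357,5567,1156,1247,1167,12567,1456,8567,1467,1457,8457,1367,1356,1256,1147,1246,8467,1257,8456,1245,1267,1145,1347,1146],[],[295]),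
  ([],[8158],[300]), ([],[1578],[302]), ([],[9458],[303]), ([],[1146],[305]), ([],[1246],[216]),
  ([],[8128],[234]), ([],[8124],[307]), ([],[1257],[199]), ([],[1256],[281]), ([],[1125],[309]),
  ([457,578],[],[310]), ([358],[348],[312]), ([],[1368],[313]), ([],[1123],[314]),
  ([],[1347],[187]), ([],[1378],[182]), ([],[1367],[316]), ([],[1178],[317]), ([],[1156],[319]),
  ([1468,8478,2468,2568,12678,9678,2368,9478,1148,8148,2248,8168,2268,1348,9468,2246,8178,9456,8126,5568,1168,8136,2346,8456,8146,8156,8678],[],[320]),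
  ([],[1245],[321]), ([],[1678],[325]), ([],[8168],[326]), ([],[8248],[274]), ([],[8148],[304]),
  ([],[2468,146],[327]), ([],[2248],[328]), ([],[8257,257],[329]), ([],[467,8467],[330]),
  ([],[1147],[332]), ([],[1148],[333]), ([],[12568,568],[336]), ([],[1468],[337]),
  ([],[10458],[338]), ([],[1467],[340]), ([],[1356],[278]), ([],[10468],[342]),
  ([],[126,2268],[343]), ([],[1247],[345]), ([245],[345],[346]), ([],[9468],[347]),
  ([],[1126],[225]),
  ([8467,5678,8567,1145,6678,12578,1348,12567,8578,1458,8568,1457,8478,12568,1357,5578,8457],[],[348]),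
  ([1458,12568,12578,8578,8678,8478,1348,13678,8456,1145,1168,5568,1456,12678,8568],[],[349]),
  ([267,678],[],[350]), ([],[1456],[193]), ([],[1458],[213]), ([],[1457],[168]),
  ([],[1267],[351]), ([],[126,2246],[353]), ([125],[245],[354]), ([],[1167],[355]),
  ([],[2245,125],[356]), ([237],[247],[357]), ([],[8268],[359]), ([],[1357],[360]),
  ([],[1348],[362]), ([],[568,10568],[363]), ([246],[346],[364]), ([],[1128],[311]),
  ([],[1168],[210]), ([237],[347],[365]), ([478],[],[186]), ([278],[],[323]), ([178],[],[331]),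
  ([],[8478],[179]), ([],[10478],[308]), ([],[8278],[341]), ([],[9478],[245]), ([],[8178],[253]),
  ([],[1145],[366]), ([],[8457,457],[368]), ([],[2346,136],[369]), ([247],[347],[370]),
  ([678],[6678,13678],[16,110,9,59]), ([],[6678,13678],[1000,159,64,192,28]),
  ([4456,4467,4457,11467,11567,367,12567],[357,456,457],[1,114,298,156,109,40]),
  ([246,11456,10356,3356,3345,3346,345,346,10456],[456],[13,88,53,111,86,154]),
  ([3568,10456,8256,5568,8456,10678,12678,8678],[246,236],[1039,134,184,124,244,215]),
  ([378,467,567],[457,257,678],[45,32,101,121,24,50,79,1036,1037,1,8,160,17,6,232,77,252,318,352,176,1034,21,235,4,76,0,2,13,1040,106,1002,83,3,14,37,1000,88,53,26,58,36,155,15,103,161]),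
  ([246,467,567],[357,457],[45,24,88,1010,1019,13,71,116,0,2,4,76,1003]),
  ([3568,10456,8256,5568,8456,10678,12678,8678],[246],[1030,1002]),
  ([467,578],[678],[6,17,160,1029,64,24,1040,1039,49,32,79,50,121,1000,1002,1001,133]),
  ([],[678,13678],[6,17,159,1030,64,7,1011,24,1,1041,1040,1000,5,1025,117]),
  ([],[457,13678],[1000,1044,16,9,12,1046,110,1025,20,33,54,1026,5,1008,7,1012,1022]),
  ([],[245,13678],[1001,16,110,1016,1026,20,33,283,54,1050,269,158,206,3,135,1038]),
  ([357,346],[367,13678],[1002,16,9,1001,55,122,11,65,1000,1025,361,2,13,30,0,108,1046,12,47,56,40]),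
  ([4456,3456,11456,10356,10456,256,10346,10345],[236],[1048,142,14,3,154]),
  ([246],[13678],[1003,1002,1027,99,86,1004,16,9,55,62,1018,111,297,122,125,115,30,53,13,1000,91,1001]),
  ([678],[13678],[16,9,1004,55,1003,1000,130]), ([],[13678],[1006,1000]),
  ([245],[246],[1058,1053,1017,1039,128,69,1051,134,119,1061,1025,89,322,124,130,276,214,1048,79,50,80,129,94,180]),
  ([],[245],[1056,1045,339,158,1025,3,135,170,222,169,1024,85,221,1043,1057]), ([],[345],[1030]),
  ([],[10345],[86]), ([],[246],[1000]), ([],[346],[1021]), ([],[10346],[111]), ([],[3456],[53]),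
  ([],[4456],[13]), ([5567,8457,8456],[567,467],[1033,1053,12,1039]),
  ([8257,10457,3578,8457,5578,10467,8267,3678,8467,5678],[247,237],[243,21,177,167,173,174]),
  ([123,2356,3356,9235,9356,10356,2456,9345,9245,125,126,9236,9246,9256],[],[123,126,164,148,25,163]),
  ([],[123],[171,1063,1053]),
  ([236,2456,9345,9245,126,9236,9246,9256],[156,256],[162,334,265,255,87,98,151,84,280,141,1000]),
  ([4567,11457,10357,11456,10356,4467,10347,3467,3367,3347,3567,10457,5567,3346,10456],[367,267,467],[18,56,150,188]),
  ([235,11456,10356,10347,347,3467,3367,3347,567,3567,5567,678,3346,10456],[356,257,457],[2,0,140,28,9,8,62,1056,175,83,299,205,131,114,156,1000,144,241,4,46,48,60,102,72,23,35,29,61]),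
  ([10356,3567,678,3346,10456],[356,257,236,456],[1057,5,1039,62,43,44,18,63,7,1025,41,8,1040,157,1004,1023,34,103,106,21,1055,1,1005,109,1000,3,14,1019]),
  ([356,347,567,678],[],[2,0,140,28,9,90,92,137,143,46,48,239,60,42,52,11,4,23,35,29,102,72,61]),
  ([678,3346,10456],[236,256,456],[1057,1059,62,5,1041,63,43,44,18,145,7,1027,1,41,8,1042,101,1007,157,1006,1025,1000,84,1001]),
  ([],[467,457,678,456],[1,1028,7,17,6,1057,1058,5,1042,117]),
  ([11456,10356,3346,10456],[235,236,456],[3,14,1023]),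
  ([235],[257,678,456],[10,1001,57,83,1021]), ([567],[357,678,456],[99,1022,1002]),
  ([],[467,678,456],[63,1003]), ([],[568,578,678,456],[33,54,17,6,1062,1063,20,1046,1042]),
  ([6678,4458,4468,4478,4568,4578,4678,11568,4467,4457,11567,4567],[378,578,678],[247,259,61]),
  ([257,356,126],[135,235,678,256,456],[85,162,25,126,38,31,27,120,49,145,367,107,68,93,324,11,105,67,74,113,36,165,15,34,95,100,82,75,4,0,2,81,104,66,78,73,70,1001,90,92,60,46,48,42,52,23,35,29,28,1000,77,1057,37,147,146,96]),
  ([3346,10456],[257,235,236,256,456],[1008,1003,58,103,15,57,26,36,45,155,14,3,10,8,101,138,1,21,106,37,161]),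
  ([356,257,126],[235,678,156,256,456],[149,1001]),
  ([235,257,357,567,367,347,247,267],[156],[67,4,0,34,15,36,113,152,87,98,172,1061,25,68,93,344,256,27,31,127,95,100,74,82,75,231,223,81,104,66,78,73,70,96]),
  ([125,145,2357,9237,3357,9235,9245,9345,257,357,567,367,347,247,267],[156],[67,4,0,34,15,36,113,25,68,93,127,95,100,74,82,75,81,104,66,78,73,70,96]),
  ([2246,2268,8126,2346,2368,8136],[146,678,456],[1007,1029,1006,39,94,195,129,217,17,6,1069,1070,1056,119,1057]),
  ([145,146,2357,9237,3357,2346,9236,2356,2345,9235,9245,9345,3356,257,9456,9256,357,567,367,347,247,267,10456,3346],[126,156],[153,1048,1002,3,1001,1046,240,112,1069]),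
  ([356,9245,9345,257,10456],[256,456,236],[1075,1014,1009,26,58,71,116,57,1010,1031,1008,39,1003,14,94,80,28,4,2,0,149,139,90,92,11,1004,85,1066,296,69,128,118,1041,46,48,60,42,52,89,1054,1049,23,35,29,1007,77,1064,37,147,146,1001,1000,38]),
  ([10456],[356,235,256,456,236],[1076,84,109,1013]),
  ([257,10456],[256,456,236],[1077,1016,1011,1033,1010,39,57,1012,116,71,58,26,1005,1000,139,1006,69,118,1043,89,1056,1051,1003,38,27,31,1001]),
  ([10456,3346],[256,236,456],[1017,1000,1014,1008]),
  ([256],[257,456],[1076,10,32,1046,1,267,1026]),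
  ([256],[456,236],[1077,132,358,142,1000,120,49,105,1013,1020,1079,1081,12,55,1061,1047,1,1067]),
  ([],[456,236],[1081,1000,50,1002]), ([],[236],[1000,19,22,125,115,30,1033]), ([368],[],[227]),
  ([],[136],[306]), ([],[126],[238]), ([],[146],[198]), ([],[9236],[191]), ([],[2236],[148]),
  ([],[9246],[153]), ([],[9346],[164]),
  ([],[457,567,578,568],[33,1083,20,59,1088,6,1081,12,1063,5,54,1062,7,1049,1059]),
  ([257,456],[567],[107,1048,2,0,49,33,22,30,136,20,1084,59,1089,6,1082,144,12,47,56,1000,99,65,108,11,40]),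
  ([257,456],[],[22,30,107,1049,0,2,1000,24,201,137,143,65,108,45,76,11,4,40]),
  ([357,456],[],[19,1000,51,91,315,32,47,136,10,1002,64,59,273,22,257,133,105,11,42,1070,52,102,72,0,2,23,35,29,61]),
  ([456],[347],[1001,10,97,1067,5,19,51,18,44,43,1053,7,1068,8,41,1054,1051,1032]),
  ([456],[247],[1002,10,97,1068,5,19,51,18,44,43,1054,7,1069,8,41,1058,1033]),
  ([4457,456],[235,237],[21,1001,1000,34,15,1003,10,1002,114,131,19,51,91,150,97,56,32,47,12,251,18,8,3,37,204]),
  ([235,456],[],[22,335,233,19,301,115,152,87,98,151,1079,123,25,141,27,31,112,163]),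
  ([456],[],[1005,1003,1000,138,1001,0]), ([],[8456],[1087]), ([],[145],[38]), ([],[9245],[27]),
  ([],[9345],[31]), ([],[2456],[112]), ([],[156,256],[80,1034]),
  ([],[267],[26,63,1025,1058,1,286,1038,208,254,1000]), ([678],[],[1066]), ([],[467],[1025]),
  ([578],[],[1047]), ([],[568],[1024]), ([156],[],[39]), ([256],[],[132]), ([],[],[1000])]

theorem certCheck1 : checkCert 9 [true, true, true, false, true, false, false, false, true]
    certTable1 certSteps1 = true := by
  decide +kernel

/-- Clauses used for the colour sequence `AAABBBABA`. -/
def certTable2 : List (List ℕ) := [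

  [140234, 154567, 122346, 142456, 143456, 140235, 140245, 122456, 153567, 123456, 153467, 142346, 131245, 122345, 142356, 133456],
  [172345, 131235, 131234, 142345, 53456, 32456, 33568, 52356, 151345, 45678, 65678, 34568, 134567, 3456, 54567, 152345],
  [194567, 34567, 133457, 151245, 133467, 162356, 140458, 31234, 21234, 122348, 163456, 44678, 142468, 151234, 53567, 142568],
  [51235, 140568, 32345, 31235, 144578, 153457, 53467, 132345, 52358, 153456, 131345, 51245, 53457, 124567, 140468, 121345],
  [51234, 154568, 31245, 122458, 123467, 133567, 123457, 124568, 33578, 74578, 141234, 151235, 141235, 33467, 161246, 120456],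
  [31356, 123567, 32478, 194568, 91468, 53458, 120128, 120135, 101238, 63578, 120125, 110246, 110278, 43678, 51346, 140236],
  [141245, 140258, 120236, 92368, 143478, 54578, 33456, 120248, 120568, 140248, 63456, 122468, 140146, 140246, 110136, 140136],
  [111236, 162468, 33457, 122356, 110146, 123568, 143678, 142578, 162345, 120245, 120458, 120156, 120246, 140578, 140678, 54568],
  [122368, 134678, 141236, 120234, 120258, 71345, 120235, 120356, 133468, 111248, 120145, 33567, 143578, 122358, 140124, 120146],
  [31358, 112678, 120468, 134568, 134578, 141356, 140478, 92568, 120358, 43456, 120134, 140134, 140278, 120168, 110156, 62345],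
  [162568, 24678, 44568, 121246, 140126, 120126, 120124, 143458, 142478, 111256, 122568, 120148, 2345, 53468, 140156, 140256],
  [140456, 162456, 64578, 52346, 142458, 161236, 120136, 120268, 120123, 141345, 141346, 121346, 120345, 31345, 144678, 140346],
  [153568, 51456, 33468, 52347, 140238, 73578, 135678, 162346, 72345, 23456, 140123, 140268, 32348, 142678, 133458, 141256],
  [140356, 120368, 25678, 140345, 141456, 153468, 143457, 120256, 33478, 120158, 141246, 120346, 205678, 120348, 145678, 121236],
  [24578]]

/-- Refutation for the colour sequence `AAABBBABA`. -/
def certSteps2 : List (List ℕ × List ℕ × List ℕ) := [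
  ([],[1135],[87]), ([],[8236,236],[95]), ([],[1236],[98]), ([136],[],[110]), ([],[8136],[111]),
  ([236],[],[112]), ([],[8236],[1000]), ([238],[],[99]), ([138],[],[88]),
  ([10456,5568,3368,1246,1248,1126,8268,1148,1146,1346,1348,1368,8248,12678,10468,10458,3348,8246,8678,8234,8468,10478,1468,10678,8238,8278,1268,3568,8456,3468,1568,8478,1124,8258,8458,8256,3346,1168,1128],[],[113]),
  ([],[235,3356],[115]), ([],[1245],[121]), ([],[1458],[122]), ([],[1156],[123]),
  ([],[1246],[124]), ([],[3368],[128]), ([],[9236],[130]), ([],[1234],[131]), ([278],[],[92]),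
  ([],[1356],[135]), ([],[1145],[138]), ([],[1248],[103]), ([],[3358,235],[141]),
  ([],[124,8124],[142]), ([],[1146],[143]), ([358,135],[],[144]), ([678],[],[145]),
  ([],[8678],[126]), ([],[1468],[146]), ([],[478,8478],[150]), ([],[1358],[152]),
  ([],[1134],[154]), ([],[8134,134],[155]), ([],[8278],[156]), ([],[1168],[157]),
  ([156],[],[158]),
  ([1158,10678,8258,8246,8248,3356,8238,13678,3358,8235,8245,8268,1125,1456,10568,1368,3568,1568,8256,1256,3456,8578,10578,8568,3468,1258,1128,3458,1268,1126],[],[160]),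
  ([468],[467],[161]), ([],[8126],[164]), ([],[1126],[165]), ([],[1124],[166]), ([246],[],[91]),
  ([146],[],[116]), ([],[1456],[79]), ([],[8246],[109]), ([148],[],[84]), ([],[8146],[108]),
  ([248],[],[137]), ([],[8248],[105]), ([],[3468],[107]), ([],[478,10478],[168]),
  ([256],[],[169]), ([258],[],[151]), ([],[8258],[97]), ([],[1568],[104]), ([],[3568],[170]),
  ([],[1148],[171]), ([],[8156],[174]), ([],[8256],[175]), ([],[456,8456],[176]),
  ([3456,8245,1256,3356,8456,10456,1125,8234,8235,3345,3346,1345,1346],[],[177]),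
  ([346,234],[],[179]), ([],[458,10458],[180]),
  ([1123,9346,9256,1136,2236,10346,9246,9356,8123,10356,8346,8356],[],[181]), ([],[1136],[182]),
  ([],[1268],[183]), ([],[1123],[184]), ([],[9346,346],[186]), ([],[134,2346],[187]),
  ([],[1345],[188]), ([],[478,12678],[190]), ([],[8346,346],[191]), ([145,456],[],[193]),
  ([],[8238],[196]), ([3346,10456,8456,8346,11456,8356,1346,10356,10346,8234],[],[199]),
  ([],[1258],[132]), ([],[1235],[134]), ([],[8123,123],[202]), ([],[8268],[203]),
  ([348,234],[],[204]), ([],[10678],[205]), ([],[9256],[207]), ([],[8356,356],[208]),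
  ([],[1368],[209]), ([568],[567],[210]), ([],[345,8345],[211]), ([],[9456,456],[212]),
  ([],[1256],[215]), ([],[1158],[217]), ([],[9246],[218]), ([],[1346],[219]), ([],[1348],[221]),
  ([],[578,13678],[222]), ([],[123,2236],[223]), ([],[1125],[90]), ([],[1128],[86]),
  ([],[346,234,356,456],[0,2,4,1005,14,1018,3,11,1010,1008]),
  ([],[234,235,456,245],[5,1028,1019,3,7,6,2,0,13,1018]),
  ([],[346,456,235],[1020,1012,106,1001,1007,4,50,1005,9,42]),
  ([11456,5567,4457,4467,4456,11467,11567,12567],[357,356,457],[214,81,32]),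
  ([9234,8234,3346,2346,8134,9456,8456,10456],[124],[1029,163,78]),
  ([358],[456],[1029,56,76,3,1023,1007,1002,94,1021,201,1027,1017,63,2,0,74,13,1003,31,1000,40,18,59,66,17,12,35,24,16]),
  ([345,457,456,11467,11567,12567],[],[28,102,20,15,114,60,57,36,34,53,69,32]),
  ([8345,10345,8245],[234,235],[5,0,13,120]),
  ([356,4457,4467,4456,456,11467,11567,12567,567],[],[33,28,139,57,53,69,32]),
  ([358,478,578],[],[25,43,1,82,56,197,1036,5,93,8,10,1003,21,33,6,7,1002,19,1012,1001,1025,195,11,1019,9,68,70,1000,14,1014,37]),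
  ([],[235,245,345,356],[19,7,6,29,9,1020,11,1013,1015,14,1037,5,37]),
  ([],[123,346,356],[1021,1024,11,1016,149,14,1018,1011,1025]),
  ([234,235,9345,10345,9245,123],[],[51,17,48,75,55,39,64,18,58,12,45,16]),
  ([456],[345,356],[29,1001,21,1022,96,19,185,1002,1000,172]),
  ([],[345,356],[1019,1017,29,1024,9,1000,1032,4,42]),
  ([],[346,356],[1000,20,1003,1012,1014,200,55,48,51,39,64,31,58,75,133,12,17,18,45,24,35,16]),
  ([478,578],[],[26,25,43,1,1006,72,22,1001,20,60,4,61,1000,77,54,15,36,34,8,10,1012]),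
  ([467,578],[],[26,1000,73,27,1011,22,1002,1001,15,4,72,101,61,25,1,77,54,36,34,8,10,1013]),
  ([578],[],[26,1001,1041,1037,1029,73,38,27,1033,71,3,1036,1012,22,1002,1034,2,41,0,1000,1038,44,62,1046]),
  ([],[8578],[125]), ([],[10578],[119]), ([],[13678],[1019]),
  ([12678,10478,8478,5568,10458,8458,8234,3348,3346,8456,10456],[468],[44,62,1046]),
  ([345],[356],[1003,20,1035,15,3,1037,1013,4,2,41,0,89,85,117,118,140,38,1034,71,178,167,1042,1038,1030,52,100,1000,162,65,194,173,206,136,213,192,83]),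
  ([345],[456],[1000,23,50,0,2,80,189,74,1032,1042,13,63,76,3,1038,1022,1018,1015,31,59,66,40,18,24,35,12,17,16]),
  ([345],[568],[1000,21,67,7,6,1001,23,5,1047,1048,47,49,1042]),
  ([345],[],[1002,1001,1000,1026,46,30,33,8,10,1,1015]), ([],[8345],[1025]), ([],[356],[1007]),
  ([235],[],[23]), ([],[456],[153]), ([],[3356],[1049]), ([],[3358],[1048]), ([],[8235],[5]),
  ([245],[],[159]), ([],[8245],[6]), ([],[3456],[7]), ([],[3458],[67]), ([],[10345],[19]),
  ([],[234],[1014]), ([346],[],[1038]), ([348],[],[1028]), ([],[4456],[9]),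
  ([567],[347],[30,1,46,10,8,68,70,1013]),
  ([568,458],[],[224,148,28,147,1027,127,30,198,129,65,1,1000,216,1034,52,220]),
  ([],[568],[47,49,1045]), ([],[458],[27]), ([],[],[1000])]

theorem certCheck2 : checkCert 9 [true, true, true, false, false, false, true, false, true]
    certTable2 certSteps2 = true := by
  decide +kernel

/-- Clauses used for the colour sequence `AAABBBBAA`. -/
def certTable3 : List (List ℕ) := [

  [140567, 140367, 32457, 140347, 140234, 63567, 143467, 140235, 140245, 122347, 122456, 122457, 141235, 154578, 55678, 122345],
  [144567, 122356, 143567, 154678, 64567, 142367, 124678, 122346, 123456, 45678, 142357, 141234, 123457, 142345, 123678, 140458],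
  [52468, 143456, 140345, 143457, 134567, 124578, 123467, 155678, 23567, 140346, 32467, 125678, 121345, 2356, 131235, 134578],
  [141236, 123578, 52358, 134568, 131245, 32345, 73457, 141245, 142346, 140256, 124567, 42346, 123478, 53457, 121347, 23467],
  [75678, 122567, 123567, 52356, 140356, 31345, 205678, 152346, 152356, 131234, 34678, 54578, 121356, 152456, 34578, 135678],
  [1235, 33578, 132456, 172345, 33457, 133456, 131236, 131246, 31256, 140358, 21234, 140578, 72346, 63568, 183456, 3458],
  [121456, 52346, 144568, 51256, 1245, 134678, 32346, 72456, 13456, 154567, 33568, 141246, 141345, 140378, 121346, 53458],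
  [140478, 35678, 151256, 154568, 131256, 54678, 53468, 152345, 4567, 142356, 153456, 151245, 65678, 33478, 132345, 142578],
  [2346, 31468, 52467, 73467, 143468, 142348, 141346, 122458, 52347, 132356, 140678, 51467, 52368, 122358, 162357, 53478],
  [63456, 31246, 23578, 145678, 44567, 151345, 31368, 63457, 5678, 143568, 162578, 51346, 142358, 31346, 153578, 172456],
  [53467, 142378, 153678, 44578, 51245, 172356, 43578, 52345, 151456, 31245, 133567, 153478, 43457, 23456, 132346, 13568],
  [133478, 123468, 124568, 74568, 62345, 151356, 143458, 123568, 120678, 110158, 72345, 120148, 120158, 120238, 195678, 140258],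
  [120258, 61345, 141247, 111257, 120347, 111238, 153457, 31358, 161257, 144678, 121357, 122378, 140278, 74567, 161247, 141456],
  [52458, 142478, 101268, 140237, 82678, 120237, 140124, 72356, 120157, 2478, 91378, 122678, 120268, 140238, 120247, 122348],
  [142678, 120357, 33467, 14568, 120246, 120368, 120467, 64568, 121247, 2345, 120147, 32348, 120235, 120578, 133568, 31567],
  [63467, 151246, 140468, 164578, 121457, 172346, 140267, 163456, 120134, 120234, 140157, 110268, 120568, 120367, 194567, 92578],
  [163467, 162456, 120236, 14578, 54568, 123458, 163678, 162378, 82378, 140257, 64678, 120146, 162567, 140127, 140368, 141457],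
  [140568, 110148, 81478, 120156, 133468, 24578, 110137, 64578, 140248, 142467, 81678, 81578, 151346, 33456, 162347, 120168],
  [52367, 120248, 122368, 120468, 120267, 142568, 120457, 32567, 120378, 162457, 140247, 111247, 163457, 120345, 51246, 141467],
  [141256, 140357, 120256, 163567, 164678, 141567, 120458, 44678, 120257, 120123, 194678, 133578, 162678, 51347, 133457, 73568],
  [54567, 120456, 51357, 144578, 162478, 120358, 73468, 140147, 140456, 142567, 122568, 3457, 32357, 120348, 140457, 53578],
  [120136, 71236, 120346, 122478, 140246, 120167, 120125, 122467, 73456, 162467, 122468, 133458, 34567, 31367, 31457, 120178],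
  [122367, 120145, 120478, 140145, 43456, 141257, 120567, 140268, 142347, 120138, 120245, 121257, 140167, 122357, 140137, 120124],
  [140125, 142457, 140348, 32356, 120127, 122578, 141237, 140236, 120356, 141356, 71346, 194578, 143678, 63678, 53456, 142368],
  [133467, 142456, 140467, 141267, 43467, 120135, 62346, 164567, 120137, 33468, 120278, 120126, 142458, 22456, 120128, 140135],
  [51356, 140134, 142468]]

/-- Refutation for the colour sequence `AAABBBBAA`. -/
def certSteps3 : List (List ℕ × List ℕ × List ℕ) := [
  ([],[1148],[187]), ([],[1158],[188]), ([],[1258],[192]), ([],[8124,124],[214]),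
  ([],[1157],[216]), ([],[1247],[222]), ([],[1246],[228]), ([],[1147],[234]), ([],[1235],[236]),
  ([],[8468,468],[242]), ([],[1134],[248]), ([],[1234],[249]), ([268],[],[251]), ([168],[],[210]),
  ([267],[],[212]), ([],[3678],[219]), ([],[1367],[253]),
  ([1347,1567,4467,8346,8356,5567,8347,8456,4567,1237,8357,1167,1346,8457,1467,1267,8467,11467,11457,1136,8367,1137,11456,1236,1146],[],[256]),
  ([158],[],[185]), ([],[1578],[237]),
  ([4568,1238,1468,1267,1138,8367,4467,1236,8378,1136,11678,1168,1378,4468,1568,1368,4567,4578,8346,4478,8368,1567,1178,1268,4678,1137,8356,8357,1278,1678,8678,8347,1237,1478,8358,1167,8348,1467],[],[262]),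
  ([8348,8347,3478,8378,8238,10358,10368,3578,8358,4578,1137,1123,8257,4678,8248,10347,8278,10378,4478,10357,1378,1478,1127,10367,8247,10348,8267,8367,3378,1678,1278,8258,8357,8237,1237,8268,1138,8368,1178,1238,1128],[],[263]),
  ([],[8257,257],[265]), ([],[1146],[267]),
  ([10567,1567,8256,8567,8247,8267,1127,8236,1357,1125,1356,3356,1126,1467,8237,8235,1256,1156,3367,3456,1167,8257,1457,8245,1257,3357,3567,3457,1267,8246,1456,3467],[],[268]),
  ([],[8127],[269]), ([],[368,8368],[270]), ([],[568,8568],[272]), ([137],[],[278]),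
  ([138],[],[218]), ([238],[],[197]), ([237],[],[264]), ([],[8237],[211]), ([],[3378],[203]),
  ([],[10467,467],[281]), ([167],[],[282]), ([],[1678],[184]), ([],[8267],[246]),
  ([157],[],[283]), ([257],[],[195]), ([],[8157],[250]), ([258],[],[255]), ([],[8257],[1004]),
  ([],[8258],[191]), ([],[1347],[196]),
  ([3347,10457,10467,10357,11467,8247,1124,10347,8347,1137,8457,8367,1123,1127,8467,11457,8357,1237,10367,8234],[],[286]),
  ([],[1168],[287]), ([236,367],[],[288]), ([],[1248],[289]), ([],[3368,236],[290]),
  ([148],[],[273]), ([147],[],[274]), ([],[10568,568],[293]), ([],[1457],[294]),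
  ([567,256],[],[295]), ([],[1378],[296]),
  ([8457,1145,1127,8247,10567,1257,3457,3357,8567,1345,8467,1125,1245,8235,8234,10457,3347,8245,12567,3345,1357,1124,10467],[],[297]),
  ([],[8247,247],[298]), ([247],[],[299]), ([],[9247],[194]), ([248],[],[217]),
  ([],[8247],[1000]), ([],[8248],[280]),
  ([1145,8567,4457,1345,1135,8345,8467,8367,1257,11467,1237,11457,8347,8457,11567,8357,1137,12567,1357,1245],[],[300]),
  ([],[1345],[301]), ([],[9467,467],[303]), ([],[8357,357],[305]), ([],[1256],[306]),
  ([],[1467],[230]), ([],[1468],[291]),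
  ([8346,1357,8567,1156,1237,1257,1167,4457,1267,4456,8367,8345,1136,8347,1137,1567,4467,4567,8357,11567,1456,8356,1236,1356,1135],[],[307]),
  ([5578,5678,1368,1567,1478,1346,8456,1267,1178,5567,1348,8457,8468,8467,12678,1278,8678,1167,8478,1568,1268,8458,5568],[],[308]),
  ([],[9567,567],[309]), ([],[1458],[310]), ([],[1257],[312]), ([],[1123],[313]),
  ([3468,8678,1478,3478,1126,8278,10678,8268,1267,8236,1167,3467,1268,1127,8238,3567,1128,1278,1568,8246,3367,1368,3578,3368,3568,8256,1178,1567],[],[316]),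
  ([134,347],[],[317]), ([],[1568],[252]), ([],[8238],[221]), ([],[1368],[229]),
  ([],[1456],[321]), ([357,135],[],[322]),
  ([10458,1124,8458,3578,5578,8467,10457,8278,8478,1178,10478,1127,3478,1348,8468,3347,10468,5678,10467,8268,8234,1278,3348,8457,1128,1478],[],[324]),
  ([],[1358],[325]), ([],[8147],[327]), ([],[456,8456],[328]), ([],[10567,567],[329]),
  ([],[256,3568],[330]), ([357,235],[],[332]), ([],[1348],[333]), ([],[457,8457],[334]),
  ([],[1136],[336]), ([],[1236],[258]), ([],[8278],[204]), ([],[1346],[338]), ([],[3478],[339]),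
  ([],[246,8246],[340]), ([],[1167],[341]), ([],[1125],[342]), ([],[246,3467],[343]),
  ([],[1357],[225]), ([],[1238],[189]), ([],[1268],[220]),
  ([8236,1127,8256,3567,1126,8234,3467,3346,8456,5567,8457,10467,3347,8467,10457,1267,10456,1567,1124,3367,8246],[],[345]),
  ([],[246,3468],[346]), ([367,136],[],[349]), ([145,457],[],[350]), ([],[1178],[351]),
  ([],[236,3367],[352]), ([],[1145],[353]), ([],[1478],[354]), ([],[9257],[357]),
  ([],[1567],[358]), ([],[8268],[359]), ([],[10347,347],[360]), ([],[1138],[361]),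
  ([],[1245],[362]), ([],[2257,125],[363]), ([],[8167],[364]), ([],[3357,235],[365]),
  ([],[8137],[366]), ([],[1124],[367]), ([],[8125,125],[368]), ([],[457,10457],[369]),
  ([],[348,8348],[370]), ([],[1127],[372]), ([],[3578],[373]), ([],[9237],[374]),
  ([],[8236,236],[375]), ([],[1356],[376]), ([],[368,10368],[383]), ([],[467,8467],[386]),
  ([],[1237],[213]), ([],[1267],[292]), ([],[9267],[387]), ([],[1135],[389]),
  ([5567,1156,8567,12567,8467,8457,8456],[],[391]), ([],[1137],[392]), ([],[1278],[394]),
  ([],[1126],[395]), ([],[10458,458],[396]), ([],[1128],[398]), ([],[135,8135],[399]),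
  ([],[1156],[275]), ([],[8134,134],[401]), ([],[468,10468],[402]),
  ([678],[6678,13678],[39,14,64,43]), ([],[6678,13678],[1000,147,25,124,79]),
  ([3568,3567,8256,10678,8678],[236,246],[1019,1021,1022,1042,1016,1009,1031]),
  ([],[246,256,678],[1026,65,57,224,138,1000,128,45,140,1044,215,92,136,235,50,1025,1048,381,1,30,68,41,3,38,60,1011,177,89,183,49,1036,66,109,380,1052]),
  ([],[678,13678],[138,147,25,124,1042,1000,32,130,103,1055,266,179,205,22,1009,1029,201,112,31,178,1025,37,58,1035]),
  ([8347,8357,457],[357,367,13678],[1,21,1000,39,64,146,49,26,54,166,61,95,89,156,93,1018,161,109,133,60,1013,1050,1011,30,1053]),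
  ([],[235,245,13678],[8,135,11,1001,39,64,1045,1050,14,1030,0,91,127,1004,141,7,1017,154]),
  ([457],[13678],[1002,39,14,2,1000,1029,1040,54,5,3,1001]),
  ([],[467,13678],[1003,39,64,1000,277,231,98,1059,163,323,112,37,31,1029,1052,14,0,91,1006,1013,16,22,243]),
  ([678],[13678],[39,14,1001,1000,20]), ([],[13678],[1005,1000]),
  ([457],[357,578,567],[152,146,49,26,1043,54,166,5,61,95,89,156,93,3,1023,161,109,21,1,133,60,1018,1055,1016,30,1058]),
  ([457],[578,567],[2,8,135,11,1035,0,127,91,152,1055,1050,43,1000,1033,141,7,1022,154]),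
  ([467],[256,236,235,567],[17,1019,1026,1023,7,20,2,8,11,42,10,1031,1032,1036,0,57,65,1058]),
  ([357,457],[125,567],[1035,1024,7,1040,12,1015,202,2,1028,55,355,244,8,11,1037,1043,0,1025,1023,200]),
  ([368,357,467],[367,567],[20,1029,131,84,108,2,29,139,160,134,24,42,56,1041,1000,80,46,1036,12,40,55,10,96,107,140,150,17,48,76,1001,72,99,88,116,86,181,114,165]),
  ([357,467],[367,568,567],[43,40,170,20,1003,81,315,238,25,335,162,158,74,131,18,160,84,24,38,28,1000,326,153,177,261,60,30,190]),
  ([346,2256,2246,9256,9456,10456,2245,9245,3456,2456,9246],[136,236,235,135,146],[76,48,17,12,155,102,110,44,27,15,23,159]),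
  ([367,357,467],[567],[20,1032,1003,100,52,1044,80,46,1039,12,40,2,55,42,10,139,96,107,148,1058,1033,17,1004,48,76,77,72,99,88,168,181,114,87,116,86,1000,56,104,134,29,108,165,24]),
  ([357,467],[567],[20,1006,81,1000,1003,1002,319]),
  ([4456,8346,8345,11567,8367,4467,4457,8347,8567],[356,357],[1052,68,66,1051]),
  ([235,356,4456,10346,10345,3456,456],[245],[122,233,67,371,126,77,72,174,137,94]),
  ([467],[567],[1045,0,20,42,148,2,10,11,8,1002,26,1054,54,5,61,3,1034,226,28,38,21,1,18,29,34,56,41,24,1001,1000,7,1032,142]),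
  ([],[345,235,347,357,567],[1033,7,1035,3,5,18,1,21,1055,26,1046,0,34,180,28,11,8,29,142]),
  ([345,11467,8367,8467],[347,346,357],[38,3,41,1056,84,285,104,1044,35,1048,58,68,33,66,1073]),
  ([],[457,346,357,567],[1002,63,1029,5,1,6,1000,28,34,3,18,1057,16,0,1045,35,1059]),
  ([12678,12578,5568,5578,5567],[468,568,567],[43,1003,16,98,22,70]),
  ([4456],[346,357,567],[1004,5,6,18,1,1031,0,63,41,3,38,1002,34,28,1003,1006,50,144,106,1001,2,1014,36,29,25,78,75,47,51,13,19,1000,32,56,10,1005]),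
  ([457,346],[357,567],[1005,120,1015,54,61,36,344,25,78,75,1004,47,51,13,19,50,95,106,393,1001]),
  ([],[345,457,357,567],[35,1049,1006,5,6,18,1,1061,16,1033,0,34,331,28,3,1063]),
  ([234,10345,3456,10346,10356,10456,236,235,11456,4456],[],[137,126,174,94]),
  ([11457,10457,8457,11467,8367,10367,8357,10357],[347,234,467],[9,4,1035,1073,3,1043,1072]),
  ([347,11458,478,12578,5578,11468,5678,12568,4678,11568,4578,578,6678,345,11457,11467,11567,12567],[],[125,143,318,176,347,158,171,379]),
  ([234,456,356,345,346,4456],[],[122,97,102,167,53,103,71,82,119,77,72,1002]),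
  ([5578,10458,8458,5678,10468,8468],[478,234,457,467],[223,9,4,1042,1054,1038,1076,209,112,1059]),
  ([5578,11458,10458,8458,11468,5678,12568,10468,8468,4678,11568,4578,578,6678,347,345,11457],[234,457,367,567],[1012,6,18,16,1000,13,1002]),
  ([578,346],[358,568,234,357,567],[43,1013,26,1068,5,21,1,6,1007,1056,1044,35,1004,1006,93,49,153,118,30,1086,1035,98,22,132,111,31,1038,182,1000,37]),
  ([],[245,235,234,457,567],[15,1047,7,9,4,1045,1057,1014,16,1041,1079,1060,0,11,8,1073]),
  ([9234,8134,2347,3347,8234],[124,457,467],[1046,1058,271,1042,1071,1080,1089,232,206]),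
  ([358,345],[134,234,457,567],[1016,4,9,62,1039,27,1000,90,73,199,50,12,44,15,1001,119,169,164,52,46,149,123,83]),
  ([456,356,4456],[357,567],[1012,1011,1010,35,1048,1060,1017,5,6,1,21,1072,26,1006,1008,1067,1000,111,31,1042,227,37,1090,1039,22,1005,106,1003,279]),
  ([],[456,457,567],[1061,1018,16,1045,0,1065,58,1044]),
  ([4456],[357,567],[1014,1013,1012,1000,382,1001]), ([346],[357,567],[1000,85,1014,1013]),
  ([],[357,567],[1021,1048,5,1,6,1001,1000,63,24,1019]),
  ([],[346,567],[1000,40,170,1022,16,63,388,144,104,151,38,18,6,122,28,24,36,198,254]),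
  ([],[468,345,567],[1001,172,1033,25,75,19,13,1000,173,78,51,47,36,179,1019]),
  ([],[345,567],[1001,1002,1068,1073,12,172,193,180,1032,55,108,100,29,80,46,52,73,1000,129,32,155,97,27,44,15,83]),
  ([468],[256,567],[32,1003,1074,1000,69,1069,53,40,1002,118,175,1008,2,10,8,11,92,17,1054,1061,1066,1067,1058,7,1071,0,57,65,1093]),
  ([468],[567],[1004,1070,1001,53,15,1075,69,44,27,1003,12,40,1026,129,32,118,107,378,92,175,48,76,110,17,23,1009,2,1063,120,1034,10,55,100,96,52,1000,77,99,88,168,114,87,116,159]),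
  ([457,456],[567],[1000,260,1037,36,25,78,75,13,47,51,19,1023]),
  ([],[457,567],[1028,1001,22,1050,1101,1006,1072,1003,53,1077,69,1011,81,111,163,31,1053,37,1016]),
  ([],[567],[1029,1000,120,1001]), ([156],[],[239]), ([256],[],[1089]), ([],[9256],[304]),
  ([],[8256],[57]), ([],[3567],[65]),
  ([456],[],[348,320,103,36,105,1047,117,74,14,113,19,259,101,13,79,115,47,51,70]),
  ([],[8456],[1076]), ([],[9456],[207]), ([],[10456],[385]),
  ([345],[245],[397,1071,10,8,186,167,7,45,4,15,1058,17,23,257]),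
  ([],[345],[34,173,356,24,41,68,33,247]), ([],[245],[1000]), ([458],[],[208]), ([457],[],[2]),
  ([],[10345],[119]), ([],[8458],[31]), ([],[10458],[1055]), ([],[5568],[178]), ([],[5578],[37]),
  ([],[8457],[1073]), ([],[10457],[1061]), ([],[5567],[58]),
  ([],[135,467,235,234],[15,9,4,12,69,62,1053,27,44,1014,90,73,169,164,46,52,149,123,83]),
  ([246,3356,3456],[235,234],[45,23,15,130,390,71,85,1000,400,121,33,94]),
  ([3467,8246,3346,8236,3367],[467,234],[9,4,1097,1059,1072]),
  ([3356,3456],[235,234],[45,1069,1062,23,1001,1075,1074,1051,14,113,79,1000,105,117,74,19,13,101,115,70]),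
  ([467],[],[42,105,1052,14,113,117,74,79,19,13,101,115,70]), ([],[10467],[1099]),
  ([],[8467],[1061]), ([],[246,234],[9,4,1076,1075,128,1070,1063,23,1074]),
  ([136,235],[234],[67,33,1079,35,66,1090,26,50,182,183,49,1000,32,1108,1057,22,1023,311,19,59,150,1073,132,21,1,6,30,1026,143,125,384,162,171,176,276,314]),
  ([9236,9356,11456,10356,3346],[134,136,234],[1001,59,71,9,4,62,1059,27,1020,90,73,145,302,87,86,241,284,110,245]),
  ([235],[236,234],[23,1002,59,67,121,33,377,1001,48,1000,157]),
  ([],[236,234],[1003,82,1000,1004,17]),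
  ([],[234],[4,9,1004,59,1000,45,1003,337,157,145,62,1062,27,1023]), ([347],[],[136]),
  ([],[235],[53]), ([367],[],[240]), ([357],[],[151]), ([356],[],[67]), ([],[8367],[1]),
  ([],[11467],[6]), ([],[10356],[121]), ([],[11456],[33]), ([],[346],[1037]), ([],[246],[97]),
  ([],[4456],[85]), ([],[236],[102]), ([],[10346],[71]), ([],[3456],[82]), ([],[],[1031])]

theorem certCheck3 : checkCert 9 [true, true, true, false, false, false, false, true, true]
    certTable3 certSteps3 = true := by
  decide +kernel

/-- Clauses used for the colour sequence `AABAABBBA`. -/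
def certTable4 : List (List ℕ) := [

  [143456, 140356, 34678, 123568, 155678, 55678, 133456, 132456, 32346, 52346, 132356, 53578, 33568, 133457, 153567, 140457],
  [144567, 51256, 33567, 144578, 140456, 152567, 132457, 44567, 140568, 124578, 51568, 152346, 132357, 154567, 143457, 121245],
  [135678, 153467, 75678, 132346, 132345, 73567, 140156, 124568, 185678, 73467, 141456, 140126, 164678, 132468, 121368, 132368],
  [163468, 52347, 45678, 141356, 121256, 24567, 132458, 121468, 123468, 132568, 132367, 141678, 124567, 140345, 33457, 132678],
  [164567, 121568, 53456, 33456, 4567, 132358, 145678, 52345, 183456, 152568, 153456, 194567, 133467, 132567, 132467, 143467],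
  [65678, 121236, 132378, 71256, 151345, 132578, 32347, 152347, 23467, 152367, 121246, 152345, 121356, 53457, 153457, 152357],
  [123567, 132478, 140234, 120236, 63468, 120267, 140367, 12378, 120156, 140125, 120135, 140145, 61457, 110468, 140168, 142456],
  [151237, 121248, 131456, 152578, 52568, 120367, 120245, 120567, 120148, 51278, 13467, 151357, 131357, 32568, 140468, 151245],
  [34568, 110123, 52457, 120258, 151247, 120678, 152678, 120457, 71357, 141234, 142578, 140378, 120347, 61368, 120346, 120123],
  [61458, 22478, 125678, 21345, 140458, 61478, 140146, 21456, 32357, 163458, 21356, 123578, 121345, 32457, 121348, 141478],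
  [140158, 72567, 120136, 131457, 121237, 140138, 120278, 121257, 141468, 140178, 140124, 141345, 164578, 140368, 173456, 54578],
  [143568, 110458, 161345, 140348, 123458, 110378, 120456, 120157, 140357, 31357, 140358, 140478, 161234, 140578, 120468, 33467],
  [140135, 120256, 140123, 134567, 120147, 120578, 62358, 143567, 53678, 151346, 152356, 52567, 141458, 120145, 161468, 143678],
  [120357, 151257, 140136, 63467, 120235, 110358, 143458, 120348, 120234, 32345, 12478, 53467, 120138, 120168, 41457, 23456],
  [113478, 120238, 35678, 13456, 12345, 72467, 120467, 132347, 133567, 140148, 140347, 120246, 142356, 120178, 1234, 172357],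
  [120158, 183457, 120247, 151235, 142678, 31367, 120146, 52456, 91238, 164568, 120248, 140134, 120478, 120257, 120368, 120124],
  [144678, 51357, 1235, 62458, 152467, 123678, 121346, 52678, 140346, 163478, 120237, 140467, 52357, 143578, 151267, 152457],
  [120137, 144568, 124678, 120568, 151367, 151567, 143478, 120458, 121268, 143468, 120356, 41345, 32578, 152456, 121234, 121235],
  [120358, 120134, 32678, 120167, 140567, 1567, 123478, 140678, 32567, 120345, 140128, 120378, 120268, 151347]]

/-- Refutation for the colour sequence `AABAABBBA`. -/
def certSteps4 : List (List ℕ × List ℕ × List ℕ) := [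
  ([],[234,9234],[137]), ([135],[345],[147]), ([],[8146,146],[150]), ([],[135,2345],[156]),
  ([],[1135],[106]), ([],[2348],[158]), ([],[1136],[162]), ([],[1123],[143]), ([],[8138],[165]),
  ([8145,1345,1145,8345,9345,1245,1134,8135,8123,2345,2234,8125,2245,8124,1235,2235,1234,8134],[],[178]),
  ([],[1456],[182]), ([],[1157],[183]), ([378],[],[181]), ([],[8378],[139]),
  ([9234,8124,1234,1124,1134,2234,8234,8123,8134],[],[188]), ([],[8348],[179]),
  ([],[578,8578],[189]), ([],[1468],[190]), ([],[1256],[193]), ([367,678],[],[200]),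
  ([],[1145],[205]),
  ([1168,1268,8468,8178,2468,1368,8156,8134,12678,9468,8478,1568,2568,1346,8148,8146,8128,1248,9478,8168,8126,9456,8124,8136,8458,9678,8158,1246,8456,5568,9458,2248,1146,2368,1348,2268,8678,2346,1148,2246],[],[206]),
  ([],[11678,678],[207]), ([],[1357],[208]), ([],[136,8136],[210]), ([],[1148],[120]),
  ([],[1235],[212]), ([],[1348],[215]), ([],[1138],[220]), ([],[1168],[221]), ([478],[],[224]),
  ([],[8478],[187]), ([468],[],[109]), ([],[8468],[126]), ([],[1678],[133]), ([368],[],[100]),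
  ([168],[],[141]), ([],[8368],[173]), ([],[8168],[110]), ([],[9468],[168]), ([],[1267],[101]),
  ([],[1467],[230]), ([178],[],[149]), ([],[9478],[159]), ([],[8178],[169]), ([],[8148],[233]),
  ([],[1246],[235]), ([],[1178],[237]), ([124],[123],[238]), ([],[1158],[240]), ([458],[],[177]),
  ([],[1578],[197]), ([358],[],[213]), ([158],[],[144]), ([],[11458],[214]), ([],[8458],[148]),
  ([],[8358],[186]), ([],[8158],[160]), ([],[9458],[204]), ([],[1247],[242]), ([],[1457],[135]),
  ([],[1146],[246]),
  ([13678,1248,8456,1268,8568,12578,1356,1358,12678,1245,1156,1345,5568,8678,1258,1458,1346,8578,12568,1368,1568],[],[249]),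
  ([],[8134],[251]), ([],[1478],[252]), ([],[1257],[253]), ([],[1368],[254]), ([],[1124],[255]),
  ([],[678,12678],[256]), ([258],[248],[259]), ([],[367,4678],[261]), ([],[2346,136],[262]),
  ([],[8346,346],[264]),
  ([11468,4578,1378,1134,8347,8457,5578,4678,11478,1137,11457,8467,1234,1347,11467,1278,1237,8367,4478,8357,5678,1238,1248,1147],[],[265]),
  ([],[1237],[266]), ([],[1156],[104]), ([],[1567],[119]), ([],[467,8467],[267]),
  ([],[11578,578],[269]), ([],[1137],[272]), ([],[568,12568],[273]), ([],[467,5678],[274]),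
  ([123],[],[129]), ([],[1236],[99]), ([],[8123],[194]), ([124],[],[1011]), ([128],[],[248]),
  ([],[1245],[118]), ([],[1234],[216]), ([],[1248],[250]), ([],[1258],[131]), ([],[1278],[166]),
  ([],[1238],[225]), ([],[8124],[170]), ([],[2248],[113]), ([],[1568],[275]), ([],[11478],[278]),
  ([],[1458],[279]), ([],[126,2268],[280]), ([],[11468],[281]), ([],[1367],[117]),
  ([],[1356],[282]), ([],[1147],[196]), ([145],[345],[283]), ([],[2234],[286]),
  ([],[2235,125],[287]), ([],[1358],[288]), ([],[1134],[289]), ([],[1167],[291]),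
  ([],[567,8567],[292]), ([],[1347],[140]), ([],[1346],[142]), ([],[347,4478],[294]),
  ([],[8678,678],[295]), ([],[1345],[297]), ([],[8128],[298]), ([],[1378],[299]),
  ([],[1268],[300]), ([678],[6678,13678],[4,5,34,146]), ([],[6678,13678],[1000,70,50,80,32]),
  ([346,345,347,11467,11567,12567,5567,11456,4567,11457],[],[13,6,76,75]),
  ([11456,8456,5568,8356,4568,8678,12678,11678],[346],[56,1014,48]),
  ([467,345,346,5567,11456,4567,11457,567],[],[6,29,219,122,76,13,14,33,75]),
  ([],[678,13678],[1024,1020,1005,70,11,50,80,175,18,128,25,30,15,3,1,96,39,20,0,60,1001,223,1000,1014,1011,44]),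
  ([5567],[456,13678],[1000,2,1015,4,5,16,1008,20,68,64,15]),
  ([],[345,13678],[1001,4,34,1014,24,176,1015,19,1029,61,180,153]),
  ([],[457,13678],[1002,4,34,1015,24,2,1014,1017,5,16,1010,19,1030,1006,25,15,172]),
  ([5567],[13678],[1001,1000,93,94,62,1003,2,1030,79,4,5,199,16,1002,66,67,74,1006,232]),
  ([678],[13678],[4,5,1001,1000,53,195]), ([],[13678],[1005,1000]), ([248],[3478],[97,145]),
  ([234,3457,10345,10347,3357,235,237,10457,10357,10467,10367,10567,4457,11467,11567,11457,12567],[],[231,36,241]),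
  ([],[234],[98,1041,1036]),
  ([345,456],[],[66,67,74,6,71,8,228,35,36,9,91,7,10,247,27,285,202,72]),
  ([4478,8347,11457,8357,4578,8457,5578],[367,467],[1020,1023,102,1027,79,1024]),
  ([],[345],[1042,61,1019,171,1040,192,258,107,105,31,1018,1039]), ([],[245],[71]),
  ([],[235],[217]), ([456],[],[1001]), ([],[10345],[91]), ([],[3345],[36]), ([],[5568],[39]),
  ([],[8456],[20]),
  ([457],[],[53,68,93,62,130,157,37,29,152,94,13,95,161,271,87,22,14,33,28,89,21,260,1002]),
  ([],[5578],[25]), ([],[8457],[15]), ([],[5567],[60]),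
  ([],[568,578,678],[19,1037,1015,1030,24,1022,1031]),
  ([146,2346,2356,2345,2256,2246,2236,2235,2245,346,9456,9356,11456],[],[6,151,201,84,114,174]),
  ([256,357,367],[157,678],[11,1001,26,17,83,52,1022,90,81,43,1020,31,1036,1032,12,1,3,1017,0,1013,42,51,65,38,59,136,257,245,1042,46,1035,92,1029,1000,1043,55,1037]),
  ([256,568],[135,678],[26,17,83,52,1023,90,81,43,1021,31,1037,1033,12,1,3,1018,0,1014,42,51,65,38,59,1043,154,46,1036,92,1030,1001,1044,55,1038]),
  ([9237,2357,9235,9567,9267,9367,9345,9245,2457,9347,9247,9257,9357,10357,10567,10367,3357,3457,10347,11567,4457],[127,125],[1022,164,167,239]),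
  ([256,6678,357,347,467],[],[2,1039,1035,11,1004,12,1,3,1020,0,1016,9,7,49,78,86,8,58,10,26,268,95,23,229,21,41,89,28,22,87,14,13,125,116,77,17,198,1034,57,85,63,73,82,69,47,1008,54,45,1002,108,222,293,123,209,132,301,163,127,84,276,270,277,1001,243,185,124,112,1000,121,244,138,40]),
  ([3456,10346,3346,3356,4456],[256,356],[0,111,236,72]),
  ([357,347,467],[],[2,1022,1037,1041,23,11,1006,12,3,1,0,1018,6,8,9,10,35,27,7,1000,32,1001]),
  ([347,467],[],[2,1023,1038,1042,23,29,41,14,33,1000,18,3,1,96,0,1019,30,1020]),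
  ([467],[],[2,1043,1039,1024,1000,191,56,227,1035,3,1,0,48]), ([],[8467],[1033]),
  ([],[5678],[1030]), ([],[347,357],[30,184,155,211,234,1025,1009]),
  ([678,567,256,347],[],[203,21,296,77,88,9,7,49,78,86,8,58,10,28,22,5,226,263,290,284,32,103,115,134,218,63,73,57,85,82,69,47,1013,54,45,40]),
  ([],[678],[1041,1026,44]), ([367],[],[1047]), ([],[567],[1028,16,64]),
  ([],[357],[1001,88,6,8,9,10,35,27,7,18,1000,1004]), ([],[],[37])]

theorem certCheck4 : checkCert 9 [true, true, false, true, true, false, false, false, true]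
    certTable4 certSteps4 = true := by
  decide +kernel

/-- Clauses used for the colour sequence `AABABBBAA`. -/
def certTable5 : List (List ℕ) := [

  [53457, 140345, 140567, 33467, 140456, 123456, 65678, 132345, 24567, 144567, 123457, 123567, 124567, 154678, 143467, 123467],
  [154578, 145678, 183456, 143456, 132356, 33568, 132346, 55678, 34578, 125678, 153456, 31457, 123568, 123468, 45678, 140457],
  [124678, 141345, 152345, 54678, 134567, 52345, 205678, 152456, 142345, 134578, 135678, 124578, 134568, 34567, 152356, 154567],
  [32356, 152346, 163678, 31468, 163456, 34678, 140478, 52458, 142346, 164567, 134678, 140458, 140135, 143568, 124568, 32346],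
  [74567, 154568, 132456, 54578, 121245, 155678, 52346, 22345, 31245, 122456, 75678, 35678, 133456, 131345, 32345, 120458],
  [120678, 121256, 121456, 110158, 12345, 83578, 131346, 144678, 121347, 1345, 140124, 110157, 120146, 120348, 73456, 110167],
  [120138, 163567, 140367, 120238, 120167, 21235, 1246, 140147, 140468, 142456, 14678, 140245, 22568, 51257, 110358, 140137],
  [163457, 72356, 120258, 163467, 120134, 151345, 120234, 81478, 51345, 143678, 121257, 110127, 42358, 140123, 120178, 141367],
  [121237, 141346, 110123, 141457, 123678, 120378, 121457, 141245, 120236, 121246, 62568, 143578, 161235, 140568, 111367, 140348],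
  [143468, 120156, 110168, 143458, 140125, 172345, 140157, 101348, 120278, 120136, 151235, 51356, 63456, 110347, 53567, 161347],
  [120368, 141347, 54568, 33456, 120245, 120468, 120478, 120137, 140358, 121235, 142356, 151356, 140578, 140467, 140167, 61235],
  [140356, 123578, 141467, 121234, 3456, 140678, 163578, 3478, 120358, 140235, 74568, 131356, 120457, 120456, 140378, 151245],
  [140357, 31356, 111368, 53468, 52356, 120158, 14567, 120567, 140346, 31345, 120256, 120248, 41234, 23456, 120568, 140127],
  [121236, 140134, 141357, 120346, 120267, 120123, 120168, 44578, 120356, 140145, 21234, 120157, 140368, 120135, 151234, 123458],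
  [120148, 164678, 22456, 120147, 141567, 32567, 74678, 123478, 120347, 44678, 120268, 120367, 120467, 143478, 53458, 120257],
  [120578, 143457, 51258, 120357, 121247, 120237, 120145, 141235, 120345, 173456, 144568, 121357, 140347, 151456, 52468, 64567],
  [161357, 120235, 163478, 120247, 143567, 120125, 120246, 51246]]

/-- Refutation for the colour sequence `AABABBBAA`. -/
def certSteps5 : List (List ℕ × List ℕ × List ℕ) := [
  ([],[8147,147],[103]), ([],[468,8468],[104]), ([],[1258],[114]), ([],[1678],[80]),
  ([167],[],[95]), ([],[11678,678],[121]), ([],[367,9367],[127]), ([],[578,11578],[139]),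
  ([],[568,8568],[141]), ([367],[],[142]), ([],[8367],[98]), ([],[9367],[1002]), ([],[1238],[99]),
  ([123],[],[130]), ([],[8123],[125]), ([127],[],[123]), ([],[2237],[128]), ([],[1156],[145]),
  ([168],[],[146]), ([],[125,8125],[148]), ([],[1278],[152]), ([],[1458],[79]), ([347],[],[157]),
  ([567,356],[],[158]),
  ([11467,8347,1347,1234,8124,1247,1147,8137,8167,8147,8134,1137,11457,8157,2234,1134,8457,2347,8467,9347,9357,8357,1237,9457,9467,8127,2247],[],[159]),
  ([],[9347,147],[161]), ([],[1245],[164]), ([],[1468],[165]), ([],[1478],[166]),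
  ([],[125,2235],[169]), ([],[8578,578],[172]), ([],[8467,467],[173]), ([158],[],[83]),
  ([358],[],[110]), ([],[8358],[168]), ([357],[],[85]), ([157],[],[91]), ([],[8157],[150]),
  ([],[8167],[174]), ([],[8356,356],[176]), ([],[1138],[96]), ([],[4578],[177]),
  ([],[467,9467],[178]), ([],[124,2234],[179]), ([],[8678,678],[181]),
  ([8347,8345,11578,1357,6678,11567,8578,8357,1178,4678,8378,1257,1237,8568,1135,4457,1358,1457,1157,4458,1158,8567,1378,8348,1137,4478,1235,8368,11568,1578],[],[182]),
  ([348],[],[183]), ([],[8348],[143]), ([148],[],[151]), ([147],[],[119]), ([],[8147],[1017]),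
  ([],[9347],[1008]), ([],[1457],[188]), ([],[1456],[189]), ([],[1136],[153]), ([],[8378],[190]),
  ([],[8357],[192]), ([],[1236],[136]), ([368],[],[194]), ([],[4678],[132]), ([346,468],[],[195]),
  ([],[1158],[197]), ([],[1567],[199]), ([],[346,8346],[200]), ([],[1256],[202]),
  ([],[1248],[203]), ([134],[234],[204]), ([],[1568],[206]), ([],[8127],[207]),
  ([],[2236,126],[208]), ([],[9357],[210]), ([],[1346],[211]), ([],[1267],[212]),
  ([],[1123],[213]), ([],[1168],[214]), ([],[1356],[216]), ([],[8145,145],[217]),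
  ([124],[234],[218]), ([],[1134],[116]), ([],[1146],[92]), ([],[1157],[219]), ([],[8368],[220]),
  ([],[1135],[221]), ([],[4458,345],[223]), ([],[1148],[224]), ([],[1234],[118]),
  ([],[1167],[100]), ([],[1178],[126]), ([],[1137],[167]),
  ([1348,1347,1268,5678,1247,8456,1147,8478,12678,8467,1367,8468,1578,1368,8458,5568,1467,8457,1246,5567,5578,8678,1378],[],[225]),
  ([],[1147],[227]), ([],[567,9567],[228]), ([],[4478],[231]), ([],[1347],[232]),
  ([],[1348],[93]), ([],[1368],[160]), ([],[1358],[184]), ([],[1268],[234]), ([],[1367],[235]),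
  ([],[1467],[236]), ([],[478,11478],[237]), ([458,345],[],[238]), ([],[1257],[239]),
  ([],[1578],[240]), ([],[11457,457],[241]), ([258,125],[],[242]), ([],[1357],[243]),
  ([],[2247,124],[244]), ([],[1237],[245]), ([],[1145],[246]), ([],[1345],[248]),
  ([],[2357,135],[251]), ([],[8347],[252]),
  ([9567,8137,8135,8145,8345,8567,4457,2357,9345,2235,1235,8125,11567,2257,2457],[],[256]),
  ([],[1235],[257]),
  ([11458,11478,11457,1247,8468,1378,5578,8458,5678,8478,8467,8457,11467,11468],[],[258]),
  ([],[1247],[259]), ([],[567,11567],[260]), ([],[8137],[111]), ([],[1378],[133]),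
  ([],[1125],[261]), ([],[1246],[262]), ([],[678,6678,13678],[17,6,30,42]),
  ([],[6678,13678],[1000,69,23,74,25]),
  ([11568,8568,11567,8567,8578,11578,6678],[345],[10,1,1013,1020]),
  ([8458,11458,5578,11457,8457,678],[478],[54,35,230,1011,14,1026,1037,144,32,1004]),
  ([678],[13678],[1002,69,1035,1028,23,74,2,1004,1034,61,1001,0,1011,31,1010,43,147,59,1000,215]),
  ([],[346,13678],[1000,17,6,21,1027,11,28,1024,1038,15,29,1021,50]),
  ([],[457,13678],[1001,17,6,1000,1023,186,59,3,233,54,87,32,1040,1029,30,1025,31,45,4,12,43,62,1016]),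
  ([],[678,13678],[17,30,1001,3,1000,64]), ([],[13678],[1003,1000]),
  ([8346,4468,4467,8356,4567,4568],[678],[1041,1027,50]),
  ([4456,8346,8345],[456,356],[1031,4,19,52]),
  ([567,457],[],[0,1,1038,64,28,11,1032,180,47,15,29,1026,5,1001,23,75,35,53,24,42,13,16,58,65,41,1000,44,36,38]),
  ([256,3356,3345,3346,3456,10346,10345,356,4456,456],[],[26,46,39,18]),
  ([10456,10356,3356,3345,3346,458,468,11456],[258,568,346,345],[5,138,55,254,40,56,73,18]),
  ([457],[578,568],[1002,25,61,1043,1013,2,0,1024,1,10,1044,1037,1031]),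
  ([12567,12678,5568,5578,12578,6678,5567],[468,467,568],[32,250,38]),
  ([457],[235,245],[0,40,27,135,107,1,33,1028,101,175,185,247,1044,1040,60,140]),
  ([468,356,457],[258,346],[21,1002,24,1005,8,26,0,55,1000,71,48,196,7,46,39,20,22,1003]),
  ([10345,3345,3346,3356,256,356,4456,456],[246,245,346],[56,73,1005]),
  ([457],[135,125],[1043,1047,122,1007,1018,1027,2,0,1,10,27,33,1031,134,60,1021,1020]),
  ([124,468,356,457],[346],[1002,124,0,71,7,48,22,20,1024,21,108,51,5,1008,8,72,263,40,1001]),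
  ([468,356,457],[346],[1009,8,26,0,5,27,33,51,82,129,1003,1025,1045,1001,89,77,155,193,187,86,171,253,1000,1040,102,1034,68,137,81,249]),
  ([356,457],[346],[1010,8,36,21,25,1007,24,67,16,41,44,1000,6,13,106,1006,9]),
  ([457],[346],[1011,1022,2,0,1,10,15,1038,5,1000,11,1044,97]),
  ([457],[567],[8,36,1000,3,1040,9,162,25,1009,6,24,67,16,41,44,13,1008]), ([457],[],[1013,1000]),
  ([],[9457],[131]), ([],[8457],[31]), ([],[11457],[1030]),
  ([2234],[134,124,467],[1028,90,1045,1047,14,88,209,1051]),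
  ([2234,345],[124,125,467],[1050,68,1000,1040,222,201,120,37,78,7,77,154,117,191,34,149]),
  ([124,345],[125],[1038,72,37]), ([345],[125,467],[1000,1047,1001]),
  ([234,10346,10456,10356,3456,10345,236,235,4456,11456],[],[20,22,7,18]),
  ([],[234,467],[1044,1041,1049,1004]), ([],[345,567,467],[9,1030,2,1053,14,10,1,112]),
  ([456,346],[],[3,1001,70,49,63,22,45,94,26,113,46,39,1000,37,78,66,20,7,34,76,18]),
  ([346],[567],[1000,12,4,3,1055,2,9,57]),
  ([346],[],[3,1003,63,70,49,1001,226,205,84,34,66,76,1005,109,1000,1061,229,19,170,105,1004]),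
  ([],[4467],[15]), ([],[4468],[29]), ([],[8346],[1049]),
  ([567],[467],[1056,14,1061,45,11,1055,19,4,12,115]),
  ([],[467],[1057,1000,2,9,1003,163,4,12,57]), ([456],[],[198]), ([],[567],[255]),
  ([],[8456],[4]), ([],[5567],[12]), ([356],[],[156]), ([],[12567],[47]), ([],[4568],[28]),
  ([],[4567],[11]), ([],[8356],[1056]), ([],[11456],[19]), ([],[678],[1025]), ([],[578],[23]),
  ([],[568],[75]), ([],[478],[35]), ([],[468],[53]), ([],[6678],[42]), ([],[12678],[13]),
  ([],[12578],[16]), ([],[5678],[58]), ([],[12568],[65]), ([],[458],[43,62,38]),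
  ([345],[],[1041]), ([],[8345],[1]), ([],[4456],[5]), ([],[],[52])]

theorem certCheck5 : checkCert 9 [true, true, false, true, false, false, false, true, true]
    certTable5 certSteps5 = true := by
  decide +kernel

/-- Clauses used for the colour sequence `AABBBAABA`. -/
def certTable6 : List (List ℕ) := [

  [140345, 153456, 123456, 133567, 153457, 153567, 154567, 134567, 153467, 63456, 144678, 33567, 121235, 53567, 194567, 152456],
  [132346, 142345, 64578, 143578, 140368, 32356, 142346, 152467, 140346, 172347, 152356, 143678, 44678, 140358, 134568, 34567],
  [123458, 44578, 132345, 133467, 122456, 140235, 144578, 132347, 51347, 52356, 133456, 123468, 31234, 183456, 13457, 121234],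
  [132356, 140378, 133457, 54567, 31347, 140468, 140168, 124568, 1256, 140135, 120246, 120235, 140158, 120125, 143468, 32468],
  [120135, 140178, 120134, 143478, 120148, 120367, 140128, 120478, 43678, 64568, 120678, 152458, 161235, 140138, 32347, 141348],
  [42345, 32456, 134578, 120124, 110178, 52468, 142478, 120458, 120248, 121247, 51234, 120145, 120245, 121258, 123467, 131237],
  [120178, 120578, 13456, 51478, 140123, 141235, 120568, 165678, 11237, 140134, 72357, 151247, 120168, 33456, 141568, 184678],
  [132678, 121458, 140125, 72458, 134678, 151257, 73478, 140578, 110578, 132467, 31348, 121358, 132568, 2345, 131234, 161358],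
  [81368, 63578, 110148, 120468, 120256, 140678, 140234, 132478, 140458, 143568, 161345, 31278, 120258, 71234, 151267, 43458],
  [162345, 71457, 132368, 151347, 120368, 121245, 1467, 81356, 142678, 31246, 120456, 153458, 120257, 62348, 120236, 120348],
  [91258, 152468, 63478, 120467, 120157, 51245, 33458, 140356, 121345, 151234, 110138, 125678, 120136, 131347, 141358, 152367],
  [13467, 140148, 123457, 140478, 132367, 120138, 110146, 110125, 131247, 140124, 31346, 120358, 120567, 120123, 151457, 120238],
  [132378, 151467, 120167, 72456, 120146, 53478, 110678, 140348, 120234, 120356, 52347, 140568, 151357, 145678, 132567, 144568],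
  [140567, 120158, 152457, 132348, 44568, 121238, 13568, 120457, 24568, 120345, 151237, 141378, 140145, 33468, 121237, 43578],
  [151367, 140456, 120278, 120268, 140245, 163568, 164568, 132468, 23568, 133568, 81456, 194568, 72367, 120346, 141578, 63468],
  [120357, 141245, 120156, 141368, 120267, 53456, 122345, 12346, 152357, 123568, 43568, 120378, 132578, 152347, 64678, 141345]]

/-- Refutation for the colour sequence `AABBBAABA`. -/
def certSteps6 : List (List ℕ × List ℕ × List ℕ) := [
  ([],[1125],[61]), ([],[1135],[64]), ([],[1124],[83]), ([],[1145],[91]), ([],[1178],[96]),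
  ([],[1578],[97]), ([],[123,8123],[100]), ([],[134,8134],[105]), ([],[9568],[110]),
  ([],[8168],[54]), ([],[1678],[74]),
  ([8158,2358,2235,8345,2238,11568,4458,1458,8138,8578,8128,8148,8135,2258,8568,1358,2458,8348,8358,8123,1235,1238,9345,11578,1138,8145,9378,1158,9358,8378,8368,9578,8178,8125,9348,1258,9368],[],[127]),
  ([],[8234,234],[134]), ([],[11568,368],[137]),
  ([1235,2234,8134,2235,2245,1245,8145,2345,9345,8345,1234,1345,8123,8125,1134,8124,8135],[],[138]),
  ([],[8158],[60]), ([],[1568],[102]),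
  ([1235,8234,10345,8245,8345,8235,1345,1234,1134,1123,3345,1245],[],[144]), ([],[1368],[148]),
  ([],[1236],[158]), ([],[1348],[159]), ([],[1248],[88]), ([],[1235],[59]), ([],[1245],[92]),
  ([],[1258],[140]), ([],[1246],[58]), ([],[1256],[132]), ([],[1467],[163]), ([],[1157],[164]),
  ([],[1134],[66]), ([],[356,8356],[167]), ([138],[],[170]), ([136],[],[128]), ([],[8138],[77]),
  ([135],[],[151]), ([],[8135],[57]), ([],[2358],[123]), ([],[567,6678],[171]), ([],[1136],[172]),
  ([],[1257],[156]), ([],[9358,358],[174]), ([],[1138],[181]), ([125],[],[183]), ([126],[],[56]),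
  ([],[8125],[114]), ([128],[],[160]), ([],[8128],[70]), ([],[2258],[93]), ([148],[],[130]),
  ([],[1478],[71]), ([],[1468],[131]), ([146],[],[182]), ([],[8148],[177]), ([],[1458],[87]),
  ([],[1456],[154]), ([],[8124,124],[185]), ([346,134],[],[186]), ([],[1358],[187]),
  ([],[1567],[188]), ([],[1123],[189]), ([],[1367],[69]), ([],[1238],[191]), ([],[1167],[194]),
  ([],[1146],[196]), ([],[8348,348],[199]), ([],[1234],[200]), ([],[1356],[201]),
  ([],[8568],[203]), ([],[468,12568],[207]), ([],[8567,567],[208]), ([],[1158],[209]),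
  ([468],[456],[212]), ([],[123,2238],[213]), ([],[1457],[215]), ([458],[456],[216]),
  ([],[1345],[217]), ([],[145,8145],[220]), ([],[8456,456],[225]), ([],[1278],[226]),
  ([],[1268],[227]), ([],[245,8245],[228]),
  ([8678,11568,8346,8378,13678,4568,1156,1168,8356,8358,8368,4458,11678,11578,4456,4468,8578,8348,8345],[],[229]),
  ([8468,8456,1156,8458,12678,1346,1168,8678,1148,12578,12568,13678,8578,8478,5568],[],[230]),
  ([358],[356],[232]), ([145],[],[234]), ([],[2458],[113]), ([],[8145],[1005]), ([],[1346],[237]),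
  ([],[1357],[240]), ([],[245,9245],[241]), ([],[1156],[242]), ([],[9368,368],[243]),
  ([],[1267],[244]), ([],[1148],[68]), ([],[1168],[108]), ([178],[],[84]), ([578],[],[120]),
  ([678],[],[198]), ([],[8178],[65]), ([],[9578],[238]), ([],[8578],[119]), ([],[8678],[133]),
  ([],[13678],[205]), ([368],[356],[250]), ([],[1378],[251]), ([478],[468],[254]),
  ([],[9345,345],[255]), ([11456,4567,11457,11467,11567,5567,12567],[346,345,347],[178,94,2,14]),
  ([11456,4567,11457,11467,11567,357,367,5567,12567],[347],[46,1000,176]),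
  ([],[234,345],[0,80,125,1027,1010,17,37,246,1024]),
  ([],[345,134],[168,1030,0,1003,1000,90,141,1031,12,47,149,1021,1026]),
  ([378,478,567],[],[33,18,1015,7,28,6,99,72,129,223,5,8,1009,4,3,1,1002,40,1000,109,50,42,35,14]),
  ([4468,8346,4458,8345,4456,8348,11578,8378,11678],[356],[1026,1010,1007,29,249,20,1029,1012]),
  ([478,567],[],[18,28,33,1007,1017,6,7,1001,27,49,19,118,197,1022,166,221,2,0,32,24,43,1000,13,11,1,5,8,4,3,1004]),
  ([123,2234,10367,10467,10357,10457,9267,9467,9367,9257,9357,9457,10347,9247,9237,3347,2347,9347,137,11457,11467,9234,234],[],[104,44,95,184,25]),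
  ([2235,9368,11568,8368,9358,8358,11578,9378,8378,4458,8348,9348,9345,8345],[123],[1036,1020,1034]),
  ([123,10367,10467,10357,10457,9267,9467,9367,9257,9357,9457,10347,9247,9237,3347,2347,9347,137,11457,11467,9234,234],[],[44,1001,126]),
  ([356,11578,9378,8378,4458,8348,9348,9345,8345],[358,123],[12,29,1029,214,20,1034,1013,1001]),
  ([10345,9245,8245,2235,8123,9345,8345],[235],[101,37,76]),
  ([124,2235,8123,356],[345],[1008,1029,9,1,2,1009,1012,0,153,165,22,36,1020,1016,17,1000,21,41,48,34,16,15,26,45]),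
  ([10468,3678,3478,3467,3468,10458,3568,3578,3378,3348,10456,3567,3367,3368,3346,5568,5578,5678,10467,10457,3347,5567],[278,478],[10,152,86,111]),
  ([10367,10467,10357,10457,9267,9467,9367,9257,9357,9457,10347,9247,9237,3347,2347,9347,11457,11467,9234],[127,124,123],[47,222,89,25]),
  ([246,5578,5678,468,10467,10457,267,257,247,237,5567,456,234],[278,348,478],[73,30,39,63,195,247,85,231,121,157,115,135,206,15,16,146,180,112,161,211,192,252,124,75,1001]),
  ([2235,8123,356],[246,345],[1012,1033,9,1,2,1013,1016,0,81,22,36,1024,1020,17,1004,21,41,48,34,16,15,26,45]),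
  ([468,5578,246,10457,267,257,247,237,5567,467,456,234],[278,348,478],[23,116,1001]),
  ([567],[345],[1011,10,38,0,1018,1015,1014,169,122,1035,79,1034,162,32,24,43,2,27,49,219,19,67,1012,9,13,11,1,51,31,5,8,4,3,6,7,1016,40,52,147,78,202,145,150,173,106,39,218,236,107,253,190,204,117,224,193,142,210,248,23,175,1008,1046,12,1007,233,1005,1003,139,1001,143,155,82,30,1000,1033,239,62,1042,235]),
  ([456,356,567],[],[1000,11,46,50,98,42,35,3,13,5,51,31,1,6,8,7,4,14]),
  ([],[456,478],[10,38,179,1033,1031,1029,53,1035,136,55,1026]),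
  ([567],[],[1014,1002,1000,245,1001]), ([],[6678],[1041]), ([],[8567],[1035]), ([],[],[103])]

theorem certCheck6 : checkCert 9 [true, true, false, false, false, true, true, false, true]
    certTable6 certSteps6 = true := by
  decide +kernel

/-- Clauses used for the colour sequence `AABBBABAA`. -/
def certTable7 : List (List ℕ) := [

  [134567, 132346, 33456, 142345, 153457, 140234, 140123, 133567, 141245, 122345, 23578, 134578, 121235, 141235, 132567, 140134],
  [152346, 154678, 134568, 31234, 32478, 51234, 31348, 143567, 122456, 123456, 123467, 144567, 141345, 151236, 131346, 51235],
  [123457, 132345, 153458, 133578, 134678, 32457, 14678, 183456, 142467, 152457, 151234, 133456, 12348, 132378, 140368, 142346],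
  [142567, 52478, 144568, 122457, 63467, 132347, 12456, 153478, 123458, 132367, 132467, 144578, 152478, 133568, 151246, 121234],
  [132348, 151346, 121245, 132578, 194678, 132468, 140378, 62345, 153678, 132356, 143467, 132478, 153467, 152458, 123478, 152678],
  [172346, 132368, 153468, 132568, 52346, 124678, 141234, 133678, 32467, 51236, 122356, 122357, 51237, 41456, 122467, 140258],
  [140278, 62467, 31245, 141368, 142367, 143468, 140267, 133467, 141378, 12346, 184678, 152345, 143478, 63468, 31268, 142568],
  [122367, 122458, 2345, 31238, 132456, 123468, 31346, 33457, 32346, 140478, 131234, 142468, 51346, 131236, 53457, 1234],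
  [152357, 12347, 42345, 122358, 33468, 142347, 72458, 131246, 120257, 140145, 121267, 161245, 120137, 141478, 120356, 121357],
  [133457, 110167, 140678, 151356, 22345, 141238, 120457, 121346, 141268, 140168, 140257, 121246, 63578, 4578, 161234, 161235],
  [120367, 140135, 120124, 120368, 31367, 140148, 151456, 120248, 1478, 141248, 140128, 140167, 140347, 121467, 120235, 73678],
  [52358, 153456, 120128, 110147, 140157, 42358, 1278, 120348, 1356, 120578, 133468, 1358, 141346, 51246, 1456, 51247],
  [22368, 184567, 121367, 73468, 161567, 121458, 120258, 120125, 62568, 54678, 121236, 13568, 32367, 120345, 42458, 141458],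
  [120568, 140125, 53678, 141578, 132357, 142458, 72457, 120238, 161345, 120678, 4678, 12356, 163458, 120135, 51347, 51248],
  [31235, 140568, 121348, 121257, 120468, 120138, 123578, 145678, 1678, 52357, 1256, 133478, 161258, 141567, 140248, 120134],
  [152456, 81257, 110137, 120148, 141568, 120178, 152356, 141468, 62468, 141257, 120458, 152468, 120478, 162345, 22367, 111568],
  [110127, 162458, 140147, 31467, 140146, 52347, 140247, 62347, 120456, 121456, 120256, 163578, 140578, 183457, 81457, 110135],
  [121256, 120234, 140348, 140268, 141258, 141236, 110567, 161458, 140367, 121248, 141267, 140156, 122346, 121358, 120268, 120357],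
  [51345, 120156, 141278, 120245, 122348, 194578, 32358, 121345, 120237, 120168, 151256, 183567, 53458, 140237, 32458, 123678],
  [120145, 120278, 31267, 44578, 140567, 140357, 120267, 140126, 120127, 121457, 63458, 52345, 140458, 141237, 141348, 165678],
  [140245, 140124, 32345, 121238, 143578, 33467, 31246, 142478, 143458, 72468, 120467, 53478, 41256, 63478, 142578, 143568],
  [140138, 161257, 41356, 120123, 62578, 120378, 43478, 42367, 122678, 140235, 52457, 64578, 120157, 121356, 120158, 140345],
  [140137, 140158, 32348, 32357, 72467, 140127, 161358, 42478, 120167, 140468, 23478, 140178, 71234, 152467, 52458, 125678],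
  [122347, 33678, 22358, 73467, 140358, 33458, 140136, 121567, 73458, 132678, 121258, 194567, 141246, 31236, 140238, 120358],
  [141247, 141358, 120567]]

/-- Refutation for the colour sequence `AABBBABAA`. -/
def certSteps7 : List (List ℕ × List ℕ × List ℕ) := [
  ([],[8257,257],[154]), ([],[1248],[167]), ([],[8128,128],[170]), ([],[1457],[150]),
  ([],[347,8347],[172]), ([147],[],[179]), ([],[8157],[180]), ([],[1578],[185]),
  ([247,124],[],[191]),
  ([2357,2567,8145,8156,1357,9567,1267,8137,2457,1157,1256,1167,1156,1567,8167,2256,2267,8126,1456,1467,8146,8147,1257,2467,8127,8125,8136,1356,2456,2356,1367,8135,8567,2257,2367],[],[196]),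
  ([],[1258],[198]), ([],[1257],[136]), ([],[1568],[208]), ([],[125,8125],[209]),
  ([148],[],[168]), ([],[8148],[165]), ([],[1238],[215]),
  ([12578,11578,8568,1235,8378,8348,8358,11468,8345,1458,11478,8368,1138,1358,1145,1234,4458,8468,1158,8458,1245,12568,1345,8478,1348,1134,8578,11458,11568,1135,1148],[],[220]),
  ([],[1678],[217]), ([167],[],[145]), ([],[8167],[171]), ([134,347],[],[222]),
  ([248,124],[],[223]), ([],[8568,568],[225]), ([],[1468],[228]), ([],[1138],[229]),
  ([168],[],[232]), ([],[8168],[153]),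
  ([1458,1125,10568,9568,8245,1358,8258,9268,8135,8238,3358,8145,9235,1158,8158,2358,8125,8568,2258,9238,9248,3458,8278,10578,2458,9578,8128,8268,1128,9278,8248,8138,8235,9258,8178,8578,9245],[],[236]),
  ([],[9567,567],[237]), ([],[248,8248],[238]), ([],[1235],[174]), ([137],[],[242]),
  ([],[1148],[243]), ([],[568,9568],[244]), ([],[1178],[245]), ([],[468,9468],[247]),
  ([],[1458],[250]), ([],[1478],[252]),
  ([10345,8234,8245,1145,1134,1123,1245,3345,1234,1124,1125,8345,1345,1135,8235],[],[253]),
  ([568],[],[255]), ([],[8568],[1006]), ([],[9568],[1002]), ([127],[],[256]), ([128],[],[182]),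
  ([125],[],[241]), ([],[8128],[1014]), ([],[8125],[1010]), ([],[2257],[227]),
  ([10578,3358,8258,12578,1348,1245,8578,8234,10568,8458,3345,1345,10458,8468,1124,1125,3458,8245,3348,1158,12568,8235,10478,8268,8238,10468,1358,8478,1145,1128,8248,8278],[],[257]),
  ([],[8147],[258]), ([467,146],[],[259]), ([],[8146,146],[260]), ([],[8247,247],[262]),
  ([],[1456],[264]), ([],[1256],[266]),
  ([6678,11567,4578,1378,11578,8367,8345,8378,4478,4678,1278,1157,8347,8368,8357,8567,1358,11568,1135,1357,1137,1237,8578,8358,1158,4457,8348,4458],[],[267]),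
  ([145],[],[270]), ([],[8145],[137]), ([],[2458],[197]), ([135],[],[271]), ([138],[],[187]),
  ([],[8135],[161]), ([],[2357],[143]), ([],[126,2256],[272]), ([],[1234],[273]),
  ([],[348,8348],[274]), ([],[9578],[211]), ([],[8268,268],[275]), ([],[9258,258],[276]),
  ([567],[],[278]), ([],[9567],[1013]),
  ([2348,2258,2345,9458,1245,1145,1348,8578,8468,8134,2358,8158,8178,8124,9478,9468,8138,2245,1358,2248,12578,1158,1345,8458,8478,12568],[],[279]),
  ([],[8367,367],[280]), ([],[2248,124],[281]), ([],[9267,267],[282]), ([],[156,8156],[283]),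
  ([],[2358],[285]), ([],[1268],[286]), ([],[1357],[287]), ([345,134],[],[288]),
  ([],[1156],[289]), ([],[278,9278],[290]), ([],[1245],[291]), ([],[2345,134],[295]),
  ([],[1237],[296]), ([],[1168],[297]), ([],[8237,237],[301]), ([],[1145],[304]),
  ([],[1278],[305]), ([267,126],[],[306]), ([478],[457],[307]), ([],[8567],[308]),
  ([],[8357,357],[309]), ([],[1267],[310]), ([],[1127],[312]), ([],[2457],[313]),
  ([],[458,8458],[316]), ([],[237,9237],[317]), ([],[1135],[221]), ([],[1134],[239]),
  ([],[1137],[140]), ([],[9348,348],[318]),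
  ([1467,1367,1567,1368,1158,6678,13678,1378,8578,8678,1157,1356,1167,1358],[],[319]),
  ([],[8245,245],[320]), ([],[8124,124],[321]), ([],[2238,123],[323]), ([],[1345],[205]),
  ([],[1348],[183]), ([],[11578,378],[324]), ([],[1467],[330]), ([156],[256],[332]),
  ([],[278,10578],[334]), ([],[368,11568],[335]), ([],[8138],[336]),
  ([8257,8137,9257,8267,9245,8237,1157,3357,9267,9235,8235,8245,1125,3457,8127,10567,9237,8247,9247],[],[337]),
  ([156],[356],[338]), ([],[1123],[339]), ([278],[258],[340]), ([],[1367],[160]),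
  ([],[1368],[163]), ([],[1356],[142]), ([],[1378],[341]), ([],[235,8235],[345]),
  ([478],[458],[347]), ([],[1157],[348]), ([],[2356,136],[349]), ([],[1158],[350]),
  ([],[345,8345],[351]), ([],[8137],[352]), ([],[8158],[353]), ([],[8127],[357]),
  ([4458,9345,8578,8123,9358,8345,2235,8368,2238,1358,8348,11578,8178,9378,9348,9368,11568,8358,8378,2258],[],[358]),
  ([],[1167],[360]), ([],[8468,468],[361]), ([],[1128],[178]), ([],[1124],[162]),
  ([],[1125],[199]), ([],[8178],[363]), ([],[6678],[367]), ([],[8578],[268]),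
  ([],[358,8358],[372]), ([],[136,8136],[374]), ([],[2567,156],[375]), ([],[2258],[378]),
  ([],[238,8238],[382]), ([],[1358],[383]), ([],[9247,247],[384]), ([],[358,9358],[385]),
  ([],[1567],[386]), ([156],[10456],[93,1017,240]),
  ([],[156],[184,234,190,1034,1004,194,1010,1005,138,1042,311,173,1045,265,1059]),
  ([],[456],[93]), ([],[256],[1018]), ([],[356],[1014]), ([],[10456],[1000]), ([],[9456],[166]),
  ([],[11456],[177]), ([],[9256],[298]), ([],[9356],[147]), ([],[10356],[246]),
  ([8468,9468,12568,8478,12578,9478],[124,134,458],[1031,226,15,1026,207,66,1036,1021,1038]),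
  ([],[134,458,468,478],[1027,1008,1050,50,121,59,141,1000,98,1061,1056,127,364,114,1023,206,113,359,1052,248,115,5,1013,9,95,213,327,1018,96,111,1041,123,131,1004,292,1048]),
  ([],[458,468,478],[1009,50,121,59,1028,1000,22,1035,1043,56,1011,314,333,109,328,1008,70,1021,108,46,1018,101,1059]),
  ([347,457],[247,345],[1012,37,261,114,1025,3,5,1015,9,1051]),
  ([2345,8134],[123,124,345],[1025,66,1013,28,6,12,63,216]),
  ([347,457],[345],[1014,1061,15,1036,1001,1065,1000,31,21,1017,9,71,5,1027,3,1053]),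
  ([],[134,123,124,345],[15,1037,1001]),
  ([9358,8358,8345,9345,4458,11568,9368,8368,11578,8378,9378,9348,8348],[123],[6,12,1027,1015]),
  ([4457,4456,4567,11457,4467,5567],[367,467],[27,23,74,379]),
  ([9245,8245,123],[124,134],[31,21,9,86,5,1021,13,1040,15,66,1030,139]),
  ([],[234,123,134],[127,1031,63,6,15,5,86,158]),
  ([234,345,346],[],[43,84,105,315,322,16,1,107,116,33,73,39]),
  ([245,3346,3356,3345,345,346],[],[43,107,54,116,16,39]),
  ([257,3467,3456,10467,10567,3457,3346,3356,3367,3345,3347,3357,457,12567],[],[0,14,41,193]),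
  ([9267,10567,8267,3457,9247,8247,8245,9245,8235,9235,3357,9237,8237],[257],[1077,249,1029]),
  ([246,124,3346,9236,2346,123,9234,346],[],[122,189,326,16,65,62,135,125,80]),
  ([345,457],[467],[0,27,1049,119,126,2,1004,144,4,7,103,43,86,1005,1007,92,31,164,1046,1041,91,204,368,13,1028,9,151,112,277,90,284,1003,8,1038,1006,1076,1060,1018,97,51,102,48,1051,40,1001,1000,94,24,1002]),
  ([],[234,245,345],[3,1039,1026,5,148,1029,9,1065]),
  ([357,457],[346,467],[1001,1012,26,25,32,52,0,4,7,1009]),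
  ([11568,4678,8368,11578,8378,8367,11567,4478,4458,8348,4457,8347,8345],[357],[10,1046,230,1025,1062]),
  ([458],[358,235,245],[1032,13,1042,8,181,370,95,200,1059,1033,134,149,131,1023,152,111,1060,1052,1037,96,169,1071,113,1073]),
  ([358,11457,357,11468,11568,4678,11478,11578,11467,11567,4478,4458,4457,5578,458,12568,5678,12567,12578],[],[34,35,293]),
  ([],[478,467],[218,59,27,85,50,1019,157,11,1005,28,1031,1016,1083,362,52,342,32,1063,1046,109,56,78,23,1059,74,104,70,1041,108,46,99,303,1038,101,1002,4,1000,1028,1023,1014,224,71,1001]),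
  ([678],[478],[201,1000]),
  ([458],[358,345],[1033,28,203,156,1030,376,1025,46,99,1040,104,70,1043,1065,1048,56,1016,31,71,1003]),
  ([123,234,346],[],[120,1,84,21,19,89,42,30,29,1009]),
  ([2235,8123,10345,8245,9245],[235,345],[1035,28,13,1038,159]),
  ([10357,10457,3347,3357,3345,10345,11457,4457],[247,245,347,467],[52,74,23,27,97,133,51,48,40,100,269]),
  ([10467,5678,10478,10678,3468,3478,3467,3368,3378,3348,10457,3567,3367,3347,3578,10458,3568,3346,678],[268,267,468],[1004,1039,18,1056,11,0,17,123,344,106]),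
  ([9246,9346,9236,2346,9234,3346,10346],[126,124,123],[63,155,202,80]),
  ([678],[245,467],[1006,1058,1041,1013,1005,10,1011,4,1024,32,8,1052,3,1012,84,120,16,1,1004,6,12,1003,176,33,355,233,294,212,83,77,67,53,57,14,41,128,64,45,81,1002,20,49,1090,58,75,69,79,60,1023,22,42,118,124,132,30,29,65,62,85,1000,110,1059,40,1001]),
  ([678],[467],[1007,1042,1059,1014,1025,1006,10,1012,1000,98,54,37,302,346,130,366,19,1024,16,105,49,263,58,75,69,44,14,41,83,77,67,22,42,118,124,1,79,60,53,57,64,45,81,132,30,29,65,62,85,1001,110,1060,40,1002]),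
  ([346,234,678],[],[1000,1008,1060,325,1020,1026]),
  ([246,3368,3367,3346,3378,3348,3347,247,678],[],[1009,1001,38,20,329,251,1061,214,1044,134,67,77,83,356,365,377,41,14,49,60,79,75,36,18,11,0,17,58,69,106]),
  ([236,247,234,678],[],[1094,19,12,6,129,1010,20,44,45,64,53,1001,2,25,1,57,81,1000,54,47,8,1056,3,24,1007,33,73,39]),
  ([247,234,678],[],[1011,1046,1002,2,1010,10,7,1063,4,35,34,61,1029,26,1003,38,36,18,11,0,17,20,1095,129,44,19,1028,22,78,117,1000,192,254,175,87,82,76,72,55,68]),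
  ([10345,8245,9245],[123,235,345],[6,12,1009]),
  ([367,678],[348,346],[117,1013,1065,2,1031,78,1048,1012,10,7,4,35,34,61,26,1005,38,36,18,11,0,17,76,210,369,72,55,87,82,68]),
  ([234,678],[236],[1002,1006,88,94,1005,47,1014,1066,37,24,2,3,1060,8,51,1032,133,1040,1082,1049,1013,10,7,26,32,25,219,90,13,1050,1001,92,115,1068,1063,91,112,354,1000,23,343,102,48,1073,100,1023,14,128,299]),
  ([123,236,10346,9246,9346,234],[],[1,21,19,89,381,42,122,30,29,135,125,80]),
  ([234,678],[],[1008,1086,1016,1068,1007,2,188,25,1004,37,88,8,1062,3,24,380,47,1001,1,1000,1003,33,73,39]),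
  ([],[345,234],[130,1023]),
  ([678],[],[1018,1070,1053,17,0,11,18,1010,38,36,1001,1000,119,300,126,373,2,235,331,371,61,34,35,4,7,186,195,103,72,55,76,87,82,68]),
  ([],[8678],[146]), ([],[13678],[231]), ([],[],[1065])]

theorem certCheck7 : checkCert 9 [true, true, false, false, false, true, false, true, true]
    certTable7 certSteps7 = true := by
  decide +kernel

/-- Clauses used for the colour sequence `AABBBBAAA`. -/
def certTable8 : List (List ℕ) := [

  [124567, 132345, 143456, 140124, 154567, 140346, 140145, 143457, 123567, 31246, 31357, 141345, 121234, 153467, 121235, 140246],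
  [140125, 124578, 31456, 140236, 124568, 123456, 152567, 135678, 133456, 153567, 142456, 142345, 51235, 53456, 152345, 72346],
  [33467, 151235, 63456, 121245, 142356, 152467, 44567, 133678, 132357, 22346, 34567, 133457, 123467, 131345, 151234, 134678],
  [24678, 62346, 121456, 123468, 53467, 132457, 21345, 172345, 144678, 23678, 43567, 152568, 65678, 22356, 152578, 142346],
  [141245, 122356, 141346, 13456, 43467, 122456, 122345, 132347, 152367, 121345, 123568, 132678, 53567, 23456, 32456, 143678],
  [72345, 141236, 141256, 121346, 154568, 151345, 32367, 132356, 140567, 43678, 32567, 194567, 121356, 132478, 52345, 32467],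
  [31458, 13457, 123478, 33458, 62456, 132458, 132358, 122567, 134567, 62356, 121256, 63458, 33457, 133467, 141246, 122346],
  [132367, 31237, 123578, 153456, 43468, 132578, 142457, 1245, 132378, 132456, 32345, 132346, 153568, 44578, 151245, 2568],
  [34578, 152457, 153578, 152478, 162456, 140478, 3458, 133458, 152357, 132348, 125678, 31238, 43478, 122467, 133478, 52347],
  [161234, 51245, 152347, 153468, 51347, 32347, 134578, 52578, 142357, 71234, 52367, 152368, 22345, 62357, 133578, 184567],
  [31457, 131245, 152348, 133567, 14567, 33578, 132467, 1234, 52467, 153457, 44568, 142347, 53457, 1235, 73568, 154578],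
  [123457, 144567, 72456, 183578, 72568, 141235, 32578, 13567, 131234, 152358, 141234, 152468, 152456, 52456, 124678, 152378],
  [143458, 184578, 64567, 131235, 122368, 12347, 121457, 122378, 33468, 140268, 120347, 110158, 52478, 140156, 120168, 4578],
  [23478, 141248, 123458, 120268, 81268, 161236, 183456, 161235, 71235, 122357, 110128, 120245, 143567, 120238, 110148, 140368],
  [41345, 152356, 122358, 51345, 120234, 72467, 122478, 140148, 42345, 24567, 140146, 31248, 205678, 120148, 143578, 140126],
  [73478, 140123, 141678, 140458, 140128, 52358, 121267, 73578, 74567, 140278, 22456, 120568, 140347, 142458, 120258, 161246],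
  [12457, 33568, 121567, 52567, 161356, 140348, 140357, 31256, 63457, 31345, 51358, 121357, 121257, 42578, 120578, 141238],
  [120678, 120246, 140168, 141268, 140456, 32358, 140678, 120167, 152346, 140147, 122347, 73458, 121568, 120178, 120137, 120567],
  [141378, 121468, 183567, 161346, 162356, 53458, 91367, 121238, 11235, 120345, 72578, 120136, 13458, 120138, 81278, 195678],
  [110136, 62678, 120278, 2567, 120467, 141468, 141567, 110157, 120124, 51258, 31234, 161345, 120478, 163456, 164678, 121368],
  [140345, 122367, 120356, 132567, 140235, 121248, 91378, 12378, 162346, 32346, 144568, 120126, 22567, 163457, 81478, 52348],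
  [51346, 2356, 141458, 71345, 110146, 140578, 120357, 120267, 120378, 120367, 43456, 120147, 54578, 45678, 31257, 120346],
  [120125, 141478, 140167, 42568, 12348, 183467, 161468, 63578, 194678, 141358, 140467, 64678, 143467, 140137, 62458, 120468],
  [144578, 140134, 140568, 62358, 120348, 51236, 140457, 120134, 122468, 25678, 120248, 120157, 120368, 122457, 140157, 44678],
  [51234, 161456, 81568, 120247, 140245, 120257, 141278, 32478, 120135, 120235, 120458, 31356, 121367, 161368, 53578, 140356],
  [122578, 31247, 120237, 140248, 162345, 141456, 141368, 62345, 120156, 165678, 121236, 140136, 42356, 161268, 120358, 140127],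
  [140378, 122568, 152458, 33567, 13467, 73456, 140238, 121246, 120457, 140468, 120123, 51348, 140178, 140367, 120158, 140358],
  [141356, 32457, 121348, 120256, 161567, 140158, 121467, 120146, 143478, 120145, 141348, 140138, 32356, 63568, 120236, 145678],
  [141258, 140256, 120456, 3578, 120128, 31245, 52357, 54567, 140258, 140135, 121268, 142678, 140234, 122458]]

/-- Refutation for the colour sequence `AABBBBAAA`. -/
def certSteps8 : List (List ℕ × List ℕ × List ℕ) := [
  ([158],[],[203]), ([],[1238],[221]), ([],[1234],[228]), ([],[8123,123],[241]),
  ([],[9678],[242]), ([],[8458,458],[243]), ([],[1568],[251]), ([],[357,8357],[262]),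
  ([358,135],[],[266]), ([],[1578],[270]), ([],[8168],[274]), ([],[9268,268],[275]),
  ([],[8456,456],[276]), ([],[156,2568],[284]), ([],[1567],[287]), ([],[378,9378],[288]),
  ([],[1345],[297]), ([],[9468,468],[309]), ([157],[],[311]), ([258,125],[],[313]),
  ([8345,2345,2235,8125,1245,1135,9345,1235,8135,1134,8124,8145,2234,2245,8134,1145,8123],[],[315]),
  ([1145,1246,1346,1146,1134,1245,8356,8456,8345,11456,1356,1236,1156,1456,1235,1135,1136,8346,4456,1256],[],[317]),
  ([1168,5678,1367,1268,1278,1478,1348,5578,1467,1468,8468,1246,1267,1378,1146,5568,8467,1178,8458,1347,1368,8678,8457,8456,1248,1247,1678,12678,1148,8478,5567,1167,1147,1346],[],[318]),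
  ([],[8345,345],[320]), ([],[1356],[322]), ([],[8235,235],[324]), ([],[1678],[272]),
  ([],[1168],[206]), ([],[1126],[331]), ([],[1347],[202]), ([136],[],[304]), ([137],[],[294]),
  ([138],[],[326]), ([],[2368],[319]),
  ([8457,4457,8467,1457,8567,1237,11457,12567,1247,8357,1357,1137,11467,1235,1147,11567,1134,8345,1135,1257,8367,1245,8347,1145,1157],[],[333]),
  ([],[9458,458],[338]), ([],[1357],[342]), ([],[1378],[344]), ([],[1367],[345]),
  ([578],[567],[349]), ([],[1346],[351]), ([],[1125],[352]), ([],[478,9478],[353]),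
  ([],[8167],[354]),
  ([2348,8178,8156,8158,8468,1268,2246,1248,8124,1148,8148,12678,2468,8138,9458,9478,1348,2346,5568,2248,9456,1146,1468,8136,8128,1246,8678,2568,8134,8146,8478,8456,8126,1368,8458,2268,9468],[],[358]),
  ([],[9358,358],[361]), ([],[8467,467],[362]), ([478],[468],[363]), ([],[8137],[365]),
  ([],[134,8134],[369]), ([],[568,8568],[370]), ([148],[],[222]), ([],[8148],[231]),
  ([],[1478],[316]), ([],[1468],[367]), ([146],[],[340]), ([147],[],[334]), ([],[8147],[281]),
  ([],[1467],[308]), ([],[2468],[289]), ([],[8146],[234]), ([],[1348],[372]),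
  ([123,236],[],[373]), ([],[457,8457],[374]), ([568],[567],[377]), ([],[1157],[379]),
  ([],[1368],[380]), ([],[1136],[299]), ([],[1138],[301]), ([],[8157],[382]), ([478],[467],[383]),
  ([8136,8125,8456,8135,1156,8156,1256,2356,2346,1246,2256,1245,8134,1146,2245,2345,2456,1145,1456,8145,2246,8126,8124,9456],[],[385]),
  ([156],[],[386]), ([],[2567],[258]), ([],[8156],[205]), ([],[2568],[1023]),
  ([],[245,8245],[388]), ([],[1257],[389]), ([],[278,9278],[390]), ([],[1135],[392]),
  ([],[1235],[393]), ([128],[],[218]), ([],[1258],[254]), ([126],[],[212]), ([],[8128],[244]),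
  ([127],[],[302]), ([],[1268],[211]), ([],[8126],[239]), ([],[1267],[343]), ([],[1278],[306]),
  ([],[2267],[246]), ([],[1458],[394]), ([356,135],[],[395]), ([],[2367],[396]),
  ([9358,8378,2236,9378,9356,2268,8356,8158,4468,8123,8346,9348,2238,1236,8348,9346,4568,8138,8178,8136,8368,8678,9368,11678,8358],[],[397]),
  ([],[8356,356],[399]), ([124,247],[],[401]), ([],[1237],[402]), ([],[8248,248],[403]),
  ([8345,1134,8245,8234,1123,3345,10345,1245,1124,8235,1145],[],[404]), ([],[9456,456],[405]),
  ([],[9368,368],[406]), ([],[1156],[408]),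
  ([1158,1358,6678,8568,8567,1256,1167,8678,1457,8578,13678,1456,1178],[],[409]),
  ([],[123,2236],[410]), ([],[8136],[411]),
  ([8268,2268,3568,8258,9236,8248,9268,3468,8678,10678,8178,8238,9258,9246,9256,9238,8158,8138,1128,8278,9278,8236,8256,3368,8246,9248],[],[413]),
  ([],[1358],[414]), ([],[8127],[415]), ([],[1167],[279]), ([],[1137],[286]), ([],[1178],[285]),
  ([],[8238,238],[422]), ([],[8678],[278]), ([],[124,2246],[423]), ([],[1457],[424]),
  ([],[8468,468],[425]), ([],[1123],[426]), ([348,134],[],[427]), ([],[8178],[428]),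
  ([],[367,8367],[429]), ([],[1158],[430]), ([],[8358,358],[431]), ([],[356,9356],[432]),
  ([],[134,2348],[434]), ([],[1256],[435]),
  ([8125,2256,2356,2456,2467,8145,1456,8135,2257,9567,2357,2457,8567],[],[436]),
  ([],[8158],[437]), ([],[2467],[438]), ([],[1146],[439]), ([],[1145],[441]),
  ([],[348,9348],[442]), ([],[8138],[443]), ([],[1236],[446]), ([],[13678,578],[447]),
  ([],[258,9258],[448]), ([],[256,8256],[449]), ([],[1456],[450]), ([],[1245],[219]),
  ([],[1248],[378]), ([],[1246],[273]), ([],[1247],[387]), ([],[1128],[452]),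
  ([],[8258,258],[456]), ([],[135,8135],[457]), ([],[2268],[458]), ([],[10678,278],[459]),
  ([],[234,8234],[460]), ([],[1148],[237]), ([],[1147],[347]), ([],[1134],[375]),
  ([],[1124],[312]),
  ([9456,8456],[124,134,135,145],[73,1036,83,1002,92,50,6,3,1015,119,35,16,106,1030]),
  ([348,458],[456],[1022,1055,96,283,1014,1057,1000,9,167,153,145,15,100,1035,28,1001,69,1030,1005,26,19,111,1046,70,65,132]),
  ([458,567],[346,348,5578],[5,150,99,42,1048,346,21,1056,1027,2,1050]),
  ([578],[458,5578],[128,17]), ([468,578],[5578],[1046,1000,150,42,1002,200,1001]),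
  ([8234],[234,245,345],[27,1034,1051,156,1050,70,1027]),
  ([235,4456,9345,8345,2456,8145],[135,356,346],[1008,92,1016,1031,66,5,28,216,1065,1024,14,16,106,260]),
  ([456],[235,356,345,346],[1032,21,1053,5,1052,412,337,1011,36,19,65,407,178,69,1036,27,15,63,292]),
  ([9236,10346,9246,10356,9256,8236,8246,8256],[123,356,346],[1018,1033,66,5,1067,1026,213]),
  ([123,10345,9245,9234,9235,2345,135,3345,234,9345],[],[314,296,184,161,195,55]),
  ([10345,9245,9234,9235,2345,3345,9345],[124,123,145],[119,35,12,14,55]),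
  ([256,3467,3457,3456,234,235,456,467,567],[357,356],[1,42,104,4,90,259,188,105,323,129,157,22,37,87,123,112,40,71,159]),
  ([257,3457,3458,3478,234,235,457,458,478,578],[256,358],[165,1,1049,1007,1054,1043,4,47,60,84,175,23,307,182,151,117,129,157,22,37,127,371,418,62,131,40,71,120,187,75,59,102,137,193]),
  ([10356,8256,9256,10346,8246,9246],[236,123,356,346],[81,19,1004]),
  ([],[368,348,378,358,123,356,346],[51,1021,261,416,1066,79,1025,74,1053,1032,295,1073,1024,1039,66,5,223,1034,1040]),
  ([5567,5578,12567,6678,5568,5678,12568],[578,457],[1021,125,56,368,236]),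
  ([11456,5567,11457,5578,11458,4467,4478,4578,4567,11468,5568,5678,11467,4678,4468,4568],[478,378],[79,56,440,360]),
  ([8356,11456,8456],[345,346],[5,1063,21,1065]),
  ([9356,8356,11456,9456,8456],[134,124,123,346],[12,1033,3,1036,1077,66,5,83,1054,291]),
  ([135,2245,2235,9234,134,2234,245,3345,235,345],[],[30,33,339,126,85,45,55]),
  ([9234,134,3345,235,345],[125,124,123],[265,12,80,14,35,1000]),
  ([478,10457,3578,10458,5578,247,245,234,235],[457,456],[197,71,40,53,1,1058,1052,125,175,204,391,47,170,194,4,229,305,62,131,327,101,93,84,23,22,37,75,59,187,102,137,120,193]),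
  ([247,236,8456,11456],[356,346],[61,41,1,1047,1004,80,1056,29,1043,1032,1046,1003,148,1035,46,98,44,97,108,51,99,300,8,7,0,20,17,74,114,192,1001,1072,350,253,400,118,1000,140,1007,57,39,116,147,68,13,47,1005]),
  ([345],[478,347,123,356,346],[29,108,0,97,7,8,2,44,207,208,140,20,17,107,51,98,1008,74,114,192,57,39,116,147,68,13,47,1006]),
  ([367,3567,10456,10356,3467,10346,467,10457,5567,11457,10357,4567,11456,10347,4467,234,236],[],[123,13,154,86,72,37,71,112,357]),
  ([345,236],[247,356,346],[41,143,171,44,1059,61,29,80,97,108,2,256,8,152,7,0,118,1001,1056,194,95,90,63,141,36,26,103,1000,89,57,451,240,1010]),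
  ([],[456,345,356,346],[1051,1080,2,1008]),
  ([456,4457,8345],[457,347,356],[252,1060,264,7,1084,42,164,58,88,177,1065,220,364,1039,1071]),
  ([],[467,348,358,123,356,346],[48,68,116,89,1013]), ([],[367,348,358,123,356,346],[89,57,1014]),
  ([10356,3367,3357,10567,10367,11567,3456,3467,10346,3457,10345,4567,4457,4456,10347,4467,3356],[257,256,357],[152,103,290]),
  ([4458,4478,4567,4578,4457,4456,4467],[578,348,358,123,356,346],[1001,58,25,51,74,359,1037,79,1016,238,39,445,124,303,23]),
  ([236],[247,356,346],[61,41,1,87,1066,143,44,171,1006,1078,21,176,1005,18,6,50,11,1025,1004,1088,10,33,54,433,114,134,8,46,45,64,27,381,98,210,1021,235,9,230,461,63,141,69,1003,1002,58,25,154,86,72,1020,22,40,112,36,1001,1000,348,128,1019]),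
  ([2345,9234,9235,3345],[245,145,345,124,123],[11,64,27,1022]),
  ([236],[345,356,346],[1001,1058,61,41,1,1068,1080,21,1007,18,6,50,11,1027,1090,10,33,54,134,46,45,1005,1004,58,1000,78,189,53,166,121,1022]),
  ([236],[356,346],[1002,1000,29,1089,2,1012]),
  ([10456,11456,8456,10346,8246,10356,8256,8356,8346],[234,236],[19,1036,111,328]),
  ([345,123,10346,8246,8346],[236,356],[105,36,1041,1062,29,1091,2,26,1000,122,384,94,28,1,227,46,45,30,33,126,85,1027]),
  ([],[356,346],[5,1002,105,49,82,1042,36,110,15,63,1024,1000,1011,18,1030,189,11,28,156,64,27,33,54,1,46,45,1028]),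
  ([3468,8248,9248,3368,8238,9238,8246,9246,8236,9236],[268,278,256],[1040,1067,249,1043,82,201,1094,127,1044,1042,417,1056]),
  ([567,367],[347,346],[1001,34,68,164,104,183,169,163,13,67,176,44,21,115,4,25,91]),
  ([3468,8248,9248,3368,8238,9238,8246,9246,8236,9236],[567,256],[1073,332,355,1083,269,1001]),
  ([123,234],[256,236,346],[49,15,110,19,81,1003,139,113,271,1058,196,356,149,209,1065,376,1000,76,1001]),
  ([],[123,236,346],[1004,67,34,49,78,27,18,64,1072,1070,444,181,1088,11,6,1089,1045,1102,173,16,14,215]),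
  ([],[567,125,346],[268,106,16,1005,34,18,50,198,6,1071,1046,267,92,88,310,1052]),
  ([234],[236,346],[1001,113,1006,1002,149,263,1000,76,1004]),
  ([],[236,346],[1007,67,34,49,78,1000,1046,1040]),
  ([356],[346],[34,1074,67,18,1049,1093,6,11,1000,1081,41,1106,173,16,14,1002,76,1006,148,1083,73,153,3,12,35,1096]),
  ([],[346],[1009,1000]), ([134],[],[336]), ([],[2346],[83]), ([],[8134],[1084]),
  ([],[2348],[1057]),
  ([236],[345],[1082,31,9,12,3,1107,1094,224,54,6,11,119,1050,73,16,14,35,1097]),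
  ([456,234,236],[],[31,1000,94,121,30,122,1,87,123,24,280,29,178,115,188,225,214]),
  ([],[468,478,458,456,124],[133,1091,56,1093,20,1108,1071,1104,1065,325,3,1101,1064,1090]),
  ([467,4457,567,367,5567,11457,11456,4567,4456],[],[420,109,25,13,4,91]),
  ([],[467,458,456,124],[48,1083,1001]),
  ([135,236],[456],[1004,24,31,9,1109,10,1080,293,8,172,2,7,0,1000,38,52,32,1001,43]),
  ([],[578,457,458,456,124],[1001,38,4,0,17,20,125,1003,47,170,23,84,1038]),
  ([578,4457,4467,11567,12567,11467,4456],[358,457,456],[60,0,165,257,8,7,2,91]),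
  ([4457,467,4456],[357,457,456],[52,38,0,183,7,2,8,1004]),
  ([234,236],[],[1008,24,31,9,122,94,30,1007,1111,1078,1003,1056,96,160,1004,38,52,32,95,168,13,4,25,86,109,43,146,53,72,22,40,1002,60,23,1001,107,245,277,247,174,335,135,142,162,298,180,185,102,120,130,39,124,93,101,62,191,75,155,59,1000,454,158,136,117,179]),
  ([236],[],[31,1092,9,1117,3,12,1000,1058,186,144]), ([],[9236],[81]), ([],[8236],[19]),
  ([234],[],[329]), ([],[8234],[1058]), ([],[3346],[111]), ([],[9234],[186]),
  ([],[123,124],[3,1117,12,144]),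
  ([10467,10567,3457,3467,3456,3345,3356,3357,12567,567],[257,457,237,456],[0,282,321,90,103,118,26,159]),
  ([246,578,245,357,123,467,567],[457,458,456],[10,28,70,65,113,217,139,226,60,77,24,52,13,4,25,32,109,43,1004,174,124,39,107,142,135,398,130,158,23,30,199,95,168,121,146,166,53,72,22,37,1000,136,182,151,117,366,180,185,62,191,93,101,162,75,155,59,179]),
  ([],[246,124,456],[1076,3,1082,1115,110,15,100,82,1065,26,255]),
  ([357,467,567],[458,124,456],[1000,250,1003,1083,1116,10,1061,160,1007,1001]),
  ([467],[357,456],[77,32,43,24,172,1006]),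
  ([467,567],[124,456],[1000,10,1085,1118,1001,1063,96]), ([458],[456],[77,99,1063]),
  ([3345,3356,8235,10456,8256,8456],[245,246],[15,1095,69,132]),
  ([467,567],[456],[77,1121,1003,10,73,1002,9,167,184,100,28,1071,26,1112,181,65,70,1000,30,145,453,126,85,161,195,55]),
  ([567],[456],[1002,20,1126,1122,1000,48,1106,1099,248,190,1082,56,133,1101,0,17,1115]),
  ([],[458,456],[20,1000,38,1111,1101,177,233,138,48,190,330,0,17,1053]), ([],[456],[1004,1000]),
  ([],[356],[421]), ([],[11456],[115]), ([],[567],[88,1112,1102,138,341,1076,1105,1089]),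
  ([],[457],[42]), ([],[467],[455]), ([],[357],[419]), ([],[367],[76]), ([],[5567],[104]),
  ([],[11457],[169]), ([],[347],[32]), ([],[4567],[163]), ([345],[],[24,43,1018]),
  ([245],[],[232]), ([],[],[1064])]

theorem certCheck8 : checkCert 9 [true, true, false, false, false, false, true, true, true]
    certTable8 certSteps8 = true := by
  decide +kernel

/-- Clauses used for the colour sequence `AABBBAAABA`. -/
def certTable9 : List (List ℕ) := [

  [51346, 123456, 41568, 123457, 142345, 141345, 121678, 133568, 155678, 123467, 132348, 1368, 54568, 52356, 34568, 134567],
  [154678, 140347, 31234, 140123, 194568, 152468, 134568, 32356, 43457, 74678, 105789, 110189, 91469, 133468, 131248, 110789],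
  [140127, 121279, 52348, 23579, 184678, 120689, 121367, 153457, 110125, 120189, 140569, 151278, 120589, 140349, 151268, 140129],
  [121257, 120389, 122345, 72378, 121278, 133456, 110129, 121345, 120167, 153478, 120489, 140157, 164567, 120457, 13458, 1378],
  [151234, 22345, 32468, 151678, 132368, 121256, 134678, 71234, 1468, 120179, 121379, 140689, 132567, 110136, 120347, 140169],
  [121358, 132345, 140179, 120236, 120145, 63569, 131348, 81267, 120268, 120246, 121245, 131234, 44567, 146789, 140189, 81357],
  [120256, 72358, 140379, 120168, 120579, 132478, 140359, 63567, 140579, 121357, 140125, 152457, 110146, 121579, 143789, 132568],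
  [121489, 140678, 123459, 134578, 140167, 132467, 120346, 31348, 110137, 73456, 161789, 91379, 141567, 120235, 63589, 145789],
  [140138, 151378, 31236, 154578, 33568, 120359, 120368, 121578, 120267, 131238, 152368, 140234, 42345, 120239, 120567, 152378],
  [151358, 140245, 123479, 153568, 121689, 120123, 152358, 153468, 153678, 120478, 120678, 32467, 123567, 140137, 62346, 140467],
  [140147, 120578, 81479, 140567, 154568, 72456, 143567, 120459, 123468, 53568, 141789, 3459, 12348, 140356, 120468, 121478],
  [161345, 152478, 153578, 140178, 132678, 120789, 121479, 110145, 120134, 21568, 121368, 121679, 41578, 142346, 151458, 140369],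
  [121389, 121468, 120345, 5678, 140149, 43467, 143467, 124567, 120157, 73578, 163579, 183456, 81279, 141235, 140158, 23567],
  [120367, 152348, 43579, 175678, 151468, 52467, 51348, 153458, 126789, 31347, 162345, 121234, 151258, 140148, 140139, 121235],
  [121589, 120467, 120146, 1268, 33456, 140345, 152458, 43567, 120135, 121789, 151238, 151248, 72457, 140124, 132468, 141568],
  [123579, 132367, 32568, 140367, 120379, 120456, 140134, 133567, 132346, 172348, 140589, 120237, 121268, 120479, 120356, 62345],
  [120259, 151348, 120178, 151478, 31238, 120378, 121457, 140135, 140789, 143569, 125679, 32348, 110689, 120279, 194567, 120139],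
  [52468, 132347, 24567, 152356, 141245, 120159, 140357, 151578, 161235, 32456, 72368, 123679, 140235, 144567, 120469, 121568],
  [121267, 120289, 120357, 120169, 140168, 120234, 153456, 166789, 140346, 120568, 1358, 120147, 140389, 3467, 120278, 121467],
  [120137, 120156, 121378, 122456, 120124, 72678, 132578, 140145, 120257, 120136, 121567, 133458, 152467, 121258, 125678, 163567],
  [132378, 143589, 140679, 140457, 121456, 120125, 120369, 140159, 3457, 140456, 120245, 120269, 152678, 132356, 143579, 151368],
  [152456, 120569, 121356, 120679, 121289, 123458, 120247, 121458, 12367, 53456, 140128]]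

/-- Refutation for the colour sequence `AABBBAAABA`. -/
def certSteps9 : List (List ℕ × List ℕ × List ℕ) := [
  ([],[1167],[56]), ([],[8157],[59]), ([],[1457],[61]), ([],[1179],[73]), ([],[1347],[78]),
  ([],[8179],[82]), ([],[1145],[84]), ([467],[456],[92]), ([],[1489],[58]), ([],[1579],[100]),
  ([367],[357],[103]), ([146],[],[108]), ([149],[],[28]), ([],[2579],[109]),
  ([],[2489,148],[112]), ([],[8678,678],[113]), ([],[8167],[116]), ([129],[],[54]),
  ([],[8129],[47]), ([],[1268],[88]), ([125],[],[40]), ([],[1256],[96]), ([],[8125],[106]),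
  ([137],[],[120]), ([135],[],[95]), ([],[2357],[105]),
  ([8158,1389,2478,8159,1478,8148,1678,8178,9789,2278,2679,2379,2289,8139,1279,1189,8789,2789,1378,8149,8169,1689,1379,2489,8127,8128,1578,8168,2589,8138,1178,1589,1278,1289,1679,8147,1479,2279,2689,8189,8137,1789,2578,2389,2678,2479,2378],[],[122]),
  ([139],[],[123]), ([],[2379],[74]), ([],[1389],[49]), ([],[9567],[124]), ([],[1235],[125]),
  ([],[8138,138],[128]), ([],[1359],[133]), ([],[1368],[134]), ([],[158,2578],[135]),
  ([],[1267],[136]), ([],[1239],[141]), ([],[1567],[142]), ([],[8245,245],[145]), ([136],[],[77]),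
  ([],[2367],[38]), ([],[168,2689],[148]), ([],[1478],[153]), ([],[1678],[154]),
  ([],[8137],[157]), ([],[467,8467],[159]), ([],[1578],[161]), ([147],[],[162]),
  ([],[8567],[163]), ([],[367,11567],[166]), ([],[1459],[167]), ([],[356,8356],[173]),
  ([],[1468],[174]), ([],[148,2478],[175]), ([],[1346],[118]),
  ([1345,2345,1234,1134,8124,8345,8145,2235,8123,8135,9345,2245,8134,1245,2234,1135],[],[176]),
  ([],[178,8178],[179]), ([],[1789],[181]), ([],[2479],[182]), ([145],[],[183]),
  ([],[1134],[184]), ([158],[568],[185]), ([],[138,2368],[186]), ([],[2679],[187]),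
  ([178],[578],[188]), ([],[8147],[160]), ([],[2389,138],[192]), ([],[2468,148],[193]),
  ([],[1123],[149]), ([],[1345],[194]), ([568],[578],[195]), ([],[8149],[196]), ([],[1157],[200]),
  ([1139,8367,8345,11579,8359,1259,8349,8589,1679,1257,11589,4459,8347,1159,13789,1237,8569,8379,1135,4479,1379,11567,4579,11789,1479,4679,8369,6679,8357,8389,1137,8579,4457,8789,1279,1357,11569],[],[202]),
  ([127],[],[204]), ([],[2279],[33]), ([126],[],[87]), ([],[8127],[32]), ([],[2257],[48]),
  ([],[2256],[69]), ([],[1689],[37]), ([],[8169],[79]), ([],[9235,235],[205]),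
  ([357],[356],[207]), ([],[1367],[208]),
  ([2458,13678,2468,9678,2456,2578,2478,2378,2358,2278,6678,2268,2568,2467,2457,9578,2368,2567,2678,2356,2258,2267,9568],[],[211]),
  ([],[1589],[44]), ([347,134],[],[217]),
  ([3345,1124,1125,1245,8345,8235,1135,8234,1234,8245,10345],[],[218]), ([],[8148,148],[221]),
  ([],[8139],[222]), ([],[123,2235],[223]), ([],[2589,158],[224]), ([],[1467],[225]),
  ([],[1189],[41]), ([],[1168],[99]), ([],[1146],[226]), ([128],[168],[227]),
  ([],[345,8345],[229]), ([367],[356],[231]), ([],[1135],[232]), ([],[178,2789],[233]),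
  ([],[8367,367],[243]), ([],[1379],[244]), ([],[1456],[245]), ([],[8134,134],[246]),
  ([],[1237],[251]), ([],[128,2268],[252]), ([],[1479],[253]), ([],[1356],[254]),
  ([],[1259],[256]), ([],[1178],[258]), ([],[1378],[261]), ([],[2457],[262]), ([],[8135],[263]),
  ([],[6679],[266]), ([],[1279],[269]), ([],[1139],[271]), ([457],[456],[274]), ([189],[],[27]),
  ([789],[],[31]), ([689],[],[268]), ([],[8189],[94]), ([],[9789],[170]), ([589],[],[26]),
  ([],[8789],[264]), ([],[8689],[75]), ([],[14789],[93]), ([],[13789],[127]), ([],[8589],[250]),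
  ([],[9245,245],[276]), ([],[1159],[277]), ([],[8357,357],[278]),
  ([8245,9245,10345,8123,8345,8145,1125,2235,9345,9235,8235],[],[280]), ([],[235,8235],[284]),
  ([],[12567,467],[285]), ([],[1469],[286]), ([],[158,2568],[287]), ([],[2267],[288]),
  ([],[1289],[289]), ([],[1357],[290]), ([],[1169],[291]), ([],[8168,168],[292]),
  ([7789,1569,8679,1679,1269,8678,1278,1568,1369],[],[295]), ([],[8346,346],[296]),
  ([],[1568],[297]), ([138],[158],[298]), ([],[1147],[299]), ([],[389,8389],[300]),
  ([],[1278],[302]), ([],[2467],[303]), ([],[1246],[89]), ([],[8569],[42]), ([],[1137],[304]),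
  ([],[1156],[305]), ([],[138,2378],[306]), ([],[1124],[308]), ([],[8145],[311]),
  ([],[1257],[312]), ([],[1136],[313]), ([],[2567],[314]), ([],[2258,128],[317]),
  ([],[568,6678],[318]),
  ([4457,8357,4567,4467,1236,8346,11567,8367,8347,8356,8345,4456],[],[319]),
  ([],[11589,389],[321]), ([],[457,8457],[323]), ([],[8579],[104]), ([],[2456],[324]),
  ([],[1125],[325]), ([],[1369],[326]), ([],[8159],[327]), ([],[456,8456],[329]),
  ([],[1245],[330]), ([],[1269],[331]), ([],[8679],[322]), ([],[11579,379],[334]),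
  ([],[1236],[83]), ([],[1234],[293]), ([],[1569],[337]), ([],[2356],[338]), ([],[1679],[339]),
  ([],[128,2289],[340]), ([],[1247],[342]), ([],[2458,148],[343]), ([],[128,8128],[346]),
  ([],[234,345],[1028,65,140,139,1018,50,1052,4,1033]),
  ([],[124,345,134],[1000,1029,5,1025,55,90,237,18,1032,19,219,1047]),
  ([],[345,134],[1001,1000,71]), ([],[456],[1062,1025,1007,1053,1020,199,1008,60]),
  ([],[356],[121,1051,1039,1030,345,1016,301,9,156,1023,1052,1028,3,1031,1,17,1010]),
  ([],[11456],[294]),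
  ([],[345,357],[35,85,265,191,126,1009,1014,110,210,1006,98,1061,283,1028,1052,102,1023,240,171,1031,328,45,114,17,146,3,1041]),
  ([345,11478,11578,11678,11468,11568,11458,358,12578,12678,5568,12568,13678],[],[7,62,228,315,53,29,20]),
  ([123,128,124,10368,10468,10358,10458,10478,10378,9258,9358,9458,9268,9368,9468,9478,9378,9278,10348,9248,3348,9238,9348,2348,9234,11478,11468,11458],[],[30,137,91,249]),
  ([123,10368,10468,10358,10458,10478,10378,9258,9358,9458,9268,9368,9468,9478,9378,9278,10348,9248,9238,9348,2348,238,9234,234,11478,11468,11458],[],[10,260,18,1000]),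
  ([],[235,245,123,345],[4,1028,1059,19,1038,1035,5,1044,1025,1026]),
  ([],[467,345],[1004,24,15,39,1005,1042,3,0,1,9,247,197,1025,198,1057,270]),
  ([246,3346,10456,10458,10478,467,457,234,568,678],[346],[12,70,14,115,15,25,16,22,165,272,66,238,158,155,213,242,111,21,309,172,344,68,117,236,101,316,180,332,10,273,320,241,76,107,310,36]),
  ([236,10356,3456,10346,3346,10456],[245,345],[4,1007,0,1,1009,130,1002,81,333,203]),
  ([11478,11578,11678,11468,11568,4568,11458,12578,12678,5568,12568,13678],[348,345],[1008,0,1,168,341,20]),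
  ([3346,10456,10458,10478,568,678],[123,345],[1003,1008,24,1009,0,1011,1002,281,189,307,1004,23,13,1001,275]),
  ([],[235,123,345],[255,1005]),
  ([568,578,678],[],[8,12,14,164,25,22,16,131,132,169,201,215,7,147,151,152,178,57,1009,1013,1011,64,1002,119,214,267,34,209,257,63,86,11,1026,234,235,51,97,282,43,129,259,212,335,46,190,144,220,143,177,230,150,21,138,1007,1000,23,13,248,336,1001]),
  ([178,578,2378,2368,2358,2258,2268,2278,678],[568,148],[8,1059,1031,1068,2,6,1023,239,1016,1055,1062,67,279,1050]),
  ([2378,2389,8138,8128,2289,2278],[178,568,148],[1060,1046,206,1069,2,1031,1067,6,1048,1063,1073,1061,1042,1071]),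
  ([2378,2389,2368,8138,2358,8128,2289,2258,2268,2278,678],[568,148],[1000,1059,1001]),
  ([568,678],[],[1057,1003]),
  ([678],[],[1000,2,11,1048,80,1073,1062,1060,1029,52,1042,1028,1021,1019,1001,72]),
  ([],[8678],[1075]), ([],[7789],[216]), ([],[],[1033])]

theorem certCheck9 : checkCert 10 [true, true, false, false, false, true, true, true, false, true]
    certTable9 certSteps9 = true := by
  decide +kernel

/-- Clauses used for the colour sequence `AABAAABBBA`. -/
def certTable10 : List (List ℕ) := [

  [55789, 145789, 125679, 56789, 140568, 140789, 156789, 144567, 74567, 134567, 145678, 125678, 143567, 132567, 5678, 123467],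
  [140678, 125789, 32457, 153456, 141567, 52457, 145689, 145679, 76789, 134568, 140689, 154567, 140679, 132345, 132346, 132367],
  [152457, 132467, 4567, 42459, 152678, 121457, 23567, 12346, 34689, 136789, 132456, 165789, 152467, 140347, 32678, 165678],
  [205678, 132347, 142389, 153457, 184567, 152456, 66789, 140357, 140456, 132368, 121357, 132356, 152567, 132568, 4678, 54578],
  [22459, 23467, 121679, 154678, 132468, 133567, 62569, 46789, 54679, 54568, 32456, 62589, 141789, 52456, 140157, 62579],
  [144568, 146789, 140147, 12347, 143467, 132457, 140127, 194567, 24678, 72467, 124678, 132357, 12357, 34567, 73678, 134578],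
  [132579, 152378, 142579, 144579, 152789, 120349, 133468, 110379, 21457, 120356, 161357, 120347, 120679, 120134, 121479, 152468],
  [135678, 140379, 21357, 163456, 141347, 34568, 120249, 153458, 141367, 33789, 120136, 120289, 21346, 132589, 120256, 1249],
  [132469, 140346, 132789, 140489, 120236, 140239, 120456, 120124, 110189, 144678, 141249, 120567, 143589, 120258, 140123, 91234],
  [120389, 43457, 122459, 143479, 110489, 120268, 1457, 153478, 120345, 120129, 23456, 121279, 161234, 120358, 33678, 41457],
  [120589, 55689, 120237, 141269, 12468, 1235, 120246, 120578, 140579, 132679, 141589, 140134, 140159, 120568, 72789, 141345],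
  [61467, 123459, 120123, 120259, 132389, 12579, 141289, 120167, 110569, 13568, 121239, 152356, 152679, 120156, 132578, 52679],
  [153468, 144589, 35678, 142479, 124679, 14568, 110479, 120468, 41357, 73456, 12568, 126789, 121379, 14567, 141569, 132479],
  [41367, 140459, 120457, 120479, 120245, 155678, 120678, 73468, 62479, 152358, 63567, 132369, 111389, 152368, 120579, 140567],
  [120467, 140569, 53468, 120379, 132378, 141357, 132478, 140289, 164579, 140389, 14678, 12356, 140479, 142345, 65678, 121234],
  [132379, 43567, 124579, 121237, 36789, 120279, 140129, 120135, 120489, 132569, 132689, 152346, 2359, 140279, 52468, 110169],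
  [140145, 140189, 110369, 110589, 163567, 120257, 120689, 140467, 161579, 52478, 54567, 141349, 143456, 140269, 120247, 33468],
  [164569, 23457, 110179, 141239, 132489, 113579, 43467, 121235, 120147, 110123, 120789, 140457, 120139, 43456, 142469, 183459],
  [132359, 142459, 140578, 121359, 120169, 140369, 152348, 140259, 120378, 120189, 120179, 42345, 144578, 120469, 140169, 141279],
  [144679, 12679, 142567, 142349, 140349, 110469, 33478, 120158, 142589, 153678, 140359, 120367, 143489, 140124, 140469, 41467],
  [140345, 152478, 140135, 120357, 34789, 140179, 121257, 134678, 120269, 143579, 62379, 120459, 154578, 142379, 143569, 142489],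
  [120235, 124569, 141379, 120137, 120267, 120239, 62345, 143459, 121579, 1347, 120146, 143469, 144689, 120478, 152458, 186789],
  [140149, 121259, 123457, 120159, 52678, 12368, 142467, 141389, 140139, 52458, 121459, 120369, 141234, 120346, 120278, 132348],
  [125689, 120569, 142569, 183468, 165689, 1247, 141259, 140367, 120368, 165679, 140249, 161239, 120458, 140125, 123456, 120145],
  [142369, 141579, 133568, 140137, 123567, 41346, 140167, 140589, 132678, 132349, 34578, 62368, 120178, 141369, 120157, 32468],
  [120168, 144789, 142359, 120234, 152689, 154568, 1257, 140234, 120359, 141359, 34678, 144569, 120149, 140356]]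

/-- Refutation for the colour sequence `AABAAABBBA`. -/
def certSteps10 : List (List ℕ × List ℕ × List ℕ) := [
  ([],[1356],[105]), ([],[346,8346],[129]), ([],[1456],[134]), ([],[1345],[152]),
  ([],[1129],[153]), ([],[1589],[160]), ([],[1578],[167]), ([],[8134],[171]), ([],[1568],[173]),
  ([],[4459],[177]), ([],[1123],[178]), ([],[1259],[179]), ([],[1468],[199]), ([],[1245],[212]),
  ([],[1249],[118]), ([],[567,8567],[223]), ([],[1467],[224]),
  ([8479,12567,8567,1459,1149,5679,8579,1379,13789,8467,12569,8569,1457,1479,5579,12589,8457,8789,12789,1159,1359,1579,1247,1157,1257,1145,12579,1179,1147,8459,1357,8589,1349,1347,8469,8489,1279,1679,6679],[],[232]),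
  ([],[1279],[245]), ([],[129,8129],[246]), ([],[1489],[248]), ([],[1257],[261]),
  ([],[467,8467],[263]), ([],[1347],[107]),
  ([8149,1479,8135,2279,2459,1179,8145,1459,13789,8169,8589,8159,8579,1359,2257,8137,8789,2679,9567,1679,8147,2379,2457,1159,9789,8167,1579,1357,8179,8127,2579,9569,2479,2357,1379,8569,8567,6679,1157,2259,8189,8139,2359,8129,1457,8125,8157,9579,9589],[],[264]),
  ([],[9349],[267]), ([],[1247],[270]),
  ([1149,12569,1369,8479,5569,12579,1159,1146,1156,8689,8589,12589,1469,1359,8679,13679,12689,8459,8579,1349,12679,13689,1459,8489,1169,1346,1569,1145,1246,1269,8469,8456,8569,1256],[],[272]),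
  ([],[9239,239],[275]), ([],[1147],[280]), ([123],[],[281]), ([],[8123],[142]), ([124],[],[143]),
  ([125],[],[165]), ([],[2235],[279]), ([129],[],[127]), ([],[2234],[239]), ([],[2239],[186]),
  ([],[8129],[1004]), ([],[1789],[282]),
  ([12589,11589,10469,10369,3345,10569,3459,11479,10489,10579,11489,3349,12579,12569,10379,10349,10459,11569,11579,10589,11469,10359,10389,10479,3359,10345,11459],[],[287]),
  ([],[578,8578],[290]), ([],[2359],[291]), ([],[8259,259],[295]), ([],[1378],[296]),
  ([],[1179],[298]), ([245],[234],[299]), ([],[1469],[301]), ([],[9345],[175]), ([],[8145],[256]),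
  ([],[1258],[141]), ([],[1289],[123]), ([],[10349,249],[307]), ([],[8349],[308]),
  ([],[1135],[247]), ([189],[],[136]), ([489],[],[148]), ([589],[],[259]), ([],[9589],[170]),
  ([389],[],[220]), ([],[8189],[257]), ([],[12589],[193]), ([],[8489],[131]), ([],[11589],[140]),
  ([],[8389],[233]), ([],[8359],[314]), ([],[1367],[315]), ([],[11489],[316]), ([],[8124],[317]),
  ([],[1579],[222]), ([],[8345],[320]), ([379],[],[103]), ([479],[],[198]), ([],[8479],[236]),
  ([179],[],[274]), ([],[8379],[113]), ([579],[],[277]), ([],[12579],[99]), ([],[11479],[147]),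
  ([],[8579],[168]), ([],[8135],[322]), ([],[1357],[323]), ([478,789],[],[324]),
  ([],[8179],[325]), ([],[2257,127],[326]), ([],[8159],[172]), ([],[1269],[328]),
  ([],[11579],[329]), ([279],[239],[330]), ([],[1459],[331]), ([],[10379,279],[333]),
  ([],[1134],[109]), ([],[1124],[135]), ([],[10489,289],[335]), ([],[1235],[336]),
  ([],[1136],[122]), ([],[1167],[183]), ([],[1156],[189]), ([],[9379],[338]), ([],[1137],[339]),
  ([],[1239],[341]), ([245],[235],[342]), ([],[157,2579],[344]), ([137],[147],[345]),
  ([],[1146],[346]), ([],[12689,689],[348]), ([],[1478],[349]), ([569],[],[184]),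
  ([],[1679],[108]), ([169],[],[255]), ([369],[],[258]), ([469],[],[309]), ([],[8469],[318]),
  ([],[9569],[206]), ([],[8569],[225]), ([],[8169],[302]), ([],[8369],[293]), ([],[11569],[334]),
  ([],[11469],[347]), ([],[1158],[311]), ([],[8149],[352]), ([],[2259],[353]),
  ([],[347,4457],[354]), ([],[1159],[355]), ([],[1567],[139]), ([],[9389],[359]),
  ([],[8139],[360]), ([],[2459],[362]), ([],[1369],[363]), ([],[8459],[209]), ([],[11459],[343]),
  ([],[9234,234],[364]), ([],[1346],[365]), ([],[1256],[126]), ([],[1236],[132]),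
  ([],[1268],[149]), ([],[1246],[166]), ([],[1278],[366]), ([],[6689,568],[368]),
  ([],[1569],[369]), ([],[10569,269],[370]),
  ([8578,6689,1389,8679,1458,1358,1168,13689,7789,6789,13679,1368,8568,8589,1689,8678,1169,8689,1189,13678,1359],[],[372]),
  ([127],[147],[373]), ([],[1169],[292]), ([],[1189],[297]), ([],[1139],[284]),
  ([],[9259,259],[374]), ([],[8367,367],[375]), ([],[1368],[376]),
  ([13679,1267,1479,6679,8679,14789,1157,8689,13789,1457,8789,1379,8567,13689,8589,1359],[],[377]),
  ([],[249,8249],[378]),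
  ([8249,10389,9279,8279,8239,9249,8289,10369,9359,9369,8259,9239,10349,9269,8269,10359,10379,9289,9259],[],[379]),
  ([],[1678],[214]), ([],[1689],[262]), ([],[1458],[380]), ([],[8125],[381]),
  ([],[346,4456],[382]), ([],[1145],[383]), ([],[269,10369],[384]), ([],[9579],[385]),
  ([],[8137,137],[387]), ([146],[346],[389]), ([],[167,8167],[390]), ([],[1349],[101]),
  ([],[1379],[227]), ([],[1389],[144]), ([],[8589],[391]), ([],[1358],[157]), ([],[1178],[396]),
  ([],[9369],[397]), ([],[1157],[398]), ([],[1457],[210]), ([],[1479],[211]), ([],[1168],[400]),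
  ([],[789,12789],[401]), ([],[10359,259],[402]), ([],[1237],[162]), ([],[1267],[340]),
  ([],[1234],[403]), ([127],[157],[406]), ([],[234,8234],[407]), ([],[1359],[408]),
  ([],[9359],[409]), ([],[12569],[411]), ([],[1149],[412]), ([],[8356,356],[413]),
  ([789],[7789,14789],[6,24,3,203]), ([],[7789,14789],[1000,81,54,71,41]),
  ([457,12578,456,458,12678,13678,5678,12567,6678,12568],[],[25,9,95,48]),
  ([12567,8467,5679,6679,8567,12789,8789,13789],[457],[283,242,1043]),
  ([578,456,457,5678,12567,6678,12568,678],[],[9,213,63,394,95,25,332,67,48]),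
  ([],[789,14789],[1,5,1009,81,40,161,54,71,4,194,80,1023,72,1046,2,11,196,1043,7,90,1001,34,1000,1038,17,43]),
  ([6678],[567,14789],[1000,6,3,16,0,10,1039,14,1047,4,47]),
  ([],[456,14789],[1001,6,24,28,304,23,1028,22,26,56,337,1043]),
  ([],[568,14789],[1002,6,3,16,24,28,23,0,10,17,1041,22,26,1006,4,1026,1024]),
  ([6678],[14789],[1001,1000,117,73,405,1003,6,3,1038,137,0,300,10,1002,93,266,27,327,1006]),
  ([],[14789],[1004,0,1001,1000,14,112]),
  ([9567,8167,2679,9789,8789,13789,6679,8567],[357],[200,114,150,78,1033,1012,58,204,1017,110,37,82,155,1038,86,1047]),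
  ([245,3567,10456,10467,10567,246,10457,236,247,237,5567,12567],[],[31,33,1042,1035,85,42,49,30,29,91,59,52]),
  ([],[234],[1031,1013,156]), ([],[789,578,568,567],[17,1045,11,1030,4,2,1053,1,5,43]),
  ([678,267,258,238,248,256,257,246,236,237,247,789],[],[190,61,228,57,230,68,13,31,33,3,244,41,191,305,46,356,392,130,181,188,216,1040,174,250,169,249,96,125,128,276,207,219,240,180,100,404,351,36]),
  ([],[678,567,578],[14,11,4,1055,1047,16,10,47]),
  ([267,257,247,246,256,678,789],[],[83,39,121,94,46,164,202,395,1001]),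
  ([],[239,245],[35,79,1042,253,303,75,231,182,50,70,1024,269,163,64,1027,1046,138,1019,1030,1048,1051,133,1026]),
  ([],[245],[35,64,237,70,75,289,79,1020,1047,146,286,1034,1025,50,312,1042,98,195,1043,1000,252,288,393,29,1051]),
  ([],[235],[1041]), ([],[3345],[29]),
  ([246,256,789,457],[467],[21,13,34,53,0,8,1002,9,7,92,91,49,32,18,85,39,30,42,59,33,1001,31,306,358,52]),
  ([789,457],[467],[34,74,77,1000]), ([],[456],[154,56,285,1061,1028,268,1019,115]),
  ([],[256],[77]), ([],[10456],[53]), ([],[246],[74]), ([],[236],[235]), ([],[3346],[30]),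
  ([467,457],[468],[21,13,9,32,92,18,234,410,89,63,1004,44,27,60,1007]),
  ([457],[468],[73,80,1000,8,90,1001,7,11,1007,238,1015]),
  ([],[457],[104,145,159,205,273,93,37,82,1043,1036,176,116,55,218,229,78,45,1041,1062,58,1028,243,1049,86,1026,20,120,12,1034,106]),
  ([],[247],[18]), ([],[257],[21]), ([],[5567],[9]), ([],[468],[1000]), ([],[237],[83]),
  ([],[10457],[32]), ([],[3567],[13]), ([689],[],[40]), ([],[458],[197]), ([],[268],[254]),
  ([],[248],[399]), ([],[8689],[26]), ([],[13689],[22]), ([],[5568],[25]), ([],[258],[361]),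
  ([],[238],[357]), ([],[10468],[111]), ([],[3468],[68]), ([],[3568],[61]), ([],[10458],[350]),
  ([],[3348],[367]), ([],[3368],[57]),
  ([],[368,467],[1002,76,5,1,8,7,2,1062,88,62,215,226,158,310,124,1030,15,12,84,208,1041,66,1026,20,1010,38,69,51,19,87]),
  ([11457,4567,11467,11567,11456,12567],[346,347],[1042,1031,15,87]),
  ([346,356],[467],[1001,185,119,217,386,187,19,62,88,94,151,313,265,97,221,192,36,321,67,251,271,294,102,371]),
  ([356],[467],[1005,76,5,1,8,7,2,1065,19,1000,1030,278,65,319,12,84,66,1029,20,1013,69,51,1001]),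
  ([],[467],[8,1066,1000,201,1025,241,38,388,1067,1034,65,15,12,1038,55,45,1045,260]),
  ([679],[],[72]), ([],[267],[89]), ([],[13679],[23]), ([],[8679],[28]), ([],[10467],[44]),
  ([],[789,567],[2,1066,1,5,1037]), ([],[567],[1000,0,1010,1011]), ([],[12567],[27]),
  ([],[10567],[60]), ([],[],[1014])]

theorem certCheck10 : checkCert 10 [true, true, false, true, true, true, false, false, false, true]
    certTable10 certSteps10 = true := by
  decide +kernel


/-! ### The combinatorial core -/

theorem Cfg.congr {n : ℕ} {col col' : ℕ → Bool} {o : ℕ → ℕ → ℕ → Bool} (hc : Cfg n col o)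
    (h : ∀ i < n, col i = col' i) : Cfg n col' o where
  z := hc.z
  cA i j k hij hjk hk h1 h2 h3 := hc.cA i j k hij hjk hk (by rw [h i (by omega)]; exact h1)
    (by rw [h j (by omega)]; exact h2) (by rw [h k (by omega)]; exact h3)
  sig := hc.sig
  sepJ i j k l hij hjk hkl hl h1 h2 h3 h4 := hc.sepJ i j k l hij hjk hkl hl
    (by rw [h i (by omega)]; exact h1) (by rw [h j (by omega)]; exact h2)
    (by rw [h k (by omega)]; exact h3) (by rw [h l (by omega)]; exact h4)
  sepK i j k l hij hjk hkl hl h1 h2 h3 h4 := hc.sepK i j k l hij hjk hkl hl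
    (by rw [h i (by omega)]; exact h1) (by rw [h j (by omega)]; exact h2)
    (by rw [h k (by omega)]; exact h3) (by rw [h l (by omega)]; exact h4)
  nohole a b c d e hab hbc hcd hde he h1 h2 := by
    rw [← h a (by omega), ← h b (by omega), ← h c (by omega), ← h d (by omega),
      ← h e (by omega)] at h1 h2
    exact hc.nohole a b c d e hab hbc hcd hde he h1 h2

/-- Deleting the second or the last point of a configuration. -/
theorem Cfg.reindex {n m : ℕ} {col : ℕ → Bool} {o : ℕ → ℕ → ℕ → Bool} (hc : Cfg n col o)
    (e : ℕ → ℕ) (he : StrictMono e) (he0 : e 0 = 0) (hem : ∀ i < m, e i < n)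
    (hx : ∀ x < n, x = 1 ∨ x = n - 1 ∨ ∃ y < m, e y = x) :
    Cfg m (fun i => col (e i)) (fun i j k => o (e i) (e j) (e k)) where
  z j k hj hjk hk := by
    have h := he hj
    rw [he0] at h
    have := hc.z (e j) (e k) h (he hjk) (hem k hk)
    simpa [he0] using this
  cA i j k hij hjk hk h1 h2 h3 := hc.cA _ _ _ (he hij) (he hjk) (hem k hk) h1 h2 h3
  sig i j k l hi hij hjk hkl hl := by
    have h := he hi
    rw [he0] at h
    exact hc.sig _ _ _ _ h (he hij) (he hjk) (he hkl) (hem l hl)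
  sepJ i j k l hij hjk hkl hl h1 h2 h3 h4 :=
    hc.sepJ _ _ _ _ (he hij) (he hjk) (he hkl) (hem l hl) h1 h2 h3 h4
  sepK i j k l hij hjk hkl hl h1 h2 h3 h4 :=
    hc.sepK _ _ _ _ (he hij) (he hjk) (he hkl) (hem l hl) h1 h2 h3 h4
  nohole a b c d f hab hbc hcd hde hf h1 h2 := by
    obtain ⟨t, ht, x, hxn, h⟩ := hc.nohole _ _ _ _ _ (he hab) (he hbc) (he hcd) (he hde)
      (hem f hf) h1 h2
    have hmap : triplesOf (e a) (e b) (e c) (e d) (e f) =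
        (triplesOf a b c d f).map fun t => (e t.1, e t.2.1, e t.2.2) := rfl
    rw [hmap, List.mem_map] at ht
    obtain ⟨s, hs, rfl⟩ := ht
    obtain ⟨b1, b2, b3⟩ := triplesOf_bound hab hbc hcd hde s hs
    have b4 : e s.2.2 < n := hem _ (by omega)
    have b5 := he b1
    have b6 := he b2
    refine ⟨s, hs, ?_⟩
    dsimp only at h
    have hy : ∃ y < m, e y = x := by
      rcases hx x hxn with h3 | h3 | h3
      · exfalso
        rcases h with ⟨h4, h5, h6⟩ | ⟨h4, h5, h6⟩
        · have h7 : e s.1 = 0 := by omega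
          rw [h7, hc.z x _ (by omega) h5 (by omega), hc.z x _ (by omega) (by omega) b4] at h6
          exact h6 rfl
        · omega
      · exfalso
        rcases h with ⟨h4, h5, h6⟩ | ⟨h4, h5, h6⟩ <;> omega
      · exact h3
    obtain ⟨y, hy, rfl⟩ := hy
    refine ⟨y, hy, ?_⟩
    simpa only [he.lt_iff_lt] using h

theorem no_cfg_nine {col : ℕ → Bool} {o : ℕ → ℕ → ℕ → Bool} (hc : Cfg 9 col o)
    (h0 : col 0 = true) (h1 : col 1 = true) (h8 : col 8 = true)
    (hcard : ((Finset.range 9).filter (fun i => col i = false)).card = 4)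
    (hB : ∃ i, i + 2 < 9 ∧ col i = false ∧ col (i + 1) = false ∧ col (i + 2) = false) : False := by
  have key : ∀ L : List Bool, Cfg 9 (fun i => L.getD i false) o →
      L ≠ [true, true, true, true, false, false, false, false, true] ∧
      L ≠ [true, true, true, false, true, false, false, false, true] ∧
      L ≠ [true, true, true, false, false, false, true, false, true] ∧
      L ≠ [true, true, true, false, false, false, false, true, true] ∧
      L ≠ [true, true, false, true, true, false, false, false, true] ∧
      L ≠ [true, true, false, true, false, false, false, true, true] ∧
      L ≠ [true, true, false, false, false, true, true, false, true] ∧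
      L ≠ [true, true, false, false, false, true, false, true, true] ∧
      L ≠ [true, true, false, false, false, false, true, true, true] := by
    intro L hL
    refine ⟨?_, ?_, ?_, ?_, ?_, ?_, ?_, ?_, ?_⟩ <;> rintro rfl
    · exact checkCert_sound certCheck0 o hL
    · exact checkCert_sound certCheck1 o hL
    · exact checkCert_sound certCheck2 o hL
    · exact checkCert_sound certCheck3 o hL
    · exact checkCert_sound certCheck4 o hL
    · exact checkCert_sound certCheck5 o hL
    · exact checkCert_sound certCheck6 o hL
    · exact checkCert_sound certCheck7 o hL
    · exact checkCert_sound certCheck8 o hL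
  have hk := key [true, true, col 2, col 3, col 4, col 5, col 6, col 7, true] (hc.congr (by
    intro i hi
    interval_cases i <;> simp [h0, h1, h8]))
  have hB' : (col 2 = false ∧ col 3 = false ∧ col 4 = false) ∨
      (col 3 = false ∧ col 4 = false ∧ col 5 = false) ∨
      (col 4 = false ∧ col 5 = false ∧ col 6 = false) ∨
      (col 5 = false ∧ col 6 = false ∧ col 7 = false) := by
    obtain ⟨i, hi, g1, g2, g3⟩ := hB
    have : i < 7 := by omega
    interval_cases i <;> simp_all
  rw [Finset.card_filter] at hcard
  simp only [Finset.sum_range_succ, Finset.sum_range_zero, h0, h1, h8] at hcard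
  clear key hc hB h0 h1 h8
  revert hk hB' hcard
  generalize col 2 = c2, col 3 = c3, col 4 = c4, col 5 = c5, col 6 = c6, col 7 = c7
  cases c2 <;> cases c3 <;> cases c4 <;> cases c5 <;> cases c6 <;> cases c7 <;> simp

theorem no_cfg_ten {col : ℕ → Bool} {o : ℕ → ℕ → ℕ → Bool} (hc : Cfg 10 col o)
    (h0 : col 0 = true) (h1 : col 1 = true) (h9 : col 9 = true)
    (hcard : ((Finset.range 10).filter (fun i => col i = false)).card = 4)
    (hB : ∃ i, i + 2 < 10 ∧ col i = false ∧ col (i + 1) = false ∧ col (i + 2) = false) : False := by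
  rw [Finset.card_filter] at hcard
  simp only [Finset.sum_range_succ, Finset.sum_range_zero, h0, h1, h9] at hcard
  obtain ⟨i, hi, g1, g2, g3⟩ := hB
  have hi8 : i < 8 := by omega
  cases h2 : col 2
  · cases h8 : col 8
    · have key : ∀ L : List Bool, Cfg 10 (fun i => L.getD i false) o →
          L ≠ [true, true, false, false, false, true, true, true, false, true] ∧
          L ≠ [true, true, false, true, true, true, false, false, false, true] := by
        intro L hL
        refine ⟨?_, ?_⟩ <;> rintro rfl
        · exact checkCert_sound certCheck9 o hL
        · exact checkCert_sound certCheck10 o hL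
      have hk := key [true, true, false, col 3, col 4, col 5, col 6, col 7, false, true]
        (hc.congr (by
          intro i hi
          interval_cases i <;> simp [h0, h1, h2, h8, h9]))
      have hB' : (col 3 = false ∧ col 4 = false) ∨
          (col 3 = false ∧ col 4 = false ∧ col 5 = false) ∨
          (col 4 = false ∧ col 5 = false ∧ col 6 = false) ∨
          (col 5 = false ∧ col 6 = false ∧ col 7 = false) ∨
          (col 6 = false ∧ col 7 = false) := by
        interval_cases i <;> simp_all
      rw [h2, h8] at hcard
      clear key hc h0 h1 h9 h2 h8 hi hi8 g1 g2 g3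
      revert hk hB' hcard
      generalize col 3 = c3, col 4 = c4, col 5 = c5, col 6 = c6, col 7 = c7
      revert c3 c4 c5 c6 c7
      decide
    · have hc' := hc.reindex (m := 9) id strictMono_id rfl (by intro i hi; simp only [id]; omega)
        (by
          intro x hx
          by_cases h : x = 9
          · exact Or.inr (Or.inl (by omega))
          · exact Or.inr (Or.inr ⟨x, by omega, rfl⟩))
      refine no_cfg_nine hc' h0 h1 h8 ?_ ⟨i, ?_, g1, g2, g3⟩
      · rw [Finset.card_filter]
        simp only [Finset.sum_range_succ, Finset.sum_range_zero, id, h0, h1]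
        simpa using hcard
      · rcases Nat.lt_or_ge i 7 with h | h
        · omega
        · have : i = 7 := by omega
          subst this
          simp [h8] at g2
  · have hmono : StrictMono (fun i : ℕ => if i = 0 then 0 else i + 1) := by
      intro x y hxy
      dsimp only
      split_ifs <;> omega
    have hc' := hc.reindex (m := 9) _ hmono rfl
      (by intro i hi; split_ifs <;> omega)
      (by
        intro x hx
        by_cases h : x = 1
        · exact Or.inl h
        · right; right
          by_cases h' : x = 0
          · exact ⟨0, by omega, by simp [h']⟩
          · refine ⟨x - 1, by omega, ?_⟩
            rw [if_neg (by omega)]; omega)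
    refine no_cfg_nine hc' h0 h2 h9 ?_ ?_
    · rw [Finset.card_filter]
      simp only [Finset.sum_range_succ, Finset.sum_range_zero]
      simpa [h0, h2, h9] using hcard
    · have : i ≠ 0 := by rintro rfl; simp [h0] at g1
      have : i ≠ 1 := by rintro rfl; simp [h1] at g1
      refine ⟨i - 1, by omega, ?_⟩
      have e1 : i - 1 ≠ 0 := by omega
      have e2 : i - 1 + 1 = i := by omega
      have e3 : i - 1 + 2 = i + 1 := by omega
      rw [if_neg e1, e2, e3, if_neg (by omega), if_neg (by omega)]
      exact ⟨g1, g2, g3⟩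

/-! ### From the point set to the combinatorial configuration -/

/-- Orientation of a triple of points. -/
def orient (p q r : Pt) : ℝ := cross2 (q - p) (r - p)

theorem orient_def (p q r : Pt) :
    orient p q r = (q.1 - p.1) * (r.2 - p.2) - (q.2 - p.2) * (r.1 - p.1) := by
  simp [orient, cross2]

theorem orient_ne {P : Set Pt} (h : GenPos P) {p q r : Pt} (hp : p ∈ P) (hq : q ∈ P) (hr : r ∈ P)
    (hpq : p ≠ q) (hpr : p ≠ r) (hqr : q ≠ r) : orient p q r ≠ 0 := by
  intro h0
  apply h p hp q hq r hr hpq hpr hqr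
  rw [orient_def] at h0
  set N := (q.1 - p.1) ^ 2 + (q.2 - p.2) ^ 2 with hN
  have hN0 : N ≠ 0 := by
    intro h1
    apply hpq
    have h2 : q.1 - p.1 = 0 := by nlinarith [sq_nonneg (q.1 - p.1), sq_nonneg (q.2 - p.2)]
    have h3 : q.2 - p.2 = 0 := by nlinarith [sq_nonneg (q.1 - p.1), sq_nonneg (q.2 - p.2)]
    ext <;> linarith
  rw [collinear_iff_of_mem (p₀ := p) (by simp)]
  refine ⟨q - p, ?_⟩
  intro y hy
  simp only [Set.mem_insert_iff, Set.mem_singleton_iff] at hy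
  rcases hy with rfl | rfl | rfl
  · exact ⟨0, by simp⟩
  · exact ⟨1, by simp⟩
  · refine ⟨((y.1 - p.1) * (q.1 - p.1) + (y.2 - p.2) * (q.2 - p.2)) / N, ?_⟩
    ext
    · simp only [vadd_eq_add, Prod.fst_add, Prod.smul_fst, Prod.fst_sub, smul_eq_mul]
      field_simp
      rw [hN]
      linear_combination (-(q.2 - p.2)) * h0
    · simp only [vadd_eq_add, Prod.snd_add, Prod.smul_snd, Prod.snd_sub, smul_eq_mul]
      field_simp
      rw [hN]
      linear_combination (q.1 - p.1) * h0

theorem orient_comb {X P Q R : Pt} {α β γ : ℝ} (hs : α + β + γ = 1)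
    (hX : X = α • P + β • Q + γ • R) (U V : Pt) :
    orient U V X = α * orient U V P + β * orient U V Q + γ * orient U V R := by
  have h1 : α = 1 - β - γ := by linarith
  subst hX h1
  simp only [orient_def, Prod.fst_add, Prod.snd_add, Prod.smul_fst, Prod.smul_snd, smul_eq_mul]
  ring

theorem orient_swap (p q r : Pt) : orient p r q = - orient p q r := by
  simp only [orient_def]; ring

theorem orient_rot (p q r : Pt) : orient q r p = orient p q r := by
  simp only [orient_def]; ring

theorem orient_self (p q : Pt) : orient p q q = 0 := by
  simp only [orient_def]; ring

theorem orient_self_left (p q : Pt) : orient p q p = 0 := by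
  simp only [orient_def]; ring

theorem orient_self_mid (p q : Pt) : orient p p q = 0 := by
  simp only [orient_def]; ring

/-- A point which sees the three sides of a triangle with positive orientation is inside. -/
theorem mem_triangle {U V W X : Pt} (h1 : 0 ≤ orient X V W) (h2 : 0 ≤ orient U X W)
    (h3 : 0 ≤ orient U V X) (hD : 0 < orient U V W) : X ∈ convexHull ℝ ({U, V, W} : Set Pt) := by
  have hs : orient X V W + orient U X W + orient U V X = orient U V W := by
    simp only [orient_def]; ring
  have hU : U ∈ convexHull ℝ ({U, V, W} : Set Pt) := subset_convexHull ℝ _ (by simp)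
  have hV : V ∈ convexHull ℝ ({U, V, W} : Set Pt) := subset_convexHull ℝ _ (by simp)
  have hW : W ∈ convexHull ℝ ({U, V, W} : Set Pt) := subset_convexHull ℝ _ (by simp)
  have hc := convex_convexHull ℝ ({U, V, W} : Set Pt)
  have hX : X = (orient X V W / orient U V W) • U + (orient U X W / orient U V W) • V
      + (orient U V X / orient U V W) • W := by
    have hD' := hD.ne'
    ext
    · simp only [Prod.fst_add, Prod.smul_fst, smul_eq_mul]
      field_simp
      simp only [orient_def]; ring
    · simp only [Prod.snd_add, Prod.smul_snd, smul_eq_mul]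
      field_simp
      simp only [orient_def]; ring
  rw [hX]
  have := hc.sum_mem (t := (Finset.univ : Finset (Fin 3)))
    (w := ![orient X V W / orient U V W, orient U X W / orient U V W, orient U V X / orient U V W])
    (z := ![U, V, W]) (by
      intro i _
      fin_cases i <;> simp <;> positivity) (by
      simp [Fin.sum_univ_three]
      rw [← add_div, ← add_div, hs, div_self hD.ne']) (by
      intro i _
      fin_cases i <;> simp [hU, hV, hW])
  simpa [Fin.sum_univ_three] using this

/-- Barycentric coordinates in a triangle. -/
theorem triangle_weights {P Q R X : Pt} (h : X ∈ convexHull ℝ ({P, Q, R} : Set Pt)) :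
    ∃ α β γ : ℝ, 0 ≤ α ∧ 0 ≤ β ∧ 0 ≤ γ ∧ α + β + γ = 1 ∧ X = α • P + β • Q + γ • R := by
  rw [convexHull_insert (by simp), convexHull_pair] at h
  rw [mem_convexJoin] at h
  obtain ⟨y, hy, z, hz, hX⟩ := h
  rw [Set.mem_singleton_iff] at hy
  subst hy
  obtain ⟨s, t, hs, ht, hst, rfl⟩ := hz
  obtain ⟨s', t', hs', ht', hst', rfl⟩ := hX
  refine ⟨s', t' * s, t' * t, hs', by positivity, by positivity, ?_, ?_⟩
  · rw [add_assoc, ← mul_add, hst, mul_one, hst']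
  · rw [smul_add, smul_smul, smul_smul, add_assoc]

theorem sep_triangle {v : Pt} {c : ℝ} {U V W X : Pt} (hU : dotp v U < c) (hV : dotp v V < c)
    (hW : dotp v W < c) (hX : c < dotp v X) (h1 : 0 ≤ orient X V W) (h2 : 0 ≤ orient U X W)
    (h3 : 0 ≤ orient U V X) (hD : 0 < orient U V W) : False := by
  have e1 : orient X V W * dotp v U + orient U X W * dotp v V + orient U V X * dotp v W
      = orient U V W * dotp v X := by
    simp only [orient_def, dotp]; ring
  have hs : orient X V W + orient U X W + orient U V X = orient U V W := by
    simp only [orient_def]; ring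
  have i1 := mul_le_mul_of_nonneg_left hU.le h1
  have i2 := mul_le_mul_of_nonneg_left hV.le h2
  have i3 := mul_le_mul_of_nonneg_left hW.le h3
  have i4 := mul_lt_mul_of_pos_left hX hD
  have e2 : orient X V W * c + orient U X W * c + orient U V X * c = orient U V W * c := by
    rw [← hs]; ring
  linarith

/-- Carathéodory: a point in the hull of a set of at least three points of the plane is in the hull
of three of them. -/
theorem caratheodory_three {S : Finset Pt} (hS : 3 ≤ S.card) {X : Pt}
    (hX : X ∈ convexHull ℝ (↑S : Set Pt)) :
    ∃ T ⊆ S, T.card = 3 ∧ X ∈ convexHull ℝ (↑T : Set Pt) := by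
  rw [convexHull_eq_union] at hX
  simp only [Set.mem_iUnion] at hX
  obtain ⟨t, ht, hai, hXt⟩ := hX
  have hcard : t.card ≤ 3 := by
    have h1 := hai.card_le_finrank_succ.trans (Nat.succ_le_succ (Submodule.finrank_le _))
    have h3 : Module.finrank ℝ Pt = 2 := by simp [Pt, Module.finrank_prod]
    rw [Fintype.card_coe, h3] at h1
    exact h1
  obtain ⟨T, h1, h2, h3⟩ := Finset.exists_subsuperset_card_eq (Finset.coe_subset.1 ht) hcard hS
  exact ⟨T, h2, h3, convexHull_mono (Finset.coe_subset.2 h1) hXt⟩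

theorem sorted_three {I : Finset ℕ} (h : I.card = 3) :
    ∃ p q r, p < q ∧ q < r ∧ I = {p, q, r} := by
  obtain ⟨x, y, z, hxy, hxz, hyz, rfl⟩ := Finset.card_eq_three.1 h
  rcases lt_or_gt_of_ne hxy with h1 | h1 <;> rcases lt_or_gt_of_ne hxz with h2 | h2 <;>
    rcases lt_or_gt_of_ne hyz with h3 | h3
  · exact ⟨x, y, z, h1, h3, rfl⟩
  · exact ⟨x, z, y, h2, h3, by ext; simp; tauto⟩
  · omega
  · exact ⟨z, x, y, h2, h1, by ext; simp; tauto⟩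
  · exact ⟨y, x, z, h1, h2, by ext; simp; tauto⟩
  · omega
  · exact ⟨y, z, x, h3, h2, by ext; simp; tauto⟩
  · exact ⟨z, y, x, h3, h1, by ext; simp; tauto⟩

theorem triple_mem_triplesOf {a b c d e p q r : ℕ} (hab : a < b) (hbc : b < c) (hcd : c < d)
    (hde : d < e) (hpq : p < q) (hqr : q < r)
    (hp : p = a ∨ p = b ∨ p = c ∨ p = d ∨ p = e)
    (hq : q = a ∨ q = b ∨ q = c ∨ q = d ∨ q = e)
    (hr : r = a ∨ r = b ∨ r = c ∨ r = d ∨ r = e) : (p, q, r) ∈ triplesOf a b c d e := by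
  rcases hp with rfl | rfl | rfl | rfl | rfl <;> rcases hq with rfl | rfl | rfl | rfl | rfl <;>
    first
    | omega
    | (rcases hr with rfl | rfl | rfl | rfl | rfl <;> first | omega | simp [triplesOf])

/-- The points of `A ∪ B`, sorted by angle around a point `x 0` of `A`. -/
structure Sorted (A B : Finset Pt) (n : ℕ) (x : ℕ → Pt) : Prop where
  mem : ∀ i < n, x i ∈ A ∪ B
  inj : ∀ i < n, ∀ j < n, x i = x j → i = j
  surj : ∀ p ∈ A ∪ B, ∃ i < n, x i = p
  zero : x 0 ∈ A
  pos : ∀ j k, 0 < j → j < k → k < n → 0 < orient (x 0) (x j) (x k)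

/-- A point inside a triangle is angularly between its vertices. -/
theorem Sorted.inside {A B : Finset Pt} {n : ℕ} {x : ℕ → Pt} (hs : Sorted A B n x)
    (hgen : GenPos (↑(A ∪ B) : Set Pt)) {p q r m : ℕ} (hpq : p < q) (hqr : q < r) (hr : r < n)
    (hm : m < n) (hmp : m ≠ p) (hmq : m ≠ q) (hmr : m ≠ r)
    (h : x m ∈ convexHull ℝ ({x p, x q, x r} : Set Pt)) :
    (p < m ∧ m < q ∧
      decide (0 < orient (x p) (x m) (x q)) ≠ decide (0 < orient (x p) (x m) (x r))) ∨
    (q < m ∧ m < r ∧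
      decide (0 < orient (x p) (x m) (x r)) ≠ decide (0 < orient (x q) (x m) (x r))) := by
  obtain ⟨α, β, γ, hα, hβ, hγ, hsum, hX⟩ := triangle_weights h
  have hne : ∀ i < n, ∀ j < n, ∀ k < n, i ≠ j → i ≠ k → j ≠ k → orient (x i) (x j) (x k) ≠ 0 := by
    intro i hi j hj k hk hij hik hjk
    exact orient_ne hgen (hs.mem i hi) (hs.mem j hj) (hs.mem k hk)
      (fun h => hij (hs.inj i hi j hj h)) (fun h => hik (hs.inj i hi k hk h))
      (fun h => hjk (hs.inj j hj k hk h))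
  have hneg : ∀ j k, 0 < k → k < j → j < n → orient (x 0) (x j) (x k) < 0 := by
    intro j k hk hkj hj
    rw [orient_swap]
    linarith [hs.pos k j hk hkj hj]
  have hmid : p < m ∧ m < r := by
    by_contra hcon
    rcases Nat.eq_zero_or_pos m with rfl | hm0
    · have e := orient_comb hsum hX (x 0) (x p)
      rw [orient_self_left, orient_self] at e
      have p1 := hs.pos p q (by omega) hpq (by omega)
      have p2 := hs.pos p r (by omega) (by omega) hr
      have hβ0 : β = 0 := by nlinarith [mul_nonneg hβ p1.le, mul_nonneg hγ p2.le]
      have hγ0 : γ = 0 := by nlinarith [mul_nonneg hβ p1.le, mul_nonneg hγ p2.le]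
      have hα1 : α = 1 := by linarith
      rw [hβ0, hγ0, hα1] at hX
      simp at hX
      exact hmp (hs.inj _ hm _ (by omega) hX)
    · have e := orient_comb hsum hX (x 0) (x m)
      rw [orient_self] at e
      rcases Nat.lt_or_ge m r with h1 | h1
      · have h2 : m < p := by omega
        have p1 := hs.pos m p hm0 h2 (by omega)
        have p2 := hs.pos m q hm0 (by omega) (by omega)
        have p3 := hs.pos m r hm0 (by omega) (by omega)
        have hα0 : α = 0 := by
          nlinarith [mul_nonneg hα p1.le, mul_nonneg hβ p2.le, mul_nonneg hγ p3.le]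
        have hβ0 : β = 0 := by
          nlinarith [mul_nonneg hα p1.le, mul_nonneg hβ p2.le, mul_nonneg hγ p3.le]
        have hγ0 : γ = 0 := by
          nlinarith [mul_nonneg hα p1.le, mul_nonneg hβ p2.le, mul_nonneg hγ p3.le]
        linarith
      · have p2 := hneg m q (by omega) (by omega) hm
        have p3 := hneg m r (by omega) (by omega) hm
        have p1 : orient (x 0) (x m) (x p) ≤ 0 := by
          rcases Nat.eq_zero_or_pos p with rfl | hp
          · rw [orient_self_left]
          · exact (hneg m p hp (by omega) hm).le
        have q1 : α * orient (x 0) (x m) (x p) ≤ 0 := mul_nonpos_of_nonneg_of_nonpos hα p1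
        have q2 : β * orient (x 0) (x m) (x q) ≤ 0 := mul_nonpos_of_nonneg_of_nonpos hβ p2.le
        have q3 : γ * orient (x 0) (x m) (x r) ≤ 0 := mul_nonpos_of_nonneg_of_nonpos hγ p3.le
        have hβ0 : β = 0 := by
          have : β * orient (x 0) (x m) (x q) = 0 := by linarith
          exact (mul_eq_zero.1 this).resolve_right p2.ne
        have hγ0 : γ = 0 := by
          have : γ * orient (x 0) (x m) (x r) = 0 := by linarith
          exact (mul_eq_zero.1 this).resolve_right p3.ne
        have hα1 : α = 1 := by linarith
        rw [hβ0, hγ0, hα1] at hX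
        simp at hX
        exact hmp (hs.inj _ hm _ (by omega) hX)
  have hD := hne p (by omega) q (by omega) r hr (by omega) (by omega) (by omega)
  -- orientations of the inner point with the sides
  have ePR : orient (x p) (x m) (x r) = β * orient (x p) (x q) (x r) := by
    have e := orient_comb hsum hX (x r) (x p)
    rw [orient_rot, orient_rot] at e
    rw [orient_self_left, orient_self] at e
    rw [e, orient_rot (x r) (x p) (x q)]; ring
  have ePQ : orient (x p) (x m) (x q) = - (γ * orient (x p) (x q) (x r)) := by
    have e := orient_comb hsum hX (x p) (x q)
    rw [orient_self_left, orient_self] at e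
    rw [orient_swap, e]; ring
  have eQR : orient (x q) (x m) (x r) = - (α * orient (x p) (x q) (x r)) := by
    have e := orient_comb hsum hX (x q) (x r)
    rw [orient_self_left, orient_self] at e
    rw [orient_swap, e, ← orient_rot (x p) (x q) (x r)]; ring
  have nPR := hne p (by omega) m hm r hr (by omega) (by omega) (by omega)
  have fin : ∀ s t D X Y : ℝ, 0 ≤ s → 0 ≤ t → X ≠ 0 → Y ≠ 0 → X = s * D → Y = -(t * D) →
      decide (0 < X) ≠ decide (0 < Y) := by
    intro s t D X Y hs ht hX hY h1 h2 h3
    rw [decide_eq_decide] at h3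
    rcases lt_trichotomy D 0 with h4 | h4 | h4
    · have : X ≤ 0 := by rw [h1]; exact mul_nonpos_of_nonneg_of_nonpos hs h4.le
      have : 0 ≤ Y := by rw [h2]; linarith [mul_nonpos_of_nonneg_of_nonpos ht h4.le]
      have h5 : 0 < Y := lt_of_le_of_ne this (Ne.symm hY)
      have := h3.2 h5
      linarith
    · rw [h4] at h1; simp at h1; exact hX h1
    · have h6 : 0 ≤ X := by rw [h1]; exact mul_nonneg hs h4.le
      have : Y ≤ 0 := by rw [h2]; linarith [mul_nonneg ht h4.le]
      have h5 : 0 < X := lt_of_le_of_ne h6 (Ne.symm hX)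
      have := h3.1 h5
      linarith
  rcases lt_or_gt_of_ne hmq with h1 | h1
  · left
    refine ⟨hmid.1, h1, ?_⟩
    have nPQ := hne p (by omega) m hm q (by omega) (by omega) (by omega) (by omega)
    exact (fin β γ _ _ _ hβ hγ nPR nPQ ePR ePQ).symm
  · right
    refine ⟨h1, hmid.2, ?_⟩
    have nQR := hne q (by omega) m hm r (by omega) (by omega) (by omega) (by omega)
    exact fin β α _ _ _ hβ hα nPR nQR ePR eQR

theorem Sorted.cfg {v : Pt} {c : ℝ} {A B : Finset Pt} {n : ℕ} {x : ℕ → Pt} (hs : Sorted A B n x)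
    (hA : ∀ p ∈ A, dotp v p < c) (hB : ∀ p ∈ B, c < dotp v p)
    (hgen : GenPos (↑(A ∪ B) : Set Pt))
    (hnh : ¬ ∃ H : Finset Pt, DividedFiveHole A B H)
    (hAconv : ConvexPos (↑A : Set Pt)) :
    Cfg n (fun i => decide (x i ∈ A)) (fun i j k => decide (0 < orient (x i) (x j) (x k))) := by
  have hne : ∀ i j k, i < j → j < k → k < n → orient (x i) (x j) (x k) ≠ 0 := by
    intro i j k hij hjk hk
    refine orient_ne hgen (hs.mem i (by omega)) (hs.mem j (by omega)) (hs.mem k hk)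
      (fun h => ?_) (fun h => ?_) (fun h => ?_)
    · have := hs.inj i (by omega) j (by omega) h; omega
    · have := hs.inj i (by omega) k (by omega) h; omega
    · have := hs.inj j (by omega) k (by omega) h; omega
  have hcol : ∀ i < n, x i ∉ A → x i ∈ B := by
    intro i hi h
    exact (Finset.mem_union.1 (hs.mem i hi)).resolve_left h
  have hz : ∀ j k, 0 < j → j < k → k < n → decide (0 < orient (x 0) (x j) (x k)) = true := by
    intro j k hj hjk hk
    exact decide_eq_true (hs.pos j k hj hjk hk)
  have hcA : ∀ i j k, i < j → j < k → k < n → x i ∈ A → x j ∈ A → x k ∈ A →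
      0 < orient (x i) (x j) (x k) := by
    intro i j k hij hjk hk h1 h2 h3
    rcases Nat.eq_zero_or_pos i with rfl | hi
    · exact hs.pos j k hij hjk hk
    · by_contra hcon
      have hmem : x j ∈ convexHull ℝ ({x 0, x i, x k} : Set Pt) := by
        apply mem_triangle
        · rw [← orient_rot (x j) (x i) (x k), orient_swap]; linarith
        · exact (hs.pos j k (by omega) hjk hk).le
        · exact (hs.pos i j hi hij (by omega)).le
        · exact hs.pos i k hi (by omega) hk
      refine hAconv (x j) h2 (convexHull_mono ?_ hmem)
      intro y hy
      simp only [Set.mem_insert_iff, Set.mem_singleton_iff] at hy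
      rcases hy with rfl | rfl | rfl
      · refine ⟨hs.zero, fun h => ?_⟩
        have := hs.inj 0 (by omega) j (by omega) h; omega
      · refine ⟨h1, fun h => ?_⟩
        have := hs.inj i (by omega) j (by omega) h; omega
      · refine ⟨h3, fun h => ?_⟩
        have := hs.inj k (by omega) j (by omega) h; omega
  have hsig : ∀ i j k l, 0 < i → i < j → j < k → k < l → l < n →
      (∃ s t u : ℝ, 0 < s ∧ 0 < t ∧ 0 < u ∧ t * orient (x i) (x j) (x l) =
        s * orient (x i) (x j) (x k) + u * orient (x i) (x k) (x l)) ∧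
      (∃ s t u : ℝ, 0 < s ∧ 0 < t ∧ 0 < u ∧ t * orient (x i) (x j) (x l) =
        s * orient (x i) (x j) (x k) + u * orient (x j) (x k) (x l)) ∧
      (∃ s t u : ℝ, 0 < s ∧ 0 < t ∧ 0 < u ∧ t * orient (x i) (x k) (x l) =
        s * orient (x i) (x j) (x k) + u * orient (x j) (x k) (x l)) ∧
      (∃ s t u : ℝ, 0 < s ∧ 0 < t ∧ 0 < u ∧ t * orient (x i) (x k) (x l) =
        s * orient (x i) (x j) (x l) + u * orient (x j) (x k) (x l)) := by
    intro i j k l hi hij hjk hkl hl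
    have pij := hs.pos i j hi hij (by omega)
    have pik := hs.pos i k hi (by omega) (by omega)
    have pil := hs.pos i l hi (by omega) (by omega)
    have pjk := hs.pos j k (by omega) (by omega) (by omega)
    have pjl := hs.pos j l (by omega) (by omega) (by omega)
    have pkl := hs.pos k l (by omega) (by omega) (by omega)
    refine ⟨⟨_, _, _, pil, pik, pij, ?_⟩, ⟨_, _, _, pjl, pjk, pij, ?_⟩, ⟨_, _, _, pkl, pjk, pik, ?_⟩,
      ⟨_, _, _, pkl, pjl, pil, ?_⟩⟩ <;> simp only [orient_def] <;> ring
  have hpat : ∀ X Y Z : ℝ, (∃ s t u : ℝ, 0 < s ∧ 0 < t ∧ 0 < u ∧ t * Y = s * X + u * Z) →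
      ¬ (decide (0 < X) = true ∧ decide (0 < Y) = false ∧ decide (0 < Z) = true) ∧
      ¬ (decide (0 < X) = false ∧ decide (0 < Y) = true ∧ decide (0 < Z) = false) := by
    rintro X Y Z ⟨s, t, u, hs, ht, hu, h⟩
    simp only [decide_eq_true_eq, decide_eq_false_iff_not, not_lt]
    constructor
    · rintro ⟨h1, h2, h3⟩
      have := mul_pos hs h1
      have := mul_pos hu h3
      have := mul_nonpos_of_nonneg_of_nonpos ht.le h2
      linarith
    · rintro ⟨h1, h2, h3⟩
      have := mul_nonpos_of_nonneg_of_nonpos hs.le h1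
      have := mul_nonpos_of_nonneg_of_nonpos hu.le h3
      have := mul_pos ht h2
      linarith
  have hsig' : ∀ i j k l, 0 < i → i < j → j < k → k < l → l < n → _ :=
    fun i j k l hi hij hjk hkl hl =>
      let ⟨s1, s2, s3, s4⟩ := hsig i j k l hi hij hjk hkl hl
      And.intro (hpat _ _ _ s1) (And.intro (hpat _ _ _ s2) (And.intro (hpat _ _ _ s3)
        (hpat _ _ _ s4)))
  refine ⟨hz, ?_, ?_, ?_, ?_, ?_⟩
  · intro i j k hij hjk hk h1 h2 h3
    exact decide_eq_true (hcA i j k hij hjk hk (of_decide_eq_true h1) (of_decide_eq_true h2)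
      (of_decide_eq_true h3))
  · intro i j k l hi hij hjk hkl hl
    obtain ⟨⟨a1, a2⟩, ⟨a3, a4⟩, ⟨a5, a6⟩, ⟨a7, a8⟩⟩ := hsig' i j k l hi hij hjk hkl hl
    exact ⟨a1, a2, a3, a4, a5, a6, a7, a8⟩
  · intro i j k l hij hjk hkl hl h1 h2 h3 h4
    rcases Nat.eq_zero_or_pos i with rfl | hi
    · rw [hz j k hij hjk (by omega), hz j l hij (by omega) hl]
    · have c1 := of_decide_eq_true h1
      have c2 := hcol j (by omega) (of_decide_eq_false h2)
      have c3 := of_decide_eq_true h3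
      have c4 := of_decide_eq_true h4
      have pikl := hcA i k l (by omega) hkl hl c1 c3 c4
      obtain ⟨⟨a1, a2⟩, ⟨a3, a4⟩, -, -⟩ := hsig' i j k l hi hij hjk hkl hl
      cases e1 : decide (0 < orient (x i) (x j) (x k)) <;>
        cases e2 : decide (0 < orient (x i) (x j) (x l))
      · rfl
      · exfalso
        cases e3 : decide (0 < orient (x j) (x k) (x l))
        · exact a4 ⟨e1, e2, e3⟩
        · refine sep_triangle (hA _ c1) (hA _ c3) (hA _ c4) (hB _ c2) (of_decide_eq_true e3).le
            (of_decide_eq_true e2).le ?_ pikl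
          rw [orient_swap]
          linarith [not_lt.1 (of_decide_eq_false e1)]
      · exact absurd ⟨e1, e2, decide_eq_true pikl⟩ a1
      · rfl
  · intro i j k l hij hjk hkl hl h1 h2 h3 h4
    have c1 := of_decide_eq_true h1
    have c2 := of_decide_eq_true h2
    have c3 := hcol k (by omega) (of_decide_eq_false h3)
    have c4 := of_decide_eq_true h4
    have pijl := hcA i j l hij (by omega) hl c1 c2 c4
    have hno : 0 < orient (x i) (x j) (x k) → 0 < orient (x i) (x k) (x l) →
        ¬ orient (x j) (x k) (x l) ≤ 0 := by
      intro g1 g2 g3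
      refine sep_triangle (hA _ c1) (hA _ c2) (hA _ c4) (hB _ c3) ?_ g2.le g1.le pijl
      rw [← orient_rot (x k) (x j) (x l), orient_swap]; linarith
    cases e1 : decide (0 < orient (x i) (x k) (x l)) <;>
        cases e2 : decide (0 < orient (x j) (x k) (x l))
    · rfl
    · exfalso
      rcases Nat.eq_zero_or_pos i with rfl | hi
      · rw [hz k l (by omega) hkl hl] at e1; cases e1
      · obtain ⟨-, -, -, ⟨a7, a8⟩⟩ := hsig' i j k l hi hij hjk hkl hl
        exact a7 ⟨decide_eq_true pijl, e1, e2⟩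
    · exfalso
      have g2 := of_decide_eq_true e1
      have g3 := not_lt.1 (of_decide_eq_false e2)
      rcases Nat.eq_zero_or_pos i with rfl | hi
      · exact hno (hs.pos j k hij hjk (by omega)) g2 g3
      · obtain ⟨-, -, ⟨a5, a6⟩, -⟩ := hsig' i j k l hi hij hjk hkl hl
        cases e3 : decide (0 < orient (x i) (x j) (x k))
        · exact a6 ⟨e3, e1, e2⟩
        · exact hno (of_decide_eq_true e3) g2 g3
    · rfl
  · intro a b c' d e hab hbc hcd hde he h1 h2
    set I : Finset ℕ := {a, b, c', d, e} with hI
    have hIn : ∀ i ∈ I, i < n := by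
      intro i hi
      simp only [hI, Finset.mem_insert, Finset.mem_singleton] at hi
      omega
    have hIc : I.card = 5 := by
      rw [hI, Finset.card_insert_of_notMem, Finset.card_insert_of_notMem,
        Finset.card_insert_of_notMem, Finset.card_insert_of_notMem, Finset.card_singleton] <;>
        simp only [Finset.mem_insert, Finset.mem_singleton] <;> omega
    have hinj : Set.InjOn x (↑I : Set ℕ) := by
      intro i hi j hj h
      exact hs.inj i (hIn i hi) j (hIn j hj) h
    set H : Finset Pt := I.image x with hH
    have hHc : H.card = 5 := by rw [hH, Finset.card_image_of_injOn hinj, hIc]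
    have hHP : H ⊆ A ∪ B := by
      intro y hy
      obtain ⟨i, hi, rfl⟩ := Finset.mem_image.1 hy
      exact hs.mem i (hIn i hi)
    have hIA : ∃ i ∈ I, x i ∈ A := by
      simp only [decide_eq_true_eq] at h1
      rcases h1 with h | h | h | h | h
      · exact ⟨a, by simp [hI], h⟩
      · exact ⟨b, by simp [hI], h⟩
      · exact ⟨c', by simp [hI], h⟩
      · exact ⟨d, by simp [hI], h⟩
      · exact ⟨e, by simp [hI], h⟩
    have hIB : ∃ i ∈ I, x i ∈ B := by
      by_contra hcon
      push Not at hcon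
      have hall : ∀ i ∈ I, x i ∈ A := by
        intro i hi
        by_contra hiA
        exact hcon i hi (hcol i (hIn i hi) hiA)
      apply h2
      simp only [decide_eq_true_eq]
      exact ⟨hall a (by simp [hI]), hall b (by simp [hI]), hall c' (by simp [hI]),
        hall d (by simp [hI]), hall e (by simp [hI])⟩
    have hinside : ∃ m < n, x m ∈ convexHull ℝ (↑(H.erase (x m)) : Set Pt) := by
      by_contra hcon
      push Not at hcon
      apply hnh
      refine ⟨H, ⟨hHP, hHc, ?_, ?_⟩, ?_, ?_⟩
      · intro p hp hp2
        obtain ⟨m, hm, rfl⟩ := hs.surj p (hHP hp)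
        apply hcon m hm
        rw [Finset.coe_erase]; exact hp2
      · intro p hp hpH hp2
        obtain ⟨m, hm, rfl⟩ := hs.surj p hp
        apply hcon m hm
        rw [Finset.erase_eq_of_notMem hpH]; exact hp2
      · obtain ⟨i, hi, h⟩ := hIA
        exact ⟨x i, Finset.mem_coe.2 (Finset.mem_image_of_mem x hi), h⟩
      · obtain ⟨i, hi, h⟩ := hIB
        exact ⟨x i, Finset.mem_coe.2 (Finset.mem_image_of_mem x hi), h⟩
    obtain ⟨m, hm, hmem⟩ := hinside
    have h3 : 3 ≤ (H.erase (x m)).card := by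
      have := Finset.pred_card_le_card_erase (s := H) (a := x m)
      omega
    obtain ⟨T, hT, hTc, hmT⟩ := caratheodory_three h3 hmem
    have hTH : T ⊆ I.image x := fun y hy => Finset.mem_of_mem_erase (hT hy)
    obtain ⟨J, hJ, hJT⟩ := Finset.subset_image_iff.1 hTH
    have hJc : J.card = 3 := by
      rw [← hTc, ← hJT, Finset.card_image_of_injOn]
      exact hinj.mono hJ
    obtain ⟨p, q, r, hpq, hqr, rfl⟩ := sorted_three hJc
    have hmem' : ∀ i ∈ ({p, q, r} : Finset ℕ), i ∈ I ∧ m ≠ i := by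
      intro i hi
      refine ⟨hJ hi, ?_⟩
      rintro rfl
      have h5 : x m ∈ T := by rw [← hJT]; exact Finset.mem_image_of_mem x hi
      exact (Finset.mem_erase.1 (hT h5)).1 rfl
    have mp := hmem' p (by simp)
    have mq := hmem' q (by simp)
    have mr := hmem' r (by simp)
    have hcast : (↑T : Set Pt) = {x p, x q, x r} := by
      rw [← hJT]; ext y; simp
    rw [hcast] at hmT
    have hfin := hs.inside hgen hpq hqr (hIn r mr.1) hm mp.2 mq.2 mr.2 hmT
    refine ⟨(p, q, r), ?_, m, hm, hfin⟩
    simp only [hI, Finset.mem_insert, Finset.mem_singleton] at mp mq mr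
    exact triple_mem_triplesOf hab hbc hcd hde hpq hqr mp.1 mq.1 mr.1

/-! ### Sorting the points around `a` -/

/-- Slope of a point as seen from `a`, with respect to the direction `u`. -/
def slopeAt (u a y : Pt) : ℝ := cross2 u (y - a) / dotp u (y - a)

theorem slopeAt_lt {u a y z : Pt} (hy : 0 < dotp u (y - a)) (hz : 0 < dotp u (z - a)) :
    slopeAt u a y < slopeAt u a z ↔ 0 < orient a y z := by
  have hid : (u.1 ^ 2 + u.2 ^ 2) * orient a y z =
      dotp u (y - a) * cross2 u (z - a) - cross2 u (y - a) * dotp u (z - a) := by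
    simp only [orient, cross2, dotp]; ring
  have hu : 0 < u.1 ^ 2 + u.2 ^ 2 := by
    by_contra hcon
    have h1 : u.1 = 0 := by nlinarith [sq_nonneg u.1, sq_nonneg u.2]
    have h2 : u.2 = 0 := by nlinarith [sq_nonneg u.1, sq_nonneg u.2]
    simp [dotp, h1, h2] at hy
  unfold slopeAt
  rw [div_lt_div_iff₀ hy hz, ← mul_pos_iff_of_pos_left hu, hid]
  constructor <;> intro h <;> linarith

theorem exists_direction {A : Finset Pt} {a : Pt} (ha : a ∈ A) (hAconv : ConvexPos (↑A : Set Pt)) :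
    ∃ u : Pt, ∀ y ∈ A.erase a, 0 < dotp u (y - a) := by
  have h1 := hAconv a ha
  have hfin : ((↑A : Set Pt) \ {a}).Finite := A.finite_toSet.subset Set.sdiff_subset
  obtain ⟨f, s, hf1, hf2⟩ := geometric_hahn_banach_point_closed
    (convex_convexHull ℝ ((↑A : Set Pt) \ {a})) (hfin.isClosed_convexHull (𝕜 := ℝ)) h1
  refine ⟨(f (1, 0), f (0, 1)), ?_⟩
  intro y hy
  have hy' : y ∈ (↑A : Set Pt) \ {a} :=
    ⟨Finset.mem_of_mem_erase hy, (Finset.mem_erase.1 hy).1⟩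
  have h2 := hf2 y (subset_convexHull ℝ _ hy')
  have h3 : f (y - a) = dotp (f (1, 0), f (0, 1)) (y - a) := by
    have : y - a = (y - a).1 • ((1, 0) : Pt) + (y - a).2 • ((0, 1) : Pt) := by
      ext <;> simp
    conv_lhs => rw [this]
    rw [map_add, map_smul, map_smul]
    simp only [dotp, smul_eq_mul]; ring
  rw [← h3, map_sub]
  linarith

theorem wedge_nonconvex {a p q : Pt} (h : 0 < orient a p q) : ¬ Convex ℝ (Wedge a p q) := by
  intro hc
  have hn : ¬ cross2 (p - a) (q - a) ≤ 0 := not_le.2 h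
  unfold Wedge at hc
  rw [if_neg hn] at hc
  have hp : p ∈ {x : Pt | cross2 (p - a) (x - a) ≤ 0 ∨ 0 ≤ cross2 (q - a) (x - a)} := by
    left; apply le_of_eq; simp only [cross2]; ring
  have hq : q ∈ {x : Pt | cross2 (p - a) (x - a) ≤ 0 ∨ 0 ≤ cross2 (q - a) (x - a)} := by
    right; apply ge_of_eq; simp only [cross2]; ring
  have hm := hc hp hq (a := 1 / 2) (b := 1 / 2) (by norm_num) (by norm_num) (by norm_num)
  rw [orient_def] at h
  rcases hm with hm | hm
  · simp only [cross2, Prod.fst_add, Prod.snd_add, Prod.smul_fst, Prod.smul_snd, Prod.fst_sub,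
      Prod.snd_sub, smul_eq_mul] at hm
    nlinarith
  · simp only [cross2, Prod.fst_add, Prod.snd_add, Prod.smul_fst, Prod.smul_snd, Prod.fst_sub,
      Prod.snd_sub, smul_eq_mul] at hm
    nlinarith

theorem exists_sorted_enum (S : Finset Pt) (κ : Pt → ℝ) (hκ : Set.InjOn κ (↑S : Set Pt)) :
    ∃ y : ℕ → Pt, (∀ i < S.card, y i ∈ S) ∧
      (∀ i j, i < j → j < S.card → κ (y i) < κ (y j)) ∧ ∀ s ∈ S, ∃ i < S.card, y i = s := by
  have hc : (S.image κ).card = S.card := Finset.card_image_of_injOn hκ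
  set e := (S.image κ).orderEmbOfFin hc with he
  have h1 : ∀ i : Fin S.card, ∃ s ∈ S, κ s = e i := by
    intro i
    exact Finset.mem_image.1 (Finset.orderEmbOfFin_mem _ hc i)
  choose g hg1 hg2 using h1
  refine ⟨fun i => if h : i < S.card then g ⟨i, h⟩ else 0, ?_, ?_, ?_⟩
  · intro i hi
    simp only [hi, dif_pos]
    exact hg1 _
  · intro i j hij hj
    have hi : i < S.card := by omega
    simp only [hi, hj, dif_pos, hg2]
    exact e.strictMono hij
  · intro s hs
    have h2 : κ s ∈ Set.range e := by
      rw [he, Finset.range_orderEmbOfFin]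
      exact Finset.mem_coe.2 (Finset.mem_image_of_mem κ hs)
    obtain ⟨i, hi⟩ := h2
    refine ⟨i, i.2, ?_⟩
    simp only [i.2, dif_pos]
    apply hκ (hg1 _) hs
    rw [hg2, ← hi]

/-- **Lemma 12.** Let `P = A ∪ B` be an `ℓ`-divided set with no `ℓ`-divided 5-hole,
`5 ≤ |A| ≤ 6`, `|B| = 4`, and `A` in convex position. Then for every point `a` of `A`,
if the non-convex `a`-wedge contains no point of `B`, then every `a`-wedge contains at
most two points of `B`. -/
theorem wedge_at_most_two_III
    (v : Pt) (hv : v ≠ 0) (c : ℝ) (A B : Finset Pt)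
    (hA : ∀ p ∈ A, dotp v p < c) (hB : ∀ p ∈ B, c < dotp v p)
    (hgen : GenPos (↑(A ∪ B) : Set Pt))
    (hnh : ¬ ∃ H : Finset Pt, DividedFiveHole A B H)
    (hA5 : 5 ≤ A.card) (hA6 : A.card ≤ 6) (hBcard : B.card = 4)
    (hAconv : ConvexPos (↑A : Set Pt)) :
    ∀ a ∈ A,
      (∀ W : Set Pt, IsAWedge A a W → ¬ Convex ℝ W → (↑B : Set Pt) ∩ W = ∅) →
      ∀ W : Set Pt, IsAWedge A a W → ((↑B : Set Pt) ∩ W).ncard ≤ 2 := by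
  intro a ha hw W hW
  have hdisj : ∀ p ∈ B, p ∉ A := fun p hp hp' => by linarith [hA p hp', hB p hp]
  obtain ⟨u, hu⟩ := exists_direction ha hAconv
  set κ : Pt → ℝ := slopeAt u a with hκ
  -- the extremal directions
  have hne : (A.erase a).Nonempty := by
    rw [← Finset.card_pos, Finset.card_erase_of_mem ha]; omega
  obtain ⟨p, hp, hpmin⟩ := Finset.exists_min_image (A.erase a) κ hne
  obtain ⟨q, hq, hqmax⟩ := Finset.exists_max_image (A.erase a) κ hne
  have hpA := Finset.mem_of_mem_erase hp
  have hqA := Finset.mem_of_mem_erase hq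
  have hAP : ∀ y ∈ A, y ∈ (↑(A ∪ B) : Set Pt) := fun y hy =>
    Finset.mem_coe.2 (Finset.mem_union_left _ hy)
  have htri : ∀ y ∈ (A ∪ B).erase a, ∀ z ∈ (A ∪ B).erase a, 0 < dotp u (y - a) →
      0 < dotp u (z - a) → y ≠ z → κ y ≤ κ z → κ y < κ z := by
    intro y hy z hz huy huz hyz hle
    have h1 := orient_ne hgen (hAP a ha) (Finset.mem_of_mem_erase hy) (Finset.mem_of_mem_erase hz)
      (Finset.mem_erase.1 hy).1.symm (Finset.mem_erase.1 hz).1.symm hyz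
    have h2 : ¬ κ z < κ y := not_lt.2 hle
    rw [hκ, slopeAt_lt huz huy, orient_swap] at h2
    rw [hκ, slopeAt_lt huy huz]
    exact lt_of_le_of_ne (by linarith) (Ne.symm h1)
  have hsub : ∀ y ∈ A.erase a, y ∈ (A ∪ B).erase a := fun y hy =>
    Finset.mem_erase.2 ⟨(Finset.mem_erase.1 hy).1,
      Finset.mem_union_left _ (Finset.mem_of_mem_erase hy)⟩
  have hpmin' : ∀ y ∈ A.erase a, y ≠ p → 0 < orient a p y := fun y hy hyp => by
    rw [← slopeAt_lt (hu p hp) (hu y hy)]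
    exact htri p (hsub p hp) y (hsub y hy) (hu p hp) (hu y hy) (Ne.symm hyp) (hpmin y hy)
  have hqmax' : ∀ y ∈ A.erase a, y ≠ q → 0 < orient a y q := fun y hy hyq => by
    rw [← slopeAt_lt (hu y hy) (hu q hq)]
    exact htri y (hsub y hy) q (hsub q hq) (hu y hy) (hu q hq) hyq (hqmax y hy)
  have hpq : p ≠ q := by
    intro h
    have h1 : 1 < (A.erase a).card := by rw [Finset.card_erase_of_mem ha]; omega
    obtain ⟨y, hy, hyp⟩ := Finset.exists_mem_ne h1 p
    have h2 := hpmin' y hy hyp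
    have h3 := hqmax' y hy (by rw [← h]; exact hyp)
    rw [← h, orient_swap] at h3
    linarith
  have hopq : 0 < orient a p q := hpmin' q hq (Ne.symm hpq)
  have hopq' : ¬ cross2 (p - a) (q - a) ≤ 0 := not_le.2 hopq
  have hWn : IsAWedge A a (Wedge a p q) := by
    refine ⟨p, hp, q, hq, hpq, rfl, ?_⟩
    rintro y ⟨hyA, hyW⟩
    by_contra hcon
    simp only [Set.mem_insert_iff, Set.mem_singleton_iff, not_or] at hcon
    have hy : y ∈ A.erase a := Finset.mem_erase.2 ⟨hcon.1, hyA⟩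
    have h1 : 0 < cross2 (p - a) (y - a) := hpmin' y hy hcon.2.1
    have h2 : 0 < orient a y q := hqmax' y hy hcon.2.2
    rw [orient_swap] at h2
    have h3 : cross2 (q - a) (y - a) < 0 := by
      have : orient a q y = cross2 (q - a) (y - a) := rfl
      linarith
    unfold Wedge at hyW
    rw [if_neg hopq'] at hyW
    rcases hyW with h | h <;> linarith
  have hBW := hw _ hWn (wedge_nonconvex hopq)
  have hBpos : ∀ b ∈ B, 0 < orient a p b ∧ 0 < orient a b q := by
    intro b hb
    have h1 : b ∉ Wedge a p q := fun h => by
      have : b ∈ (↑B : Set Pt) ∩ Wedge a p q := ⟨hb, h⟩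
      rw [hBW] at this; exact this
    unfold Wedge at h1
    rw [if_neg hopq'] at h1
    simp only [Set.mem_setOf_eq, not_or, not_le] at h1
    refine ⟨h1.1, ?_⟩
    rw [orient_swap]
    have : orient a q b = cross2 (q - a) (b - a) := rfl
    linarith [h1.2]
  have huB : ∀ b ∈ B, 0 < dotp u (b - a) := by
    intro b hb
    obtain ⟨h1, h2⟩ := hBpos b hb
    have hid : orient a p q * dotp u (b - a) =
        orient a b q * dotp u (p - a) + orient a p b * dotp u (q - a) := by
      simp only [orient, cross2, dotp]; ring
    have h3 := mul_pos h2 (hu p hp)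
    have h4 := mul_pos h1 (hu q hq)
    by_contra hcon
    have := mul_nonpos_of_nonneg_of_nonpos hopq.le (not_lt.1 hcon)
    linarith
  have huP : ∀ y ∈ (A ∪ B).erase a, 0 < dotp u (y - a) := by
    intro y hy
    obtain ⟨h1, h2⟩ := Finset.mem_erase.1 hy
    rcases Finset.mem_union.1 h2 with h3 | h3
    · exact hu y (Finset.mem_erase.2 ⟨h1, h3⟩)
    · exact huB y h3
  have hinj : Set.InjOn κ (↑((A ∪ B).erase a) : Set Pt) := by
    intro y hy z hz h
    by_contra hyz
    exact (htri y hy z hz (huP y hy) (huP z hz) hyz h.le).ne h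
  obtain ⟨y, hy1, hy2, hy3⟩ := exists_sorted_enum _ κ hinj
  have haP : a ∈ A ∪ B := Finset.mem_union_left _ ha
  have hcardP : (A ∪ B).card = A.card + 4 := by
    rw [Finset.card_union_of_disjoint, hBcard]
    rw [Finset.disjoint_left]
    exact fun z hz hz' => hdisj z hz' hz
  have hcardS : ((A ∪ B).erase a).card = A.card + 3 := by
    rw [Finset.card_erase_of_mem haP, hcardP]; omega
  rw [hcardS] at hy1 hy2 hy3
  set n := A.card + 4 with hn
  set x : ℕ → Pt := fun i => if i = 0 then a else y (i - 1) with hx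
  have hx0 : x 0 = a := by simp [hx]
  have hxs : ∀ i, 0 < i → x i = y (i - 1) := by
    intro i hi
    simp only [hx]
    rw [if_neg (by omega)]
  have hxS : ∀ i, 0 < i → i < n → x i ∈ (A ∪ B).erase a := by
    intro i hi hin
    rw [hxs i hi]; exact hy1 _ (by omega)
  have hxlt : ∀ i j, 0 < i → i < j → j < n → κ (x i) < κ (x j) := by
    intro i j hi hij hj
    rw [hxs i hi, hxs j (by omega)]
    exact hy2 _ _ (by omega) (by omega)
  have hsurj : ∀ z ∈ (A ∪ B).erase a, ∃ i, 0 < i ∧ i < n ∧ x i = z := by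
    intro z hz
    obtain ⟨i, hi, h⟩ := hy3 z hz
    refine ⟨i + 1, by omega, by omega, ?_⟩
    rw [hxs _ (by omega)]; exact h
  have hSort : Sorted A B n x := by
    refine ⟨?_, ?_, ?_, ?_, ?_⟩
    · intro i hi
      rcases Nat.eq_zero_or_pos i with rfl | h
      · rw [hx0]; exact haP
      · exact Finset.mem_of_mem_erase (hxS i h hi)
    · have key : ∀ i j, i < j → j < n → x i ≠ x j := by
        intro i j hij hj h
        rcases Nat.eq_zero_or_pos i with rfl | hi
        · rw [hx0] at h
          exact (Finset.mem_erase.1 (hxS j hij hj)).1 h.symm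
        · have := hxlt i j hi hij hj
          rw [h] at this
          exact lt_irrefl _ this
      intro i hi j hj h
      rcases lt_trichotomy i j with h1 | h1 | h1
      · exact absurd h (key i j h1 hj)
      · exact h1
      · exact absurd h.symm (key j i h1 hi)
    · intro z hz
      by_cases hza : z = a
      · exact ⟨0, by omega, by rw [hx0, hza]⟩
      · obtain ⟨i, -, hi, h⟩ := hsurj z (Finset.mem_erase.2 ⟨hza, hz⟩)
        exact ⟨i, hi, h⟩
    · rw [hx0]; exact ha
    · intro j k hj hjk hk
      rw [hx0, ← slopeAt_lt (huP _ (hxS j hj (by omega))) (huP _ (hxS k (by omega) hk))]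
      exact hxlt j k hj hjk hk
  have hcfg := hSort.cfg hA hB hgen hnh hAconv
  have hcolB : ∀ i < n, x i ∉ A → x i ∈ B := fun i hi h =>
    (Finset.mem_union.1 (hSort.mem i hi)).resolve_left h
  -- the first and the last points are in `A`
  have hfirst : x 1 ∈ A := by
    by_contra hcon
    have hb := hcolB 1 (by omega) hcon
    have h1 := (hBpos _ hb).1
    rw [← slopeAt_lt (hu p hp) (huB _ hb)] at h1
    obtain ⟨i, hi0, hin, hi⟩ := hsurj p (hsub p hp)
    have hi1 : i ≠ 1 := by rintro rfl; rw [hi] at hcon; exact hcon hpA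
    have h2 := hxlt 1 i (by omega) (by omega) hin
    rw [hi] at h2
    exact lt_asymm h1 h2
  have hlast : x (n - 1) ∈ A := by
    by_contra hcon
    have hb := hcolB (n - 1) (by omega) hcon
    have h1 := (hBpos _ hb).2
    rw [← slopeAt_lt (huB _ hb) (hu q hq)] at h1
    obtain ⟨i, hi0, hin, hi⟩ := hsurj q (hsub q hq)
    have hi1 : i ≠ n - 1 := by rintro rfl; rw [hi] at hcon; exact hcon hqA
    have h2 := hxlt i (n - 1) (by omega) (by omega) (by omega)
    rw [hi] at h2
    exact lt_asymm h1 h2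
  have hcount : ((Finset.range n).filter (fun i => decide (x i ∈ A) = false)).card = 4 := by
    have himg : ((Finset.range n).filter (fun i => decide (x i ∈ A) = false)).image x = B := by
      ext z
      simp only [Finset.mem_image, Finset.mem_filter, Finset.mem_range, decide_eq_false_iff_not]
      constructor
      · rintro ⟨i, ⟨hi, h⟩, rfl⟩
        exact hcolB i hi h
      · intro hz
        obtain ⟨i, hi, rfl⟩ := hSort.surj z (Finset.mem_union_right _ hz)
        exact ⟨i, ⟨hi, hdisj _ hz⟩, rfl⟩
    rw [← hBcard, ← himg, Finset.card_image_of_injOn]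
    intro i hi j hj h
    have hi' := Finset.mem_range.1 (Finset.mem_filter.1 (Finset.mem_coe.1 hi)).1
    have hj' := Finset.mem_range.1 (Finset.mem_filter.1 (Finset.mem_coe.1 hj)).1
    exact hSort.inj i hi' j hj' h
  -- the wedge
  obtain ⟨s, hs, t, ht, hst, hWdef, hWA⟩ := hW
  by_cases hcross : cross2 (s - a) (t - a) ≤ 0
  swap
  · have h0 := hw W ⟨s, hs, t, ht, hst, hWdef, hWA⟩
      (by rw [hWdef]; exact wedge_nonconvex (not_le.1 hcross))
    rw [h0]; simp
  by_contra hcon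
  have hfinW : ((↑B : Set Pt) ∩ W).Finite := B.finite_toSet.subset Set.inter_subset_left
  obtain ⟨b1, b2, b3, hb1, hb2, hb3, hb12, hb13, hb23⟩ :=
    (Set.two_lt_ncard_iff hfinW).1 (not_le.1 hcon)
  have hWmem : ∀ z, 0 < dotp u (z - a) → (z ∈ W ↔ κ z ≤ κ s ∧ κ t ≤ κ z) := by
    intro z hz
    have e1 : κ z ≤ κ s ↔ orient a s z ≤ 0 := by
      rw [← not_lt, hκ, slopeAt_lt (hu s hs) hz, not_lt]
    have e2 : κ t ≤ κ z ↔ 0 ≤ orient a t z := by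
      have h := slopeAt_lt hz (hu t ht)
      rw [orient_swap, neg_pos] at h
      rw [← not_lt, hκ, h, not_lt]
    rw [hWdef, e1, e2]
    unfold Wedge
    rw [if_pos hcross]
    exact Iff.rfl
  have hidx : ∃ i j k, i < j ∧ j < k ∧ 0 < i ∧ k < n ∧ x i ∈ (↑B : Set Pt) ∩ W ∧
      x k ∈ (↑B : Set Pt) ∩ W := by
    have hS : ∀ b ∈ (↑B : Set Pt) ∩ W, b ∈ (A ∪ B).erase a := by
      rintro b ⟨hb, -⟩
      refine Finset.mem_erase.2 ⟨?_, Finset.mem_union_right _ hb⟩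
      rintro rfl
      exact hdisj _ hb ha
    obtain ⟨i1, p1, l1, rfl⟩ := hsurj b1 (hS _ hb1)
    obtain ⟨i2, p2, l2, rfl⟩ := hsurj b2 (hS _ hb2)
    obtain ⟨i3, p3, l3, rfl⟩ := hsurj b3 (hS _ hb3)
    have n12 : i1 ≠ i2 := fun h => hb12 (by rw [h])
    have n13 : i1 ≠ i3 := fun h => hb13 (by rw [h])
    have n23 : i2 ≠ i3 := fun h => hb23 (by rw [h])
    have hc3 : ({i1, i2, i3} : Finset ℕ).card = 3 := Finset.card_eq_three.2
      ⟨i1, i2, i3, n12, n13, n23, rfl⟩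
    have hall : ∀ i ∈ ({i1, i2, i3} : Finset ℕ), 0 < i ∧ i < n ∧ x i ∈ (↑B : Set Pt) ∩ W := by
      intro i hi
      simp only [Finset.mem_insert, Finset.mem_singleton] at hi
      rcases hi with rfl | rfl | rfl
      · exact ⟨p1, l1, hb1⟩
      · exact ⟨p2, l2, hb2⟩
      · exact ⟨p3, l3, hb3⟩
    obtain ⟨i, j, k, hij, hjk, he⟩ := sorted_three hc3
    rw [he] at hall
    have g1 := hall i (by simp)
    have g3 := hall k (by simp)
    exact ⟨i, j, k, hij, hjk, g1.1, g3.2.1, g1.2.2, g3.2.2⟩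
  obtain ⟨i, j, k, hij, hjk, hi0, hkn, hiB, hkB⟩ := hidx
  have hbetween : ∀ m, i ≤ m → m ≤ k → decide (x m ∈ A) = false := by
    intro m him hmk
    rw [decide_eq_false_iff_not]
    intro hmA
    have h1 : i ≠ m := by rintro rfl; exact hdisj _ hiB.1 hmA
    have h2 : m ≠ k := by rintro rfl; exact hdisj _ hkB.1 hmA
    have k1 := hxlt i m hi0 (by omega) (by omega)
    have k2 := hxlt m k (by omega) (by omega) hkn
    have w1 := (hWmem _ (huB _ hiB.1)).1 hiB.2
    have w2 := (hWmem _ (huB _ hkB.1)).1 hkB.2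
    have hmS := hxS m (by omega) (by omega)
    have hmW : x m ∈ W := (hWmem _ (huP _ hmS)).2 ⟨by linarith [w2.1], by linarith [w1.2]⟩
    have h3 := hWA ⟨hmA, by rw [← hWdef]; exact hmW⟩
    simp only [Set.mem_insert_iff, Set.mem_singleton_iff] at h3
    rcases h3 with h3 | h3 | h3
    · exact (Finset.mem_erase.1 hmS).1 h3
    · rw [h3] at k2; linarith [w2.1]
    · rw [h3] at k1; linarith [w1.2]
  have hthree : ∃ i, i + 2 < n ∧ decide (x i ∈ A) = false ∧ decide (x (i + 1) ∈ A) = false ∧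
      decide (x (i + 2) ∈ A) = false :=
    ⟨i, by omega, hbetween i (by omega) (by omega), hbetween (i + 1) (by omega) (by omega),
      hbetween (i + 2) (by omega) (by omega)⟩
  have hc0 : decide (x 0 ∈ A) = true := decide_eq_true hSort.zero
  have hc1 : decide (x 1 ∈ A) = true := decide_eq_true hfirst
  have hcl : decide (x (n - 1) ∈ A) = true := decide_eq_true hlast
  have hn' : n = 9 ∨ n = 10 := by omega
  clear_value n
  rcases hn' with rfl | rfl
  · exact no_cfg_nine hcfg hc0 hc1 hcl hcount hthree
  · exact no_cfg_ten hcfg hc0 hc1 hcl hcount hthree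

end
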